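/- Let 𝒪⁺ (resp. 𝒪⁻) be a set of representatives for the isomorphism classes of irreducible cubic orders with positive (resp. negative) discriminant. Then for each sign, as X → ∞, the ratio (Σ over O in the given set with |disc(O)| < X of #I(O)[2]) / #{O in the given set : |disc(O)| < X} tends to ζ(2)/ζ(4). -/

import Mathlib

open scoped TensorProduct

/-- The discriminant of a commutative ring that is finite and free as a `ℤ`-module:
the discriminant of the trace form with respect to a `ℤ`-basis (independent of the basis). -/
noncomputable def ringDisc (O : Type*) [CommRing O] [Module.Free ℤ O] [Module.Finite ℤ O] : ℤ :=
  Algebra.discr ℤ (Module.Free.chooseBasis ℤ O)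

/-- The number of `2`-torsion elements of the class group (the group of invertible
fractional ideals modulo principal fractional ideals) of a domain `O`
(junk value `0` if `O` is not a domain). -/
noncomputable def classGroupTwoTorsion (O : Type*) [CommRing O] : ℕ := by
  classical exact
    if h : IsDomain O then
      letI := h
      Nat.card {x : ClassGroup O // x ^ 2 = 1}
    else 0

/-- The number of `2`-torsion elements of the group of invertible fractional ideals of `O`,
i.e. the number of invertible fractional ideals `I` with `I² = O`. -/
noncomputable def idealGroupTwoTorsion (O : Type*) [CommRing O] : ℕ :=
  Nat.card {I : (FractionalIdeal (nonZeroDivisors O) (FractionRing O))ˣ // I ^ 2 = 1}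

/-- `O` is an irreducible cubic order: free of rank `3` over `ℤ` with `ℚ ⊗ O` a field. -/
def IsIrredCubicOrder (O : Type*) [CommRing O] [Module.Free ℤ O] [Module.Finite ℤ O] : Prop :=
  Module.finrank ℤ O = 3 ∧ IsField (ℚ ⊗[ℤ] O)

/-- The value of the binary cubic form with coefficients `f` at `(X, Y)`. -/
def cubicEval {R : Type*} [CommRing R] (f : Fin 4 → R) (X Y : R) : R :=
  f 0 * X ^ 3 + f 1 * X ^ 2 * Y + f 2 * X * Y ^ 2 + f 3 * Y ^ 3

/-- The discriminant of a binary cubic form. -/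
def cubicDisc {R : Type*} [CommRing R] (f : Fin 4 → R) : R :=
  f 1 ^ 2 * f 2 ^ 2 - 4 * f 0 * f 2 ^ 3 - 4 * f 1 ^ 3 * f 3 - 27 * f 0 ^ 2 * f 3 ^ 2 +
    18 * f 0 * f 1 * f 2 * f 3

/-- The binary cubic form `f(pX + qY, rX + sY)`. -/
def cubicSubst {R : Type*} [CommRing R] (p q r s : R) (f : Fin 4 → R) : Fin 4 → R :=
  ![f 0 * p ^ 3 + f 1 * p ^ 2 * r + f 2 * p * r ^ 2 + f 3 * r ^ 3,
    3 * f 0 * p ^ 2 * q + f 1 * (p ^ 2 * s + 2 * p * q * r) +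
      f 2 * (2 * p * r * s + q * r ^ 2) + 3 * f 3 * r ^ 2 * s,
    3 * f 0 * p * q ^ 2 + f 1 * (q ^ 2 * r + 2 * p * q * s) +
      f 2 * (p * s ^ 2 + 2 * q * r * s) + 3 * f 3 * r * s ^ 2,
    f 0 * q ^ 3 + f 1 * q ^ 2 * s + f 2 * q * s ^ 2 + f 3 * s ^ 3]

theorem cubicForm_ext {R : Type*} {f g : Fin 4 → R} (h0 : f 0 = g 0) (h1 : f 1 = g 1)
    (h2 : f 2 = g 2)
    (h3 : f 3 = g 3) : f = g := by
  funext i; fin_cases i <;> assumption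

section
variable {R S : Type*} [CommRing R] [CommRing S] (f : Fin 4 → R)

theorem cubicSubst_zero (p q r s : R) : cubicSubst p q r s f 0 =
    f 0 * p ^ 3 + f 1 * p ^ 2 * r + f 2 * p * r ^ 2 + f 3 * r ^ 3 := rfl

theorem cubicSubst_one (p q r s : R) : cubicSubst p q r s f 1 =
    3 * f 0 * p ^ 2 * q + f 1 * (p ^ 2 * s + 2 * p * q * r) +
      f 2 * (2 * p * r * s + q * r ^ 2) + 3 * f 3 * r ^ 2 * s := rfl

theorem cubicSubst_two (p q r s : R) : cubicSubst p q r s f 2 =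
    3 * f 0 * p * q ^ 2 + f 1 * (q ^ 2 * r + 2 * p * q * s) +
      f 2 * (p * s ^ 2 + 2 * q * r * s) + 3 * f 3 * r * s ^ 2 := rfl

theorem cubicSubst_three (p q r s : R) : cubicSubst p q r s f 3 =
    f 0 * q ^ 3 + f 1 * q ^ 2 * s + f 2 * q * s ^ 2 + f 3 * s ^ 3 := rfl

theorem cubicEval_subst (p q r s X Y : R) :
    cubicEval (cubicSubst p q r s f) X Y = cubicEval f (p * X + q * Y) (r * X + s * Y) := by
  simp only [cubicEval, cubicSubst_zero, cubicSubst_one, cubicSubst_two, cubicSubst_three]; ring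

theorem cubicDisc_subst (p q r s : R) :
    cubicDisc (cubicSubst p q r s f) = (p * s - q * r) ^ 6 * cubicDisc f := by
  simp only [cubicDisc, cubicSubst_zero, cubicSubst_one, cubicSubst_two, cubicSubst_three]; ring

theorem cubicSubst_subst (p q r s p' q' r' s' : R) :
    cubicSubst p' q' r' s' (cubicSubst p q r s f) =
      cubicSubst (p * p' + q * r') (p * q' + q * s') (r * p' + s * r') (r * q' + s * s') f := by
  apply cubicForm_ext <;>
  simp only [cubicSubst_zero, cubicSubst_one, cubicSubst_two, cubicSubst_three] <;> ring

theorem cubicSubst_id : cubicSubst 1 0 0 1 f = f := by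
  apply cubicForm_ext <;>
  simp only [cubicSubst_zero, cubicSubst_one, cubicSubst_two, cubicSubst_three] <;> ring

theorem cubicSubst_smul (p q r s t : R) :
    cubicSubst p q r s (t • f) = t • cubicSubst p q r s f := by
  apply cubicForm_ext <;>
  simp only [cubicSubst_zero, cubicSubst_one, cubicSubst_two, cubicSubst_three, Pi.smul_apply,
    smul_eq_mul] <;> ring

theorem cubicDisc_smul (t : R) : cubicDisc (t • f) = t ^ 4 * cubicDisc f := by
  simp only [cubicDisc, Pi.smul_apply, smul_eq_mul]; ring

theorem cubicEval_smul (t X Y : R) : cubicEval (t • f) X Y = t * cubicEval f X Y := by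
  simp only [cubicEval, Pi.smul_apply, smul_eq_mul]; ring

theorem cubicEval_map (φ : R →+* S) (X Y : R) :
    cubicEval (fun i => φ (f i)) (φ X) (φ Y) = φ (cubicEval f X Y) := by
  simp only [cubicEval, map_add, map_mul, map_pow]

theorem cubicDisc_map (φ : R →+* S) : cubicDisc (fun i => φ (f i)) = φ (cubicDisc f) := by
  simp only [cubicDisc, map_add, map_sub, map_mul, map_pow, map_ofNat]

theorem cubicSubst_map (φ : R →+* S) (p q r s : R) :
    cubicSubst (φ p) (φ q) (φ r) (φ s) (fun i => φ (f i)) =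
      fun i => φ (cubicSubst p q r s f i) := by
  apply cubicForm_ext <;>
  simp only [cubicSubst_zero, cubicSubst_one, cubicSubst_two, cubicSubst_three, map_add,
    map_mul, map_pow, map_ofNat]

end

/-- The form `g` is obtained from `f` by a matrix of `GL₂(ℤ)` (twisted action). -/
def CubicEquiv (f g : Fin 4 → ℤ) : Prop :=
  ∃ p q r s : ℤ, (p * s - q * r) ^ 2 = 1 ∧ g = (p * s - q * r) • cubicSubst p q r s f

theorem CubicEquiv.refl (f : Fin 4 → ℤ) : CubicEquiv f f :=
  ⟨1, 0, 0, 1, by norm_num, by rw [cubicSubst_id]; norm_num⟩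

theorem CubicEquiv.trans {f g h : Fin 4 → ℤ} (h₁ : CubicEquiv f g) (h₂ : CubicEquiv g h) :
    CubicEquiv f h := by
  obtain ⟨p, q, r, s, hd, rfl⟩ := h₁
  obtain ⟨p', q', r', s', hd', rfl⟩ := h₂
  refine ⟨p * p' + q * r', p * q' + q * s', r * p' + s * r', r * q' + s * s', ?_, ?_⟩
  · linear_combination (p' * s' - q' * r') ^ 2 * hd + hd'
  · rw [cubicSubst_smul, cubicSubst_subst, smul_smul]
    congr 1
    ring

theorem CubicEquiv.symm {f g : Fin 4 → ℤ} (h : CubicEquiv f g) : CubicEquiv g f := by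
  obtain ⟨p, q, r, s, hd, rfl⟩ := h
  obtain ⟨D, hD⟩ : ∃ D, D = p * s - q * r := ⟨_, rfl⟩
  rw [← hD] at hd ⊢
  have hdet : D * s * (D * p) - -D * q * (-D * r) = D := by
    linear_combination -D ^ 2 * hD + D * hd
  refine ⟨D * s, -D * q, -D * r, D * p, by rw [hdet, hd], ?_⟩
  rw [hdet, cubicSubst_smul, cubicSubst_subst, smul_smul]
  have h1 : p * (D * s) + q * (-D * r) = 1 := by rw [← hd, hD]; ring
  have h2 : p * (-D * q) + q * (D * p) = 0 := by ring
  have h3 : r * (D * s) + s * (-D * r) = 0 := by ring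
  have h4 : r * (-D * q) + s * (D * p) = 1 := by rw [← hd, hD]; ring
  rw [h1, h2, h3, h4, cubicSubst_id, ← sq, hd, one_smul]

theorem CubicEquiv.disc_eq {f g : Fin 4 → ℤ} (h : CubicEquiv f g) : cubicDisc g = cubicDisc f := by
  obtain ⟨p, q, r, s, hd, rfl⟩ := h
  rw [cubicDisc_smul, cubicDisc_subst]
  linear_combination (((p * s - q * r) ^ 2) ^ 4 + ((p * s - q * r) ^ 2) ^ 3 +
    ((p * s - q * r) ^ 2) ^ 2 + (p * s - q * r) ^ 2 + 1) * cubicDisc f * hd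

/-- `1, w, t` is a `ℤ`-basis of `O` whose multiplication table is the one attached
to the binary cubic form `f` (Delone–Faddeev). -/
structure IsFormBasis {O : Type*} [CommRing O] (f : Fin 4 → ℤ) (w t : O) : Prop where
  ww : w * w = ((-(f 0 * f 2) : ℤ) : O) + (f 1 : O) * w - (f 0 : O) * t
  tt : t * t = ((-(f 1 * f 3) : ℤ) : O) + (f 3 : O) * w - (f 2 : O) * t
  wt : w * t = ((-(f 0 * f 3) : ℤ) : O)
  ind : ∀ x y z : ℤ, (x : O) + y * w + z * t = 0 → x = 0 ∧ y = 0 ∧ z = 0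
  span : ∀ u : O, ∃ x y z : ℤ, u = (x : O) + y * w + z * t

section
variable {O : Type*} [CommRing O] {f g : Fin 4 → ℤ} {w t : O}

theorem IsFormBasis.ext_iff (h : IsFormBasis f w t) {x y z x' y' z' : ℤ}
    (e : (x : O) + y * w + z * t = x' + y' * w + z' * t) : x = x' ∧ y = y' ∧ z = z' := by
  have := h.ind (x - x') (y - y') (z - z') (by push_cast; linear_combination e)
  omega

/-- A `ℤ`-basis `1, w, t` becomes a form basis after translating `w` and `t` by integers. -/
theorem exists_isFormBasis_translate
    (ind : ∀ x y z : ℤ, (x : O) + y * w + z * t = 0 → x = 0 ∧ y = 0 ∧ z = 0)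
    (span : ∀ u : O, ∃ x y z : ℤ, u = (x : O) + y * w + z * t) :
    ∃ (i j : ℤ) (f : Fin 4 → ℤ), IsFormBasis f (w + i) (t + j) := by
  obtain ⟨n, i, j, hwt⟩ := span (w * t)
  have ind' : ∀ x y z : ℤ, (x : O) + y * (w - j) + z * (t - i) = 0 → x = 0 ∧ y = 0 ∧ z = 0 := by
    intro x y z h
    obtain ⟨h1, h2, h3⟩ := ind (x - y * j - z * i) y z (by push_cast; linear_combination h)
    subst h2 h3
    simpa using h1
  have span' : ∀ u : O, ∃ x y z : ℤ, u = (x : O) + y * (w - j) + z * (t - i) := by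
    intro u
    obtain ⟨x, y, z, rfl⟩ := span u
    exact ⟨x + y * j + z * i, y, z, by push_cast; ring⟩
  have hN : (w - j) * (t - i) = ((n + i * j : ℤ) : O) := by
    push_cast; linear_combination hwt
  obtain ⟨W, hW⟩ : ∃ W, W = w - (j : O) := ⟨_, rfl⟩
  obtain ⟨T, hT⟩ : ∃ T, T = t - (i : O) := ⟨_, rfl⟩
  obtain ⟨N, hN'⟩ : ∃ N, N = n + i * j := ⟨_, rfl⟩
  rw [← hW, ← hT, ← hN'] at hN
  simp only [← hW, ← hT] at ind' span'
  obtain ⟨A, B, C, h1⟩ := span' (W * W)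
  obtain ⟨D, E, F, h2⟩ := span' (T * T)
  have e1 := ind' (B * N + C * D) (C * E - N) (A + C * F) (by
    push_cast
    linear_combination (-T) * h1 - C * h2 + (W - B) * hN)
  have e2 := ind' (E * A + F * N) (D + E * B) (E * C - N) (by
    push_cast
    linear_combination (-W) * h2 - E * h1 + (T - F) * hN)
  refine ⟨-j, -i, ![-C, B, -F, E], ?_⟩
  have hW' : w + ((-j : ℤ) : O) = W := by rw [hW]; push_cast; ring
  have hT' : t + ((-i : ℤ) : O) = T := by rw [hT]; push_cast; ring
  rw [hW', hT']
  refine ⟨?_, ?_, ?_, ind', span'⟩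
  · have : A = -(-C * -F) := by linarith [e1.2.2]
    simp only [Matrix.cons_val]
    rw [h1, this]; push_cast; ring
  · have : D = -(B * E) := by linarith [e2.2.1]
    simp only [Matrix.cons_val]
    rw [h2, this]; push_cast; ring
  · have : N = -(-C * E) := by linarith [e1.2.1]
    simp only [Matrix.cons_val]
    rw [hN, this]

/-- Two form bases of the same ring have forms related by the base change matrix. -/
theorem IsFormBasis.form_eq (h : IsFormBasis f w t) {w' t' : O} (h' : IsFormBasis g w' t')
    {n p r k q s : ℤ} (hw : w' = n + p * w + r * t) (ht : t' = k + q * w + s * t) :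
    (p * s - q * r) ^ 2 = 1 ∧ g = (p * s - q * r) • cubicSubst p q r s f := by
  have hdet : (p * s - q * r) ^ 2 = 1 := by
    obtain ⟨x, y, z, e⟩ := h'.span w
    obtain ⟨x', y', z', e'⟩ := h'.span t
    have e1 := h.ext_iff (x := 0) (y := 1) (z := 0) (x' := x + y * n + z * k)
      (y' := y * p + z * q) (z' := y * r + z * s) (by
        push_cast; rw [hw, ht] at e; linear_combination e)
    have e2 := h.ext_iff (x := 0) (y := 0) (z := 1) (x' := x' + y' * n + z' * k)
      (y' := y' * p + z' * q) (z' := y' * r + z' * s) (by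
        push_cast; rw [hw, ht] at e'; linear_combination e')
    have : (p * s - q * r) * (y * z' - z * y') = 1 := by
      obtain ⟨_, h1, h2⟩ := e1
      obtain ⟨_, h3, h4⟩ := e2
      linear_combination (-(y' * r + z' * s)) * h1 + (y' * p + z' * q) * h2 - h4
    have hu : IsUnit (p * s - q * r) := IsUnit.of_mul_eq_one _ this
    rcases Int.isUnit_iff.1 hu with h | h <;> rw [h] <;> norm_num
  have eww := h'.ww
  have ett := h'.tt
  have ewt := h'.wt
  have hWW := h.ww
  have hTT := h.tt
  have hWT := h.wt
  subst hw ht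
  push_cast at eww ett ewt hWW hTT hWT
  obtain ⟨_, a1, a2⟩ := h.ext_iff
    (x := n ^ 2 - p ^ 2 * f 0 * f 2 - r ^ 2 * f 1 * f 3 - 2 * p * r * f 0 * f 3)
    (y := 2 * n * p + p ^ 2 * f 1 + r ^ 2 * f 3) (z := 2 * n * r - p ^ 2 * f 0 - r ^ 2 * f 2)
    (x' := -(g 0 * g 2) + g 1 * n - g 0 * k) (y' := g 1 * p - g 0 * q)
    (z' := g 1 * r - g 0 * s) (by
      push_cast
      linear_combination eww - (p : O) ^ 2 * hWW - (r : O) ^ 2 * hTT - 2 * (p : O) * r * hWT)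
  obtain ⟨_, b1, b2⟩ := h.ext_iff
    (x := k ^ 2 - q ^ 2 * f 0 * f 2 - s ^ 2 * f 1 * f 3 - 2 * q * s * f 0 * f 3)
    (y := 2 * k * q + q ^ 2 * f 1 + s ^ 2 * f 3) (z := 2 * k * s - q ^ 2 * f 0 - s ^ 2 * f 2)
    (x' := -(g 1 * g 3) + g 3 * n - g 2 * k) (y' := g 3 * p - g 2 * q)
    (z' := g 3 * r - g 2 * s) (by
      push_cast
      linear_combination ett - (q : O) ^ 2 * hWW - (s : O) ^ 2 * hTT - 2 * (q : O) * s * hWT)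
  obtain ⟨_, c1, c2⟩ := h.ext_iff
    (x := n * k - p * q * f 0 * f 2 - r * s * f 1 * f 3 - (p * s + q * r) * f 0 * f 3)
    (y := n * q + k * p + p * q * f 1 + r * s * f 3)
    (z := n * s + k * r - p * q * f 0 - r * s * f 2)
    (x' := -(g 0 * g 3)) (y' := 0) (z' := 0) (by
      push_cast
      linear_combination ewt - (p : O) * q * hWW - (r : O) * s * hTT -
        ((p : O) * s + q * r) * hWT)
  refine ⟨hdet, ?_⟩
  obtain ⟨D, hD⟩ : ∃ D, D = p * s - q * r := ⟨_, rfl⟩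
  rw [← hD] at hdet ⊢
  have key : ∀ x y : ℤ, x * D = y → x = D * y := fun x y e => by
    linear_combination (-x) * hdet + D * e
  apply cubicForm_ext <;>
  simp only [Pi.smul_apply, smul_eq_mul] <;>
  apply key <;> rw [hD] <;>
  simp only [cubicSubst_zero, cubicSubst_one, cubicSubst_two, cubicSubst_three]
  · linear_combination p * a2 - r * a1
  · linear_combination q * a2 - s * a1 - 2 * r * c1 + 2 * p * c2
  · linear_combination p * b2 - r * b1 - 2 * s * c1 + 2 * q * c2
  · linear_combination q * b2 - s * b1

theorem IsFormBasis.swap (h : IsFormBasis f w t) : IsFormBasis ![-f 3, -f 2, -f 1, -f 0] t w := by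
  refine ⟨?_, ?_, ?_, ?_, ?_⟩
  · have := h.tt
    simp only [Matrix.cons_val]
    push_cast at this ⊢
    linear_combination this
  · have := h.ww
    simp only [Matrix.cons_val]
    push_cast at this ⊢
    linear_combination this
  · have := h.wt
    simp only [Matrix.cons_val]
    push_cast at this ⊢
    linear_combination this
  · intro x y z e
    obtain ⟨h1, h2, h3⟩ := h.ind x z y (by linear_combination e)
    exact ⟨h1, h3, h2⟩
  · intro u
    obtain ⟨x, y, z, rfl⟩ := h.span u
    exact ⟨x, z, y, by ring⟩

theorem IsFormBasis.transform (h : IsFormBasis f w t) {p q r s : ℤ}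
    (hd : (p * s - q * r) ^ 2 = 1) : ∃ n k : ℤ,
    IsFormBasis ((p * s - q * r) • cubicSubst p q r s f) ((n : O) + p * w + r * t)
      ((k : O) + q * w + s * t) := by
  obtain ⟨D, hD⟩ : ∃ D, D = p * s - q * r := ⟨_, rfl⟩
  rw [← hD] at hd
  have hDO : (D : O) * D = 1 := by
    rw [← Int.cast_mul, ← sq, hd, Int.cast_one]
  have hDD : (D : O) = p * s - q * r := by rw [hD]; push_cast; ring
  obtain ⟨n, k, g, hg⟩ := exists_isFormBasis_translate (w := (p : O) * w + r * t)
    (t := (q : O) * w + s * t) (by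
      intro x y z e
      obtain ⟨h1, h2, h3⟩ := h.ind x (y * p + z * q) (y * r + z * s) (by
        push_cast; linear_combination e)
      refine ⟨h1, ?_, ?_⟩
      · linear_combination (-y) * hd + D * (s * h2 - q * h3) + D * y * hD
      · linear_combination (-z) * hd + D * (p * h3 - r * h2) + D * z * hD)
    (by
      intro u
      obtain ⟨x, y, z, rfl⟩ := h.span u
      refine ⟨x, D * (s * y - q * z), D * (p * z - r * y), ?_⟩
      push_cast
      linear_combination (-(y * w + z * t)) * hDO + (D : O) * (y * w + z * t) * hDD)
  have e1 : (p : O) * w + r * t + n = n + p * w + r * t := by ring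
  have e2 : (q : O) * w + s * t + k = k + q * w + s * t := by ring
  rw [e1, e2] at hg
  refine ⟨n, k, ?_⟩
  rw [← (h.form_eq hg rfl rfl).2]
  exact hg

theorem IsFormBasis.cubicEquiv (h : IsFormBasis f w t) {w' t' : O} (h' : IsFormBasis g w' t') :
    CubicEquiv f g := by
  obtain ⟨n, p, r, hw⟩ := h.span w'
  obtain ⟨k, q, s, ht⟩ := h.span t'
  exact ⟨p, q, r, s, h.form_eq h' hw ht⟩

theorem IsFormBasis.exists_of_cubicEquiv (h : IsFormBasis f w t) (hfg : CubicEquiv f g) :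
    ∃ w' t' : O, IsFormBasis g w' t' := by
  obtain ⟨p, q, r, s, hd, rfl⟩ := hfg
  obtain ⟨n, k, h'⟩ := h.transform hd
  exact ⟨_, _, h'⟩

theorem IsFormBasis.map (h : IsFormBasis f w t) {O' : Type*} [CommRing O'] (e : O ≃+* O') :
    IsFormBasis f (e w) (e t) := by
  refine ⟨?_, ?_, ?_, ?_, ?_⟩
  · rw [← map_mul, h.ww]; simp
  · rw [← map_mul, h.tt]; simp
  · rw [← map_mul, h.wt]; simp
  · intro x y z hz
    apply h.ind
    apply e.injective
    simpa using hz
  · intro u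
    obtain ⟨x, y, z, hu⟩ := h.span (e.symm u)
    refine ⟨x, y, z, ?_⟩
    apply e.symm.injective
    simpa using hu

theorem IsFormBasis.mul_eq (h : IsFormBasis f w t) (x y z x' y' z' : ℤ) :
    ((x : O) + y * w + z * t) * (x' + y' * w + z' * t) =
      ((x * x' - f 0 * f 2 * (y * y') - f 0 * f 3 * (y * z' + z * y') -
        f 1 * f 3 * (z * z') : ℤ) : O) +
      ((x * y' + y * x' + f 1 * (y * y') + f 3 * (z * z') : ℤ) : O) * w +
      ((x * z' + z * x' - f 0 * (y * y') - f 2 * (z * z') : ℤ) : O) * t := by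
  have hWW := h.ww
  have hTT := h.tt
  have hWT := h.wt
  push_cast at hWW hTT hWT ⊢
  linear_combination (y : O) * y' * hWW + (z : O) * z' * hTT +
    ((y : O) * z' + z * y') * hWT

end

/-- The binary cubic form `f` has no nontrivial integral zero. -/
def CubicIrred (f : Fin 4 → ℤ) : Prop := ∀ x y : ℤ, cubicEval f x y = 0 → x = 0 ∧ y = 0

section
variable {O : Type*} [CommRing O] {f : Fin 4 → ℤ} {w t : O}

theorem IsFormBasis.intCast_injective (h : IsFormBasis f w t) {n m : ℤ} (e : (n : O) = m) :
    n = m :=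
  (h.ext_iff (x := n) (y := 0) (z := 0) (x' := m) (y' := 0) (z' := 0) (by simpa using e)).1

theorem IsFormBasis.isDomain (h : IsFormBasis f w t) (hf : CubicIrred f) : IsDomain O := by
  have : Nontrivial O := ⟨⟨0, 1, fun e => by
    have := h.intCast_injective (n := 0) (m := 1) (by simpa using e)
    omega⟩⟩
  have tf : ∀ (n : ℤ) (v : O), (n : O) * v = 0 → n ≠ 0 → v = 0 := by
    intro n v e hn
    obtain ⟨x, y, z, rfl⟩ := h.span v
    obtain ⟨h1, h2, h3⟩ := h.ind (n * x) (n * y) (n * z) (by push_cast; linear_combination e)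
    simp only [mul_eq_zero, hn, false_or] at h1 h2 h3
    subst h1 h2 h3; simp
  have : NoZeroDivisors O := by
    refine ⟨fun {u v} e => ?_⟩
    obtain ⟨n', x', y', hu⟩ := h.span u
    obtain ⟨n, x, y, hv⟩ := h.span v
    by_cases hv0 : x = 0 ∧ y = 0
    · obtain ⟨rfl, rfl⟩ := hv0
      by_cases hn : n = 0
      · right; rw [hv, hn]; simp
      · left; exact tf n u (by rw [← e, hv]; push_cast; ring) hn
    by_cases hu0 : x' = 0 ∧ y' = 0
    · obtain ⟨rfl, rfl⟩ := hu0
      by_cases hn : n' = 0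
      · left; rw [hu, hn]; simp
      · right; exact tf n' v (by rw [← e, hu]; push_cast; ring) hn
    exfalso
    have hvv := h.mul_eq n x y n x y
    have huu := h.mul_eq n' x' y' n' x' y'
    rw [← hv] at hvv
    rw [← hu] at huu
    obtain ⟨P, hP⟩ : ∃ P, P = n * x + x * n + f 1 * (x * x) + f 3 * (y * y) := ⟨_, rfl⟩
    obtain ⟨Q, hQ⟩ : ∃ Q, Q = n * y + y * n - f 0 * (x * x) - f 2 * (y * y) := ⟨_, rfl⟩
    obtain ⟨R, hR⟩ : ∃ R, R = n * n - f 0 * f 2 * (x * x) - f 0 * f 3 * (x * y + y * x) -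
        f 1 * f 3 * (y * y) := ⟨_, rfl⟩
    rw [← hP, ← hQ, ← hR] at hvv
    obtain ⟨N, hN⟩ : ∃ N, N = x * Q - y * P := ⟨_, rfl⟩
    have hN' : N = -cubicEval f x y := by
      rw [hN, hP, hQ, cubicEval]; ring
    obtain ⟨k0, hk0⟩ : ∃ k, k = N * n' - (x' * Q - y' * P) * n - (x * y' - y * x') * R := ⟨_, rfl⟩
    have key : (N : O) * u = k0 + ((x' * Q - y' * P : ℤ) : O) * v +
        ((x * y' - y * x' : ℤ) : O) * (v * v) := by
      rw [hvv, hk0, hu, hv, hN]; push_cast; ring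
    have key2 : (N : O) * (u * u) = k0 * u := by
      linear_combination u * key + (((x' * Q - y' * P : ℤ) : O) + ((x * y' - y * x' : ℤ) : O)
        * v) * e
    rw [huu] at key2
    nth_rewrite 1 [hu] at key2
    obtain ⟨-, e1, e2⟩ := h.ind
      (N * (n' * n' - f 0 * f 2 * (x' * x') - f 0 * f 3 * (x' * y' + y' * x') -
        f 1 * f 3 * (y' * y')) - k0 * n')
      (N * (n' * x' + x' * n' + f 1 * (x' * x') + f 3 * (y' * y')) - k0 * x')
      (N * (n' * y' + y' * n' - f 0 * (x' * x') - f 2 * (y' * y')) - k0 * y') (by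
        push_cast at key2 ⊢; linear_combination key2)
    have : N * cubicEval f x' y' = 0 := by
      rw [cubicEval]; linear_combination y' * e1 - x' * e2
    rcases mul_eq_zero.1 this with h0 | h0
    · exact hv0 (hf x y (by linarith))
    · exact hu0 (hf x' y' h0)
  exact NoZeroDivisors.to_isDomain O

theorem IsFormBasis.eval_ne_zero_of_left [IsDomain O] (h : IsFormBasis f w t) {x y : ℤ}
    (hx : x ≠ 0) : cubicEval f x y ≠ 0 := by
  intro hf
  have huu := h.mul_eq 0 x y 0 x y
  obtain ⟨u, hu⟩ : ∃ u : O, u = ((0 : ℤ) : O) + x * w + y * t := ⟨_, rfl⟩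
  rw [← hu] at huu
  obtain ⟨P, hP⟩ : ∃ P, P = 0 * x + x * 0 + f 1 * (x * x) + f 3 * (y * y) := ⟨_, rfl⟩
  obtain ⟨Q, hQ⟩ : ∃ Q, Q = 0 * y + y * 0 - f 0 * (x * x) - f 2 * (y * y) := ⟨_, rfl⟩
  obtain ⟨R, hR⟩ : ∃ R, R = 0 * 0 - f 0 * f 2 * (x * x) - f 0 * f 3 * (x * y + y * x) -
        f 1 * f 3 * (y * y) := ⟨_, rfl⟩
  rw [← hP, ← hQ, ← hR] at huu
  have hPQ : x * Q = y * P := by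
    rw [hP, hQ]; rw [cubicEval] at hf; linear_combination -hf
  have hPQ' : (x : O) * Q = y * P := by
    rw [← Int.cast_mul, hPQ, Int.cast_mul]
  have hq : (x : O) * (u * u) = P * u + (x * R : ℤ) := by
    rw [huu, hu]; push_cast; linear_combination t * hPQ'
  obtain ⟨α, β, γ, huv⟩ := h.span (u * t)
  obtain ⟨s, hs⟩ : ∃ s, s = x * γ - β * y := ⟨_, rfl⟩
  have hs' : (s : O) = x * γ - β * y := by rw [hs]; push_cast; ring
  have h1 : ((x : O) * u - s) * t = x * α + β * u := by
    rw [hs', hu]; rw [hu] at huv; push_cast at huv ⊢; linear_combination (x : O) * huv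
  obtain ⟨M, hM⟩ : ∃ M, M = -x ^ 2 * (x * R) - x * s * P + x * s ^ 2 := ⟨_, rfl⟩
  have hMO : (M : O) = -x ^ 2 * (x * R) - x * s * P + x * s ^ 2 := by rw [hM]; push_cast; ring
  have h2 : ((x : O) * u - s) * (x * P - x * s - x * x * u) = M := by
    rw [hMO]; push_cast at hq; linear_combination -(x : O) ^ 2 * hq
  have h3 : (M : O) * t = (x * α + β * u) * (x * P - x * s - x * x * u) := by
    rw [← h1, ← h2]; ring
  obtain ⟨k0, k1, h4⟩ : ∃ k0 k1 : ℤ, (M : O) * t = k0 + k1 * u := by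
    refine ⟨x * α * (x * P - x * s) - β * x * (x * R),
      β * (x * P - x * s) - x * α * x * x - β * x * P, ?_⟩
    rw [h3]; push_cast at hq ⊢; linear_combination -(β : O) * x * hq
  obtain ⟨-, e1, e2⟩ := h.ext_iff (x := 0) (y := 0) (z := M) (x' := k0) (y' := k1 * x)
    (z' := k1 * y) (by rw [hu] at h4; push_cast at h4 ⊢; linear_combination h4)
  have hk1 : k1 = 0 := by
    rcases mul_eq_zero.1 e1.symm with h | h
    · exact h
    · exact absurd h hx
  have hM0 : M = 0 := by rw [e2, hk1, zero_mul]
  rw [hM0, Int.cast_zero] at h2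
  rcases mul_eq_zero.1 h2 with h0 | h0
  · obtain ⟨-, h5, -⟩ := h.ind (-s) (x * x) (x * y) (by
      rw [hu] at h0; push_cast at h0 ⊢; linear_combination h0)
    exact hx (mul_self_eq_zero.1 h5)
  · obtain ⟨-, h5, -⟩ := h.ind (x * P - x * s) (-(x * x * x)) (-(x * x * y)) (by
      rw [hu] at h0; push_cast at h0 ⊢; linear_combination h0)
    simp [hx] at h5

theorem IsFormBasis.cubicIrred [IsDomain O] (h : IsFormBasis f w t) : CubicIrred f := by
  intro x y hf
  have hx : x = 0 := by
    by_contra hx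
    exact h.eval_ne_zero_of_left hx hf
  have hy : y = 0 := by
    by_contra hy
    refine h.swap.eval_ne_zero_of_left (y := x) hy ?_
    simp only [cubicEval, Matrix.cons_val] at hf ⊢
    linear_combination -hf
  exact ⟨hx, hy⟩

end

section
variable {O : Type*} [CommRing O] {f g : Fin 4 → ℤ} {w t : O}

/-- The `ℤ`-basis `1, w, t`. -/
noncomputable def IsFormBasis.basis (h : IsFormBasis f w t) : Module.Basis (Fin 3) ℤ O :=
  Module.Basis.mk (v := ![1, w, t])
    (by
      rw [Fintype.linearIndependent_iff]
      intro c hc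
      simp only [Fin.sum_univ_three, Matrix.cons_val, zsmul_eq_mul, mul_one] at hc
      obtain ⟨h1, h2, h3⟩ := h.ind _ _ _ hc
      intro i
      fin_cases i <;> assumption)
    (by
      intro u _
      obtain ⟨x, y, z, rfl⟩ := h.span u
      rw [show (x : O) + y * w + z * t = x • (1 : O) + y • w + z • t by
        simp only [zsmul_eq_mul, mul_one]]
      refine add_mem (add_mem ?_ ?_) ?_ <;> apply Submodule.smul_mem <;> apply Submodule.subset_span
      · exact ⟨0, rfl⟩
      · exact ⟨1, rfl⟩
      · exact ⟨2, rfl⟩)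

theorem IsFormBasis.basis_apply (h : IsFormBasis f w t) (i : Fin 3) : h.basis i = ![1, w, t] i := by
  simp [IsFormBasis.basis]

theorem IsFormBasis.basis_repr (h : IsFormBasis f w t) (x y z : ℤ) (i : Fin 3) :
    h.basis.repr ((x : O) + y * w + z * t) i = ![x, y, z] i := by
  have : (x : O) + y * w + z * t = ∑ i, ![x, y, z] i • h.basis i := by
    simp only [Fin.sum_univ_three, h.basis_apply, Matrix.cons_val, zsmul_eq_mul, mul_one]
  rw [this, Module.Basis.repr_sum_self]

theorem IsFormBasis.trace (h : IsFormBasis f w t) (x y z : ℤ) :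
    Algebra.trace ℤ O ((x : O) + y * w + z * t) = 3 * x + f 1 * y - f 2 * z := by
  have h1 := h.mul_eq x y z 0 1 0
  have h2 := h.mul_eq x y z 0 0 1
  simp only [Int.cast_zero, Int.cast_one, one_mul, zero_mul, zero_add, add_zero] at h1 h2
  rw [Algebra.trace_eq_matrix_trace h.basis, Matrix.trace, Fin.sum_univ_three]
  simp only [Matrix.diag, Algebra.leftMulMatrix_eq_repr_mul, h.basis_apply, Matrix.cons_val,
    mul_one]
  rw [h1, h2, h.basis_repr, h.basis_repr, h.basis_repr]
  simp
  ring

theorem IsFormBasis.discr (h : IsFormBasis f w t) : Algebra.discr ℤ h.basis = cubicDisc f := by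
  have t00 := h.trace 1 0 0
  have t10 := h.trace 0 1 0
  have t20 := h.trace 0 0 1
  have t11 := h.trace (-(f 0 * f 2)) (f 1) (-f 0)
  have t22 := h.trace (-(f 1 * f 3)) (f 3) (-f 2)
  have t12 := h.trace (-(f 0 * f 3)) 0 0
  simp only [Int.cast_zero, Int.cast_one, one_mul, zero_mul, zero_add, add_zero] at t00 t10 t20 t12
  rw [← h.wt] at t12
  rw [show ((-(f 0 * f 2) : ℤ) : O) + (f 1 : O) * w + ((-f 0 : ℤ) : O) * t = w * w by
    rw [h.ww]; push_cast; ring] at t11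
  rw [show ((-(f 1 * f 3) : ℤ) : O) + (f 3 : O) * w + ((-f 2 : ℤ) : O) * t = t * t by
    rw [h.tt]; push_cast; ring] at t22
  rw [Algebra.discr_def, Matrix.det_fin_three]
  simp only [Algebra.traceMatrix_apply, Algebra.traceForm_apply, h.basis_apply, Matrix.cons_val,
    mul_one, one_mul]
  rw [mul_comm t w, t00, t10, t20, t11, t22, t12, cubicDisc]
  ring

theorem IsFormBasis.ringDisc_eq [Module.Free ℤ O] [Module.Finite ℤ O] (h : IsFormBasis f w t) :
    ringDisc O = cubicDisc f := by
  have e : Fintype.card (Module.Free.ChooseBasisIndex ℤ O) = Fintype.card (Fin 3) := by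
    rw [← Module.finrank_eq_card_basis h.basis,
      ← Module.finrank_eq_card_basis (Module.Free.chooseBasis ℤ O)]
  rw [ringDisc, ← h.discr, ← Algebra.discr_reindex ℤ h.basis (Fintype.equivOfCardEq e).symm,
    Equiv.symm_symm]
  have := Algebra.discr_eq_discr O (Module.Free.chooseBasis ℤ O)
    (h.basis.reindex (Fintype.equivOfCardEq e).symm)
  rw [Module.Basis.coe_reindex, Equiv.symm_symm] at this
  exact this

/-- Two rings with form bases for the same form are isomorphic. -/
theorem IsFormBasis.nonempty_ringEquiv {O' : Type*} [CommRing O'] {w' t' : O'}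
    (h : IsFormBasis f w t) (h' : IsFormBasis f w' t') : Nonempty (O ≃+* O') := by
  let e : O ≃ₗ[ℤ] O' := h.basis.equiv h'.basis (Equiv.refl _)
  have he : ∀ x y z : ℤ, e ((x : O) + y * w + z * t) = (x : O') + y * w' + z * t' := by
    intro x y z
    have e0 := h.basis.equiv_apply 0 h'.basis (Equiv.refl _)
    have e1 := h.basis.equiv_apply 1 h'.basis (Equiv.refl _)
    have e2 := h.basis.equiv_apply 2 h'.basis (Equiv.refl _)
    simp only [h.basis_apply, h'.basis_apply, Equiv.refl_apply, Matrix.cons_val] at e0 e1 e2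
    rw [show (x : O) + y * w + z * t = x • (1 : O) + y • w + z • t by
        simp only [zsmul_eq_mul, mul_one]]
    rw [map_add, map_add, map_smul, map_smul, map_smul]
    change x • (h.basis.equiv h'.basis (Equiv.refl _)) 1 + y • (h.basis.equiv h'.basis
      (Equiv.refl _)) w +
      z • (h.basis.equiv h'.basis (Equiv.refl _)) t = _
    rw [e0, e1, e2]
    simp only [zsmul_eq_mul, mul_one]
  refine ⟨{ e with map_mul' := ?_, map_add' := e.map_add }⟩
  intro u v
  obtain ⟨x, y, z, rfl⟩ := h.span u
  obtain ⟨x', y', z', rfl⟩ := h.span v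
  change e _ = e _ * e _
  rw [h.mul_eq, he, he, he, h'.mul_eq]

theorem IsFormBasis.exists_of_isFormBasis {O' : Type*} [CommRing O'] {w' t' : O'}
    (h : IsFormBasis f w t) (h' : IsFormBasis g w' t') :
    Nonempty (O ≃+* O') ↔ CubicEquiv f g := by
  constructor
  · rintro ⟨e⟩
    exact (h.map e).cubicEquiv h'
  · intro e
    obtain ⟨w₁, t₁, h₁⟩ := h.exists_of_cubicEquiv e
    exact h₁.nonempty_ringEquiv h'

end

section
variable (O : Type*) [CommRing O] [Module.Free ℤ O] [Module.Finite ℤ O]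

theorem exists_isFormBasis (h3 : Module.finrank ℤ O = 3) :
    ∃ (f : Fin 4 → ℤ) (w t : O), IsFormBasis f w t := by
  have b : Module.Basis (Fin 3) ℤ O := Module.finBasisOfFinrankEq ℤ O h3
  have hnt : Nontrivial O := Module.nontrivial_of_finrank_pos (R := ℤ) (by omega)
  obtain ⟨n, bM, bN, φ, a, snf⟩ := (Submodule.span ℤ {(1 : O)}).smithNormalForm b
  have hn : n = 1 := by
    have e := LinearEquiv.finrank_eq (LinearEquiv.toSpanNonzeroSingleton ℤ O 1 one_ne_zero)
    rw [Module.finrank_self, Module.finrank_eq_card_basis bN, Fintype.card_fin] at e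
    exact e.symm
  subst hn
  obtain ⟨k, hk⟩ : ∃ k : ℤ, (1 : O) = k • bM (φ 0) := by
    have := bN.sum_repr ⟨1, Submodule.mem_span_singleton_self _⟩
    rw [Fin.sum_univ_one] at this
    have := congrArg Subtype.val this
    simp only [Submodule.coe_smul, snf, smul_smul] at this
    exact ⟨_, this.symm⟩
  have hku : k * bM.repr (bM (φ 0) * bM (φ 0)) (φ 0) = 1 := by
    have : bM (φ 0) = k • (bM (φ 0) * bM (φ 0)) := by
      rw [← smul_mul_assoc, ← hk, one_mul]
    have h2 := congrArg (fun u => bM.repr u (φ 0)) this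
    simp only [Module.Basis.repr_self, Finsupp.single_eq_same, map_smul, Finsupp.smul_apply,
      smul_eq_mul] at h2
    exact h2.symm
  have hk2 : k * k = 1 := by
    rcases Int.isUnit_iff.1 (IsUnit.of_mul_eq_one _ hku) with h | h <;> rw [h] <;> norm_num
  let B := bM.reindex (Equiv.swap 0 (φ 0))
  have hB : B 0 = (k : O) := by
    simp only [B, Module.Basis.reindex_apply, Equiv.symm_swap, Equiv.swap_apply_left]
    calc bM (φ 0) = (k * k) • bM (φ 0) := by rw [hk2, one_smul]
      _ = k • (1 : O) := by rw [mul_smul, ← hk]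
      _ = k := by simp
  have hkO : (k : O) * k = 1 := by rw [← Int.cast_mul, hk2, Int.cast_one]
  obtain ⟨i, j, f, hf⟩ := exists_isFormBasis_translate (w := B 1) (t := B 2) (by
      intro x y z e
      have := Fintype.linearIndependent_iff.1 B.linearIndependent ![x * k, y, z] (by
        simp only [Fin.sum_univ_three, Matrix.cons_val, zsmul_eq_mul, hB]
        push_cast
        linear_combination e + (x : O) * hkO)
      have h0 := this 0
      have h1 := this 1
      have h2 := this 2
      simp only [Matrix.cons_val] at h0 h1 h2
      exact ⟨by linear_combination (-x) * hk2 + k * h0, h1, h2⟩)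
    (by
      intro u
      have := B.sum_repr u
      simp only [Fin.sum_univ_three, zsmul_eq_mul, hB] at this
      exact ⟨B.repr u 0 * k, B.repr u 1, B.repr u 2, by rw [Int.cast_mul]; exact this.symm⟩)
  exact ⟨f, _, _, hf⟩

theorem IsIrredCubicOrder.isDomain {O : Type*} [CommRing O] [Module.Free ℤ O] [Module.Finite ℤ O]
    (h : IsIrredCubicOrder O) : IsDomain O := by
  let := h.2.toField
  exact (Algebra.TensorProduct.includeRight_injective (R := ℤ) (A := ℚ) (B := O)
    (Int.cast_injective)).isDomain (Algebra.TensorProduct.includeRight (R := ℤ) (A := ℚ)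
      (B := O)).toRingHom

theorem isIrredCubicOrder_of_isDomain [IsDomain O] (h3 : Module.finrank ℤ O = 3) :
    IsIrredCubicOrder O := by
  refine ⟨h3, ?_⟩
  have hinj : Function.Injective (Algebra.TensorProduct.includeRight (R := ℤ) (A := ℚ) (B := O)) :=
    Algebra.TensorProduct.includeRight_injective Int.cast_injective
  have : Nontrivial (ℚ ⊗[ℤ] O) := hinj.nontrivial
  have hrep : ∀ x : ℚ ⊗[ℤ] O, ∃ (q : ℚ) (y : O), x = q ⊗ₜ y := by
    intro x
    induction x with
    | zero => exact ⟨0, 0, by simp⟩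
    | tmul q y => exact ⟨q, y, rfl⟩
    | add x x' hx hx' =>
      obtain ⟨q, y, rfl⟩ := hx
      obtain ⟨q', y', rfl⟩ := hx'
      refine ⟨1 / (q.den * q'.den), (q.num * q'.den) • y + (q'.num * q.den) • y', ?_⟩
      rw [TensorProduct.tmul_add, ← TensorProduct.smul_tmul, ← TensorProduct.smul_tmul]
      congr 2
      · rw [zsmul_eq_mul]; push_cast
        have := q.den_ne_zero; have := q'.den_ne_zero
        nth_rewrite 1 [← Rat.num_div_den q]
        field_simp
      · rw [zsmul_eq_mul]; push_cast
        have := q.den_ne_zero; have := q'.den_ne_zero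
        nth_rewrite 1 [← Rat.num_div_den q']
        field_simp
  refine ⟨⟨0, 1, zero_ne_one⟩, mul_comm, ?_⟩
  intro x hx
  obtain ⟨q, y, rfl⟩ := hrep x
  have hq : q ≠ 0 := by rintro rfl; simp at hx
  have hy : y ≠ 0 := by rintro rfl; simp at hx
  have hI := Ideal.comap_ne_bot_of_integral_mem (R := ℤ) (I := Ideal.span {y}) hy
    (Ideal.mem_span_singleton_self y) (Algebra.IsIntegral.isIntegral y)
  obtain ⟨n, hn, hn0⟩ := Submodule.exists_mem_ne_zero_of_ne_bot hI
  obtain ⟨z, hz⟩ := Ideal.mem_span_singleton.1 (Ideal.mem_comap.1 hn)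
  refine ⟨(1 / (q * n)) ⊗ₜ z, ?_⟩
  rw [Algebra.TensorProduct.tmul_mul_tmul, ← hz, Algebra.TensorProduct.one_def,
    Algebra.algebraMap_eq_smul_one, ← TensorProduct.smul_tmul]
  congr 1
  rw [zsmul_eq_mul]
  have : (n : ℚ) ≠ 0 := by exact_mod_cast hn0
  field_simp

end

/-- The cubic ring attached to a binary cubic form. -/
@[ext] structure CubicRing (f : Fin 4 → ℤ) where
  x : ℤ
  y : ℤ
  z : ℤ

namespace CubicRing
variable (f : Fin 4 → ℤ)

instance : Zero (CubicRing f) := ⟨⟨0, 0, 0⟩⟩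
instance : One (CubicRing f) := ⟨⟨1, 0, 0⟩⟩
instance : Add (CubicRing f) := ⟨fun u v => ⟨u.x + v.x, u.y + v.y, u.z + v.z⟩⟩
instance : Neg (CubicRing f) := ⟨fun u => ⟨-u.x, -u.y, -u.z⟩⟩
instance : Mul (CubicRing f) := ⟨fun u v =>
  ⟨u.x * v.x - f 0 * f 2 * (u.y * v.y) - f 0 * f 3 * (u.y * v.z + u.z * v.y) -
        f 1 * f 3 * (u.z * v.z),
    u.x * v.y + u.y * v.x + f 1 * (u.y * v.y) + f 3 * (u.z * v.z),
    u.x * v.z + u.z * v.x - f 0 * (u.y * v.y) - f 2 * (u.z * v.z)⟩⟩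

@[simp] theorem zero_x : (0 : CubicRing f).x = 0 := rfl
@[simp] theorem zero_y : (0 : CubicRing f).y = 0 := rfl
@[simp] theorem zero_z : (0 : CubicRing f).z = 0 := rfl
@[simp] theorem one_x : (1 : CubicRing f).x = 1 := rfl
@[simp] theorem one_y : (1 : CubicRing f).y = 0 := rfl
@[simp] theorem one_z : (1 : CubicRing f).z = 0 := rfl

variable {f} (u v : CubicRing f)
@[simp] theorem add_x : (u + v).x = u.x + v.x := rfl
@[simp] theorem add_y : (u + v).y = u.y + v.y := rfl
@[simp] theorem add_z : (u + v).z = u.z + v.z := rfl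
@[simp] theorem neg_x : (-u).x = -u.x := rfl
@[simp] theorem neg_y : (-u).y = -u.y := rfl
@[simp] theorem neg_z : (-u).z = -u.z := rfl
theorem mul_x : (u * v).x = u.x * v.x - f 0 * f 2 * (u.y * v.y) -
    f 0 * f 3 * (u.y * v.z + u.z * v.y) - f 1 * f 3 * (u.z * v.z) := rfl
theorem mul_y : (u * v).y = u.x * v.y + u.y * v.x + f 1 * (u.y * v.y) + f 3 * (u.z * v.z) := rfl
theorem mul_z : (u * v).z = u.x * v.z + u.z * v.x - f 0 * (u.y * v.y) - f 2 * (u.z * v.z) := rfl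

instance : CommRing (CubicRing f) where
  add_assoc a b c := by ext <;> simp [add_assoc]
  zero_add a := by ext <;> simp
  add_zero a := by ext <;> simp
  add_comm a b := by ext <;> simp [add_comm]
  neg_add_cancel a := by ext <;> simp
  mul_assoc a b c := by ext <;> simp only [mul_x, mul_y, mul_z] <;> ring
  one_mul a := by ext <;> simp [mul_x, mul_y, mul_z]
  mul_one a := by ext <;> simp [mul_x, mul_y, mul_z]
  zero_mul a := by ext <;> simp [mul_x, mul_y, mul_z]
  mul_zero a := by ext <;> simp [mul_x, mul_y, mul_z]
  left_distrib a b c := by ext <;> simp only [mul_x, mul_y, mul_z, add_x, add_y, add_z] <;> ring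
  right_distrib a b c := by ext <;> simp only [mul_x, mul_y, mul_z, add_x, add_y, add_z] <;> ring
  mul_comm a b := by ext <;> simp only [mul_x, mul_y, mul_z] <;> ring
  nsmul := nsmulRec
  zsmul := zsmulRec

theorem natCast_eq (n : ℕ) : (n : CubicRing f) = ⟨n, 0, 0⟩ := by
  induction n with
  | zero => simp; rfl
  | succ n ih => rw [Nat.cast_succ, ih]; ext <;> simp

theorem intCast_eq (n : ℤ) : (n : CubicRing f) = ⟨n, 0, 0⟩ := by
  obtain ⟨k, rfl | rfl⟩ := n.eq_nat_or_neg
  · simp [natCast_eq]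
  · rw [Int.cast_neg, Int.cast_natCast, natCast_eq]; ext <;> simp

theorem eq_coords (x y z : ℤ) : (x : CubicRing f) + y * ⟨0, 1, 0⟩ + z * ⟨0, 0, 1⟩ = ⟨x, y, z⟩ := by
  simp only [intCast_eq]
  ext <;> simp [mul_x, mul_y, mul_z]

theorem isFormBasis (f : Fin 4 → ℤ) :
    IsFormBasis f (⟨0, 1, 0⟩ : CubicRing f) (⟨0, 0, 1⟩ : CubicRing f) where
  ww := by
    have := eq_coords (f := f) (-(f 0 * f 2)) (f 1) (-f 0)
    rw [Int.cast_neg (f 0), neg_mul, ← sub_eq_add_neg] at this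
    rw [this]; ext <;> simp [mul_x, mul_y, mul_z]
  tt := by
    have := eq_coords (f := f) (-(f 1 * f 3)) (f 3) (-f 2)
    rw [Int.cast_neg (f 2), neg_mul, ← sub_eq_add_neg] at this
    rw [this]; ext <;> simp [mul_x, mul_y, mul_z]
  wt := by rw [intCast_eq]; ext <;> simp [mul_x, mul_y, mul_z]
  ind x y z h := by
    rw [eq_coords] at h
    exact ⟨congrArg CubicRing.x h, congrArg CubicRing.y h, congrArg CubicRing.z h⟩
  span u := ⟨u.x, u.y, u.z, by rw [eq_coords]⟩

instance : Module.Free ℤ (CubicRing f) := Module.Free.of_basis (isFormBasis f).basis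
instance : Module.Finite ℤ (CubicRing f) := Module.Finite.of_basis (isFormBasis f).basis

theorem isIrredCubicOrder (hf : CubicIrred f) : IsIrredCubicOrder (CubicRing f) := by
  have := (isFormBasis f).isDomain hf
  exact isIrredCubicOrder_of_isDomain _ (Module.finrank_eq_card_basis (isFormBasis f).basis)

end CubicRing

/-- The ideals `J` with `J² = m²O` and `J ∩ ℤ = m²ℤ`; the fractional ideals `J/m` with `m ≥ 1`
are exactly the `2`-torsion elements of the ideal group. -/
def torsionIdeals (O : Type*) [CommRing O] (m : ℕ) : Set (Ideal O) :=
  {J | 0 < m ∧ J * J = Ideal.span {((m : O)) ^ 2} ∧ ∀ n : ℤ, (n : O) ∈ J ↔ (m : ℤ) ^ 2 ∣ n}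

/-- The congruence conditions on `f` for the lattice spanned by `m²`, `mw`, `t + mτ` to be
an ideal of the required type. -/
def TorsionData (f : Fin 4 → ℤ) (m τ : ℤ) : Prop :=
  ∃ e d : ℤ, f 2 = 2 * m * τ + m ^ 2 * e ∧ f 3 = m ^ 2 * d ∧ IsCoprime (τ ^ 2 - f 1 * d) m

section
variable {O : Type*} [CommRing O] {f : Fin 4 → ℤ} {w t : O}

theorem IsFormBasis.dvd_coords (h : IsFormBasis f w t) {N x y z : ℤ} {u : O}
    (e : (x : O) + y * w + z * t = N * u) : N ∣ x ∧ N ∣ y ∧ N ∣ z := by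
  obtain ⟨a, b, c, rfl⟩ := h.span u
  obtain ⟨h1, h2, h3⟩ := h.ext_iff (x := x) (y := y) (z := z) (x' := N * a) (y' := N * b)
    (z' := N * c) (by push_cast; linear_combination e)
  exact ⟨⟨a, h1⟩, ⟨b, h2⟩, ⟨c, h3⟩⟩

theorem IsFormBasis.mul_cancel (h : IsFormBasis f w t) {N : ℤ} (hN : N ≠ 0) {u v : O}
    (e : (N : O) * u = N * v) : u = v := by
  obtain ⟨a, b, c, hu⟩ := h.span (u - v)
  obtain ⟨h1, h2, h3⟩ := h.ind (N * a) (N * b) (N * c) (by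
    push_cast; linear_combination e - (N : O) * hu)
  simp only [mul_eq_zero, hN, false_or] at h1 h2 h3
  subst h1 h2 h3
  simp only [Int.cast_zero, zero_mul, add_zero] at hu
  exact sub_eq_zero.1 hu

theorem torsionIdeals_mul_mem {m : ℕ} {J : Ideal O} (hJ : J ∈ torsionIdeals O m) {u v : O}
    (hu : u ∈ J) (hv : v ∈ J) : ∃ y, u * v = (((m : ℤ) ^ 2 : ℤ) : O) * y := by
  have := hJ.2.1 ▸ Ideal.mul_mem_mul hu hv
  obtain ⟨y, hy⟩ := Ideal.mem_span_singleton.1 this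
  exact ⟨y, by rw [hy]; push_cast; ring⟩

theorem torsionIdeals_sq_mem {m : ℕ} {J : Ideal O} (hJ : J ∈ torsionIdeals O m) :
    (((m : ℤ) ^ 2 : ℤ) : O) ∈ J := (hJ.2.2 _).2 dvd_rfl

/-- A linear functional that is divisible by `p` on all quotients `uv/m²` is divisible by `p`. -/
theorem IsFormBasis.dvd_functional (h : IsFormBasis f w t) {m : ℕ} {J : Ideal O}
    (hJ : J ∈ torsionIdeals O m) (p : ℤ) (A : O →+ ℤ)
    (hA : ∀ u ∈ J, ∀ v ∈ J, ∀ y, u * v = (((m : ℤ) ^ 2 : ℤ) : O) * y → p ∣ A y) (y : O) :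
    p ∣ A y := by
  have hm : (m : ℤ) ^ 2 ≠ 0 := by have := hJ.1; positivity
  have hy : (((m : ℤ) ^ 2 : ℤ) : O) * y ∈ J * J := by
    rw [hJ.2.1]
    exact Ideal.mem_span_singleton.2 ⟨y, by push_cast; ring⟩
  have : ∃ y', (((m : ℤ) ^ 2 : ℤ) : O) * y = (((m : ℤ) ^ 2 : ℤ) : O) * y' ∧ p ∣ A y' := by
    refine Submodule.mul_induction_on (C := fun x => ∃ y',
      x = (((m : ℤ) ^ 2 : ℤ) : O) * y' ∧ p ∣ A y')
      hy ?_ ?_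
    · intro u hu v hv
      obtain ⟨y', hy'⟩ := torsionIdeals_mul_mem hJ hu hv
      exact ⟨y', hy', hA u hu v hv y' hy'⟩
    · rintro _ _ ⟨y₁, rfl, h₁⟩ ⟨y₂, rfl, h₂⟩
      exact ⟨y₁ + y₂, by ring, by rw [map_add]; exact dvd_add h₁ h₂⟩
  obtain ⟨y', e, hy'⟩ := this
  rwa [h.mul_cancel hm e]

theorem exists_coprime_lift {N x y : ℤ} (hN : N ≠ 0)
    (hxy : ∀ p : ℕ, p.Prime → (p : ℤ) ∣ x → (p : ℤ) ∣ y → ¬ (p : ℤ) ∣ N) :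
    ∃ x' y' : ℤ, N ∣ x' - x ∧ N ∣ y' - y ∧ IsCoprime x' y' := by
  obtain ⟨y', hy', hy0⟩ : ∃ y' : ℤ, N ∣ y' - y ∧ y' ≠ 0 := by
    by_cases hy : y = 0
    · exact ⟨y + N, by simp, by rw [hy]; simpa using hN⟩
    · exact ⟨y, by simp, hy⟩
  have hxy' : ∀ p : ℕ, p.Prime → (p : ℤ) ∣ x → (p : ℤ) ∣ y' → ¬ (p : ℤ) ∣ N := by
    intro p hp h1 h2 h3
    refine hxy p hp h1 ?_ h3
    have := dvd_sub h2 (h3.trans hy')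
    simpa using this
  -- multiply `N` by the primes dividing `y'` but not `x`
  classical
  let S := y'.natAbs.primeFactors.filter fun p : ℕ => ¬ (p : ℤ) ∣ x
  refine ⟨x + N * ∏ p ∈ S, (p : ℤ), y', by simp, hy', ?_⟩
  rw [Int.isCoprime_iff_gcd_eq_one]
  by_contra hne
  obtain ⟨p, hp, hpd⟩ := Nat.exists_prime_and_dvd hne
  have h1 : (p : ℤ) ∣ x + N * ∏ p ∈ S, (p : ℤ) :=
    (Int.natCast_dvd_natCast.2 hpd).trans (Int.gcd_dvd_left _ _)
  have h2 : (p : ℤ) ∣ y' := (Int.natCast_dvd_natCast.2 hpd).trans (Int.gcd_dvd_right _ _)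
  have hpp := Nat.prime_iff_prime_int.1 hp
  by_cases hx : (p : ℤ) ∣ x
  · have h3 := (Int.dvd_add_right hx).1 h1
    rcases hpp.dvd_or_dvd h3 with h4 | h4
    · exact hxy' p hp hx h2 h4
    · obtain ⟨q, hq, hpq⟩ := (Prime.dvd_finsetProd_iff hpp _).1 h4
      have hq' := Finset.mem_filter.1 hq
      have : p = q := (Nat.prime_dvd_prime_iff_eq hp (Nat.prime_of_mem_primeFactors hq'.1)).1
        (Int.natCast_dvd_natCast.1 hpq)
      exact hq'.2 (this ▸ hx)
  · have h3 : p ∈ S := by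
      refine Finset.mem_filter.2 ⟨?_, hx⟩
      rw [Nat.mem_primeFactors]
      exact ⟨hp, Int.natCast_dvd.1 h2, by simpa using hy0⟩
    have h4 : (p : ℤ) ∣ N * ∏ p ∈ S, (p : ℤ) := (Finset.dvd_prod_of_mem _ h3).mul_left _
    exact hx ((Int.dvd_add_left h4).1 h1)

theorem IsFormBasis.exists_not_dvd (h : IsFormBasis f w t) {m : ℕ} {J : Ideal O}
    (hJ : J ∈ torsionIdeals O m) {p : ℕ} (hp : p.Prime) (hpm : p ∣ m) :
    ∃ n x y : ℤ, (n : O) + x * w + y * t ∈ J ∧ ¬ ((p : ℤ) ∣ x ∧ (p : ℤ) ∣ y) := by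
  by_contra hcon
  push Not at hcon
  have hpp := Nat.prime_iff_prime_int.1 hp
  obtain ⟨k, rfl⟩ := hpm
  have hp0 : (p : ℤ) ≠ 0 := by exact_mod_cast hp.ne_zero
  have hk0 : (k : ℤ) ≠ 0 := by
    have := hJ.1
    rintro h0
    simp only [Nat.cast_eq_zero] at h0
    simp [h0] at this
  have hJp : ∀ u ∈ J, ∃ v, u = ((p : ℤ) : O) * v := by
    intro u hu
    obtain ⟨n, x, y, rfl⟩ := h.span u
    obtain ⟨⟨x', rfl⟩, ⟨y', rfl⟩⟩ := hcon n x y hu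
    obtain ⟨v, hv⟩ := torsionIdeals_mul_mem hJ hu hu
    have : (p : ℤ) ∣ n * n := by
      refine (h.dvd_coords (x := n * n) (y := 0) (z := 0)
        (u := (k : O) ^ 2 * p * v - 2 * n * (x' * w + y' * t) - p * (x' * w + y' * t) ^ 2) ?_).1
      push_cast at hv ⊢
      linear_combination hv
    obtain ⟨n', rfl⟩ := (or_self_iff.1 (hpp.dvd_or_dvd this))
    exact ⟨n' + x' * w + y' * t, by push_cast; ring⟩
  have hmem : ∃ z ∈ J, (((p * k : ℕ) : O)) ^ 2 = ((p : ℤ) : O) * z := by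
    refine Submodule.mul_induction_on (M := J) (N := J)
      (C := fun x => ∃ z ∈ J, x = ((p : ℤ) : O) * z) ?_ ?_ ?_
    · rw [hJ.2.1]; exact Ideal.mem_span_singleton_self _
    · intro u hu v hv
      obtain ⟨v', rfl⟩ := hJp v hv
      exact ⟨u * v', J.mul_mem_right _ hu, by ring⟩
    · rintro _ _ ⟨z₁, h₁, rfl⟩ ⟨z₂, h₂, rfl⟩
      exact ⟨z₁ + z₂, J.add_mem h₁ h₂, by ring⟩
  obtain ⟨z, hz, e⟩ := hmem
  have : ((p * k ^ 2 : ℤ) : O) = z := h.mul_cancel hp0 (by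
    rw [← e]; push_cast; ring)
  rw [← this, hJ.2.2] at hz
  push_cast at hz
  have h1 : ((p : ℤ) * k ^ 2) * p ∣ (p * k ^ 2) * 1 := by
    rw [show ((p : ℤ) * k ^ 2) * p = (p * k) ^ 2 by ring, mul_one]; exact hz
  have h2 := Int.dvd_of_mul_dvd_mul_left (mul_ne_zero hp0 (pow_ne_zero 2 hk0)) h1
  exact hpp.not_dvd_one h2

theorem IsFormBasis.exists_coprime_mem (h : IsFormBasis f w t) {m : ℕ} {J : Ideal O}
    (hJ : J ∈ torsionIdeals O m) :
    ∃ n x y : ℤ, (n : O) + x * w + y * t ∈ J ∧ IsCoprime x y := by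
  have key : ∀ S : Finset ℕ, (∀ p ∈ S, p.Prime ∧ p ∣ m) → ∃ n x y : ℤ,
      (n : O) + x * w + y * t ∈ J ∧ ∀ p ∈ S, ¬ ((p : ℤ) ∣ x ∧ (p : ℤ) ∣ y) := by
    intro S
    induction S using Finset.induction_on with
    | empty => exact fun _ => ⟨0, 0, 0, by simp, by simp⟩
    | insert p S hpS ih =>
      intro hS
      obtain ⟨n, x, y, hmem, hnd⟩ := ih fun q hq => hS q (Finset.mem_insert_of_mem hq)
      obtain ⟨hp, hpm⟩ := hS p (Finset.mem_insert_self _ _)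
      have hpp := Nat.prime_iff_prime_int.1 hp
      by_cases hpxy : (p : ℤ) ∣ x ∧ (p : ℤ) ∣ y
      · obtain ⟨n', x', y', hmem', hnd'⟩ := h.exists_not_dvd hJ hp hpm
        let P : ℤ := ∏ q ∈ S, (q : ℤ)
        have hpP : ¬ (p : ℤ) ∣ P := by
          intro hd
          obtain ⟨q, hq, hpq⟩ := (Prime.dvd_finsetProd_iff hpp _).1 hd
          have : p = q := (Nat.prime_dvd_prime_iff_eq hp (hS q (Finset.mem_insert_of_mem hq)).1).1
            (Int.natCast_dvd_natCast.1 hpq)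
          exact hpS (this ▸ hq)
        refine ⟨n + P * n', x + P * x', y + P * y', ?_, ?_⟩
        · have := J.add_mem hmem (J.mul_mem_left (P : O) hmem')
          convert this using 1
          push_cast
          ring
        · intro q hq
          rcases Finset.mem_insert.1 hq with rfl | hq
          · rw [Int.dvd_add_right hpxy.1, Int.dvd_add_right hpxy.2]
            rintro ⟨h1, h2⟩
            exact hnd' ⟨(hpp.dvd_or_dvd h1).resolve_left hpP, (hpp.dvd_or_dvd h2).resolve_left hpP⟩
          · have hqP : (q : ℤ) ∣ P := Finset.dvd_prod_of_mem _ hq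
            rw [Int.dvd_add_left (hqP.mul_right _), Int.dvd_add_left (hqP.mul_right _)]
            exact hnd q hq
      · refine ⟨n, x, y, hmem, fun q hq => ?_⟩
        rcases Finset.mem_insert.1 hq with rfl | hq
        · exact hpxy
        · exact hnd q hq
  have hm0 : m ≠ 0 := hJ.1.ne'
  obtain ⟨n, x, y, hmem, hnd⟩ := key m.primeFactors
    fun p hp => ⟨Nat.prime_of_mem_primeFactors hp, Nat.dvd_of_mem_primeFactors hp⟩
  obtain ⟨x', y', ⟨a, ha⟩, ⟨b, hb⟩, hco⟩ := exists_coprime_lift (N := (m : ℤ) ^ 2) (x := x) (y := y)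
    (by positivity) (by
      intro p hp h1 h2 h3
      have hpm : p ∣ m := by
        have := (Nat.prime_iff_prime_int.1 hp).dvd_of_dvd_pow h3
        exact Int.natCast_dvd_natCast.1 this
      exact hnd p (Nat.mem_primeFactors.2 ⟨hp, hpm, hm0⟩) ⟨h1, h2⟩)
  refine ⟨n, x', y', ?_, hco⟩
  have := J.add_mem hmem (J.mul_mem_right (a * w + b * t) (torsionIdeals_sq_mem hJ))
  convert this using 1
  rw [show x' = x + m ^ 2 * a by linarith, show y' = y + m ^ 2 * b by linarith]
  push_cast
  ring

end

section
variable {O : Type*} [CommRing O] {f : Fin 4 → ℤ} {w t : O}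

/-- The functional `x + yw + zt ↦ αx + βy`. -/
noncomputable def IsFormBasis.functional (h : IsFormBasis f w t) (α β : ℤ) : O →+ ℤ where
  toFun u := α * h.basis.repr u 0 + β * h.basis.repr u 1
  map_zero' := by simp
  map_add' u v := by simp; ring

theorem IsFormBasis.functional_apply (h : IsFormBasis f w t) (α β x y z : ℤ) :
    h.functional α β ((x : O) + y * w + z * t) = α * x + β * y := by
  change α * h.basis.repr _ 0 + β * h.basis.repr _ 1 = _
  rw [h.basis_repr, h.basis_repr]
  simp

theorem IsFormBasis.torsion_structure (h : IsFormBasis f w t) {m : ℕ} {J : Ideal O}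
    (hJ : J ∈ torsionIdeals O m) {s : ℤ} (hs : t + s ∈ J) :
    ∃ τ : ℤ, s = m * τ ∧ TorsionData f m τ ∧
      ∀ x y z : ℤ, (x : O) + y * w + z * t ∈ J ↔ (m : ℤ) ∣ y ∧ (m : ℤ) ^ 2 ∣ x - m * τ * z := by
  have hm : (m : ℤ) ≠ 0 := by exact_mod_cast hJ.1.ne'
  have hm2 : (m : ℤ) ^ 2 ≠ 0 := pow_ne_zero 2 hm
  have hww := h.ww
  have htt := h.tt
  have hwt := h.wt
  push_cast at hww htt hwt
  -- the square of `t + s`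
  obtain ⟨u, hu⟩ := torsionIdeals_mul_mem hJ hs hs
  obtain ⟨h1, ⟨d, hd⟩, ⟨e, he⟩⟩ := h.dvd_coords (N := (m : ℤ) ^ 2) (x := s ^ 2 - f 1 * f 3)
    (y := f 3) (z := 2 * s - f 2) (u := u) (by
      rw [← hu]; push_cast; linear_combination -htt)
  have hms : (m : ℤ) ∣ s := by
    rw [hd] at h1
    have : (m : ℤ) ^ 2 ∣ s ^ 2 := by
      rw [show s ^ 2 = (s ^ 2 - f 1 * (m ^ 2 * d)) + m ^ 2 * (f 1 * d) by ring]
      exact dvd_add h1 (Dvd.intro _ rfl)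
    exact (Int.pow_dvd_pow_iff two_ne_zero).1 this
  obtain ⟨τ, rfl⟩ := hms
  have hf2 : f 2 = 2 * m * τ + m ^ 2 * (-e) := by linear_combination -he
  push_cast at hs
  -- elements of `J ∩ (ℤ + ℤw)`
  have hkw : ∀ n k : ℤ, (n : O) + k * w ∈ J →
      (m : ℤ) ^ 2 ∣ n ∧ (m : ℤ) ∣ k * τ ∧ (m : ℤ) ^ 2 ∣ k ^ 2 * f 1 ∧
        (m : ℤ) ^ 2 ∣ k ^ 2 * f 0 := by
    intro n k hk
    obtain ⟨v, hv⟩ := torsionIdeals_mul_mem hJ hk hs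
    obtain ⟨-, h2, h3⟩ := h.dvd_coords (N := (m : ℤ) ^ 2) (x := n * m * τ - k * f 0 * f 3)
      (y := k * m * τ) (z := n) (u := v) (by
        rw [← hv]; push_cast; linear_combination -(k : O) * hwt)
    obtain ⟨v', hv'⟩ := torsionIdeals_mul_mem hJ hk hk
    obtain ⟨-, h4, h5⟩ := h.dvd_coords (N := (m : ℤ) ^ 2) (x := n ^ 2 - k ^ 2 * (f 0 * f 2))
      (y := 2 * n * k + k ^ 2 * f 1) (z := - (k ^ 2 * f 0)) (u := v') (by
        rw [← hv']; push_cast; linear_combination -(k : O) ^ 2 * hww)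
    refine ⟨h3, ?_, ?_, (dvd_neg.1 h5)⟩
    · rw [show k * m * τ = m * (k * τ) by ring, sq] at h2
      exact Int.dvd_of_mul_dvd_mul_left hm h2
    · exact (Int.dvd_add_right ((h3.mul_left 2).mul_right k)).1 h4
  have hkw' : ∀ k : ℤ, ∀ n : ℤ, (n : O) + k * w ∈ J → (k : O) * w ∈ J := by
    intro k n hk
    have := J.sub_mem hk ((hJ.2.2 n).2 (hkw n k hk).1)
    convert this using 1; ring
  -- decomposition of elements of `J`
  have hdec : ∀ u ∈ J, ∃ α k γ : ℤ, u = ((m ^ 2 * α : ℤ) : O) + k * w + γ * (t + m * τ) ∧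
      (k : O) * w ∈ J := by
    intro u hu
    obtain ⟨x, y, z, rfl⟩ := h.span u
    have h6 : (((x - z * (m * τ) : ℤ)) : O) + y * w ∈ J := by
      have := J.sub_mem hu (J.mul_mem_left (z : O) hs)
      convert this using 1; push_cast; ring
    obtain ⟨⟨α, hα⟩, -⟩ := hkw _ _ h6
    refine ⟨α, y, z, ?_, hkw' _ _ h6⟩
    rw [← hα]; push_cast; ring
  -- the functionals on quotients
  have hfun : ∀ (p : ℕ), p.Prime → p ∣ m → ∀ A B : ℤ,
      (∀ k : ℤ, (k : O) * w ∈ J → (p : ℤ) ∣ B * k ∧ ∀ k' : ℤ, (k' : O) * w ∈ J → ∀ q,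
        k * k' * f 1 = m ^ 2 * q → (p : ℤ) ∣ B * q) →
      (∀ k : ℤ, (k : O) * w ∈ J → ∀ q, k * τ = m * q → (p : ℤ) ∣ B * q) →
      (p : ℤ) ∣ A * (τ ^ 2 - f 1 * d) + B * d → (p : ℤ) ∣ A ∧ (p : ℤ) ∣ B := by
    intro p hp hpm A B hB hB' hlast
    have hpp := Nat.prime_iff_prime_int.1 hp
    have hpm' : (p : ℤ) ∣ m := Int.natCast_dvd_natCast.2 hpm
    have hall := h.dvd_functional hJ p (h.functional A B) (by
      intro u hu v hv y hy
      obtain ⟨α, k, γ, rfl, hk⟩ := hdec u hu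
      obtain ⟨α', k', γ', rfl, hk'⟩ := hdec v hv
      obtain ⟨-, ⟨q, hq⟩, h7, h8⟩ := hkw 0 k (by simpa using hk)
      obtain ⟨-, ⟨q', hq'⟩, h7', h8'⟩ := hkw 0 k' (by simpa using hk')
      obtain ⟨v₁, hv₁⟩ := torsionIdeals_mul_mem hJ hk hk'
      obtain ⟨-, ⟨b', hb'⟩, ⟨a', ha'⟩⟩ := h.dvd_coords (N := (m : ℤ) ^ 2)
        (x := -(k * k' * (f 0 * f 2))) (y := k * k' * f 1) (z := - (k * k' * f 0)) (u := v₁) (by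
          rw [← hv₁]; push_cast; linear_combination -(k : O) * k' * hww)
      have hak : ∀ k : ℤ, (m : ℤ) ^ 2 ∣ k ^ 2 * f 0 → (p : ℤ) ∣ k * f 0 := by
        intro k hk2
        have : (p : ℤ) ∣ k ^ 2 * f 0 := (hpm'.trans (Dvd.intro_left _ (sq (m:ℤ)).symm)).trans hk2
        rcases hpp.dvd_or_dvd this with h9 | h9
        · exact (hpp.dvd_of_dvd_pow h9).mul_right _
        · exact h9.mul_left _
      have hmO : (((m : ℤ) ^ 2 : ℤ) : O) = (m : O) ^ 2 := by push_cast; ring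
      have ha'O : (k : O) * k' * f 0 = -(m ^ 2 * a') := by
        have := congrArg (Int.cast : ℤ → O) ha'; push_cast at this; linear_combination -this
      have hb'O : (k : O) * k' * f 1 = m ^ 2 * b' := by
        have := congrArg (Int.cast : ℤ → O) hb'; push_cast at this; linear_combination this
      have hqO : (k : O) * τ = m * q := by
        have := congrArg (Int.cast : ℤ → O) hq; push_cast at this; exact this
      have hqO' : (k' : O) * τ = m * q' := by
        have := congrArg (Int.cast : ℤ → O) hq'; push_cast at this; exact this
      have hdO : (f 3 : O) = m ^ 2 * d := by
        have := congrArg (Int.cast : ℤ → O) hd; push_cast at this; exact this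
      have heO : 2 * (m * τ : O) - f 2 = m ^ 2 * e := by
        have := congrArg (Int.cast : ℤ → O) he; push_cast at this; exact this
      have hy' : y = (((m ^ 2 * α * α' + m * τ * (α * γ' + α' * γ) + a' * f 2
          - (k * γ' + k' * γ) * (f 0 * d) + γ * γ' * (τ ^ 2 - f 1 * d)) : ℤ) : O) +
          ((α * k' + α' * k + b' + γ' * q + γ * q' + γ * γ' * d : ℤ) : O) * w +
          ((α * γ' + α' * γ + a' + γ * γ' * e : ℤ) : O) * t := by
        refine h.mul_cancel hm2 ?_
        rw [← hy]
        push_cast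
        linear_combination ((k : O) * k') * hww + (k * γ' + k' * γ : O) * hwt +
          (γ * γ' : O) * htt + ((-f 2 - t) : O) * ha'O + w * hb'O + ((m : O) * γ' * w) * hqO +
          ((m : O) * γ * w) * hqO' + (γ * γ' * t : O) * heO +
          (γ * γ' * (w - f 1) - (k * γ' + k' * γ) * f 0 : O) * hdO
      rw [hy', h.functional_apply]
      have hf2p : (p : ℤ) ∣ f 2 := by
        rw [hf2]
        exact dvd_add ((hpm'.mul_left 2).mul_right _) ((dvd_pow hpm' two_ne_zero).mul_right _)
      obtain ⟨m', hm'⟩ := hpm'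
      obtain ⟨c', hc'⟩ := hf2p
      obtain ⟨x₁, hx₁⟩ := hak k h8
      obtain ⟨x₂, hx₂⟩ := hak k' h8'
      obtain ⟨x₃, hx₃⟩ := (hB k hk).1
      obtain ⟨x₄, hx₄⟩ := (hB k' hk').1
      obtain ⟨x₅, hx₅⟩ := (hB k hk).2 k' hk' b' hb'
      obtain ⟨x₆, hx₆⟩ := hB' k hk q hq
      obtain ⟨x₇, hx₇⟩ := hB' k' hk' q' hq'
      obtain ⟨x₈, hx₈⟩ := hlast
      refine ⟨A * (m' * m * α * α' + m' * τ * (α * γ' + α' * γ) + a' * c' -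
        (x₁ * γ' + x₂ * γ) * d) + α * x₄ + α' * x₃ + x₅ + γ' * x₆ + γ * x₇ + γ * γ' * x₈, ?_⟩
      linear_combination (A * (m * α * α' + τ * (α * γ' + α' * γ))) * hm' + A * a' * hc' -
        A * d * γ' * hx₁ - A * d * γ * hx₂ + α' * hx₃ + α * hx₄ + hx₅ + γ' * hx₆ + γ * hx₇ +
        γ * γ' * hx₈)
    have r1 := hall (((1 : ℤ) : O) + (0 : ℤ) * w + (0 : ℤ) * t)
    have r2 := hall (((0 : ℤ) : O) + (1 : ℤ) * w + (0 : ℤ) * t)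
    rw [h.functional_apply] at r1 r2
    exact ⟨by simpa using r1, by simpa using r2⟩
  -- coprimality
  have hcop : IsCoprime (τ ^ 2 - f 1 * d) (m : ℤ) := by
    rw [Int.isCoprime_iff_gcd_eq_one]
    by_contra hne
    obtain ⟨p, hp, hpd⟩ := Nat.exists_prime_and_dvd hne
    have h1 : (p : ℤ) ∣ τ ^ 2 - f 1 * d :=
      (Int.natCast_dvd_natCast.2 hpd).trans (Int.gcd_dvd_left _ _)
    have h2 : (p : ℤ) ∣ m := (Int.natCast_dvd_natCast.2 hpd).trans (Int.gcd_dvd_right _ _)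
    have := (hfun p hp (Int.natCast_dvd_natCast.1 h2) 1 0 (by simp) (by simp)
      (by simpa using h1)).1
    exact (Nat.prime_iff_prime_int.1 hp).not_dvd_one this
  have hmk : ∀ k : ℤ, (k : O) * w ∈ J → (m : ℤ) ∣ k := by
    intro k hk
    obtain ⟨-, h2, h3, -⟩ := hkw 0 k (by simpa using hk)
    have h4 : (m : ℤ) ^ 2 ∣ k ^ 2 * (τ ^ 2 - f 1 * d) := by
      rw [mul_sub, ← mul_pow, ← mul_assoc]
      exact dvd_sub (pow_dvd_pow_of_dvd h2 2) (h3.mul_right _)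
    exact (Int.pow_dvd_pow_iff two_ne_zero).1 ((hcop.symm.pow_left).dvd_of_dvd_mul_right h4)
  have hmw : (m : O) * w ∈ J := by
    let L : Ideal ℤ := Submodule.comap (LinearMap.toSpanSingleton ℤ O w) (J.restrictScalars ℤ)
    have hL : ∀ k : ℤ, k ∈ L ↔ (k : O) * w ∈ J := by
      intro k
      simp [L]
    obtain ⟨l, hl⟩ := (inferInstance : L.IsPrincipal)
    have hlL : (l : O) * w ∈ J := (hL l).1 (by rw [hl]; exact Submodule.mem_span_singleton_self l)
    have hgen : ∀ k : ℤ, (k : O) * w ∈ J → l ∣ k := by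
      intro k hk
      have := (hL k).2 hk
      rw [hl] at this
      exact Ideal.mem_span_singleton.1 this
    obtain ⟨k, hk⟩ := hmk l hlL
    have hkm : k ∣ m := by
      have : l ∣ (m : ℤ) ^ 2 := hgen _ (J.mul_mem_right w (torsionIdeals_sq_mem hJ))
      rw [hk, sq] at this
      exact Int.dvd_of_mul_dvd_mul_left hm this
    have hku : IsUnit k := by
      rw [Int.isUnit_iff_natAbs_eq]
      by_contra hne
      obtain ⟨p, hp, hpd⟩ := Nat.exists_prime_and_dvd hne
      have hpk : (p : ℤ) ∣ k := Int.natCast_dvd.2 hpd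
      have hpm : (p : ℤ) ∣ m := hpk.trans hkm
      have := hfun p hp (Int.natCast_dvd_natCast.1 hpm) d (-(τ ^ 2 - f 1 * d)) (by
          intro k₁ hk₁
          obtain ⟨c₁, rfl⟩ := hgen k₁ hk₁
          refine ⟨?_, ?_⟩
          · exact ((hpm.trans (hk ▸ Dvd.intro _ rfl)).mul_right _).mul_left _
          · intro k₂ hk₂ q hq
            obtain ⟨c₂, rfl⟩ := hgen k₂ hk₂
            have : (m : ℤ) ^ 2 * (k ^ 2 * (c₁ * c₂ * f 1)) = m ^ 2 * q := by
              rw [← hq, hk]; ring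
            rw [← mul_left_cancel₀ hm2 this]
            exact ((dvd_pow hpk two_ne_zero).mul_right _).mul_left _)
        (by
          intro k₁ hk₁ q hq
          obtain ⟨c₁, rfl⟩ := hgen k₁ hk₁
          have : (m : ℤ) * (k * (c₁ * τ)) = m * q := by rw [← hq, hk]; ring
          rw [← mul_left_cancel₀ hm this]
          exact (hpk.mul_right _).mul_left _)
        (by rw [show d * (τ ^ 2 - f 1 * d) + -(τ ^ 2 - f 1 * d) * d = 0 by ring]; exact dvd_zero _)
      have h5 : (p : ℤ) ∣ τ ^ 2 - f 1 * d := (dvd_neg.1 this.2)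
      have := hcop.isUnit_of_dvd' h5 hpm
      exact (Nat.prime_iff_prime_int.1 hp).not_isUnit this
    rcases Int.isUnit_iff.1 hku with h1 | h1
    · rw [hk, h1] at hlL; simpa using hlL
    · rw [hk, h1] at hlL; simpa using hlL
  refine ⟨τ, rfl, ⟨-e, d, hf2, hd, hcop⟩, ?_⟩
  intro x y z
  constructor
  · intro hu
    have h6 : (((x - m * τ * z : ℤ)) : O) + y * w ∈ J := by
      have := J.sub_mem hu (J.mul_mem_left (z : O) hs)
      convert this using 1; push_cast; ring
    exact ⟨hmk y (hkw' _ _ h6), (hkw _ _ h6).1⟩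
  · rintro ⟨⟨y', rfl⟩, hx⟩
    have := J.add_mem (J.add_mem ((hJ.2.2 _).2 hx) (J.mul_mem_left (y' : O) hmw))
      (J.mul_mem_left (z : O) hs)
    convert this using 1; push_cast; ring

end

section
variable {O : Type*} [CommRing O] {f : Fin 4 → ℤ} {w t : O}

/-- The ideal spanned by `m²`, `mw` and `t + mτ`. -/
def IsFormBasis.torsionIdeal (h : IsFormBasis f w t) {m τ e d : ℤ}
    (hc : f 2 = 2 * m * τ + m ^ 2 * e) (hd : f 3 = m ^ 2 * d) : Ideal O where
  carrier := {u | ∃ α β γ : ℤ, u = (m : O) ^ 2 * α + m * β * w + γ * (t + m * τ)}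
  zero_mem' := ⟨0, 0, 0, by simp⟩
  add_mem' := by
    rintro _ _ ⟨α, β, γ, rfl⟩ ⟨α', β', γ', rfl⟩
    exact ⟨α + α', β + β', γ + γ', by push_cast; ring⟩
  smul_mem' := by
    rintro u _ ⟨α, β, γ, rfl⟩
    obtain ⟨x, y, z, rfl⟩ := h.span u
    have hww := h.ww
    have htt := h.tt
    have hwt := h.wt
    push_cast [hc, hd] at hww htt hwt
    refine ⟨x * α + y * (-β * f 0 * (τ + m * e) - γ * f 0 * d) +
        z * (-m * τ * α - m * β * f 0 * d + γ * (τ ^ 2 - f 1 * d + m * e * τ)),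
      x * β + y * (m * α + β * f 1 + γ * τ) + z * γ * m * d,
      x * γ - y * m * β * f 0 + z * (m ^ 2 * α - γ * (m * τ + m ^ 2 * e)), ?_⟩
    push_cast
    rw [smul_eq_mul]
    linear_combination (y * m * β : O) * hww + (z * γ : O) * htt + (z * m * β + y * γ : O) * hwt

theorem IsFormBasis.mem_torsionIdeal (h : IsFormBasis f w t) {m τ e d : ℤ}
    (hc : f 2 = 2 * m * τ + m ^ 2 * e) (hd : f 3 = m ^ 2 * d) (x y z : ℤ) :
    (x : O) + y * w + z * t ∈ h.torsionIdeal hc hd ↔ m ∣ y ∧ m ^ 2 ∣ x - m * τ * z := by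
  constructor
  · rintro ⟨α, β, γ, e⟩
    obtain ⟨h1, h2, h3⟩ := h.ext_iff (x := x) (y := y) (z := z) (x' := m ^ 2 * α + γ * (m * τ))
      (y' := m * β) (z' := γ) (by push_cast; linear_combination e)
    exact ⟨⟨β, h2⟩, ⟨α, by rw [h1, h3]; ring⟩⟩
  · rintro ⟨⟨β, rfl⟩, ⟨α, hα⟩⟩
    refine ⟨α, β, z, ?_⟩
    have := congrArg (Int.cast : ℤ → O) hα
    push_cast at this ⊢
    linear_combination this

theorem IsFormBasis.torsionIdeal_mem (h : IsFormBasis f w t) {m : ℕ} (hm : 0 < m) {τ e d : ℤ}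
    (hc : f 2 = 2 * m * τ + m ^ 2 * e) (hd : f 3 = m ^ 2 * d)
    (hco : IsCoprime (τ ^ 2 - f 1 * d) (m : ℤ)) :
    h.torsionIdeal hc hd ∈ torsionIdeals O m := by
  have hww := h.ww
  have htt := h.tt
  have hwt := h.wt
  push_cast [hc, hd] at hww htt hwt
  refine ⟨hm, le_antisymm ?_ ?_, fun n => ?_⟩
  · rw [Ideal.mul_le]
    rintro _ ⟨α, β, γ, rfl⟩ _ ⟨α', β', γ', rfl⟩
    rw [Ideal.mem_span_singleton]
    refine ⟨m ^ 2 * α * α' + m * (α * β' + α' * β) * w + (α * γ' + α' * γ) * (t + m * τ) +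
      β * β' * w ^ 2 + (β * γ' + β' * γ) * (-f 0 * m * d + τ * w) +
      γ * γ' * (τ ^ 2 - f 1 * d + d * w - e * t), ?_⟩
    push_cast
    linear_combination ((m : O) * (β * γ' + β' * γ)) * hwt + (γ * γ' : O) * htt
  · rw [Ideal.span_singleton_le_iff_mem]
    set J := h.torsionIdeal hc hd with hJ
    let S : Ideal O := Submodule.comap (LinearMap.mulLeft O ((m : O) ^ 2)) (J * J)
    have hS : ∀ x, x ∈ S ↔ (m : O) ^ 2 * x ∈ J * J := fun x => Iff.rfl
    have j1 : (m : O) ^ 2 ∈ J := ⟨1, 0, 0, by push_cast; ring⟩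
    have j2 : (m : O) * w ∈ J := ⟨0, 1, 0, by push_cast; ring⟩
    have j3 : t + (m : O) * τ ∈ J := ⟨0, 0, 1, by push_cast; ring⟩
    have e1 : (m : O) ^ 2 ∈ S := (hS _).2 (Ideal.mul_mem_mul j1 j1)
    have e2 : (m : O) * w ∈ S := (hS _).2 (Ideal.mul_mem_mul j1 j2)
    have e3 : t + (m : O) * τ ∈ S := (hS _).2 (Ideal.mul_mem_mul j1 j3)
    have e4 : w * w ∈ S := (hS _).2 (by
      have := Ideal.mul_mem_mul j2 j2
      convert this using 1; ring)
    have e5 : -(f 0 * m * d : O) + τ * w ∈ S := (hS _).2 (by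
      have := Ideal.mul_mem_mul j2 j3
      convert this using 1; linear_combination (-(m : O)) * hwt)
    have e6 : (τ ^ 2 - f 1 * d : O) + d * w - e * t ∈ S := (hS _).2 (by
      have := Ideal.mul_mem_mul j3 j3
      convert this using 1; linear_combination - htt)
    have e7 : (τ ^ 2 - f 1 * d : O) * w ∈ S := by
      have := S.sub_mem (S.sub_mem (S.sub_mem (S.mul_mem_left (τ : O) e5)
        (S.mul_mem_left (d : O) e4)) (S.mul_mem_left (f 0 * d : O) e3))
        (S.mul_mem_left (f 0 * d * e : O) e1)
      convert this using 1
      linear_combination (d : O) * hww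
    obtain ⟨u, v, huv⟩ := hco
    have huvO : (u : O) * (τ ^ 2 - f 1 * d) + v * m = 1 := by
      have := congrArg (Int.cast : ℤ → O) huv
      push_cast at this
      exact this
    have e8 : w ∈ S := by
      have := S.add_mem (S.mul_mem_left (u : O) e7) (S.mul_mem_left (v : O) e2)
      convert this using 1
      linear_combination (-w) * huvO
    have e9 : (τ ^ 2 - f 1 * d + e * m * τ : O) ∈ S := by
      have := S.sub_mem (S.add_mem e6 (S.mul_mem_left (e : O) e3)) (S.mul_mem_left (d : O) e8)
      convert this using 1
      ring
    have hco2 : IsCoprime (τ ^ 2 - f 1 * d + e * τ * m) ((m : ℤ) ^ 2) :=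
      IsCoprime.pow_right (IsCoprime.add_mul_right_left ⟨u, v, huv⟩ _)
    obtain ⟨u', v', huv'⟩ := hco2
    have huvO' := congrArg (Int.cast : ℤ → O) huv'
    push_cast at huvO'
    have : (1 : O) ∈ S := by
      have := S.add_mem (S.mul_mem_left (u' : O) e9) (S.mul_mem_left (v' : O) e1)
      convert this using 1
      linear_combination -huvO'
    simpa using (hS _).1 this
  · have := h.mem_torsionIdeal hc hd n 0 0
    simpa using this

theorem IsFormBasis.exists_torsionIdeal (h : IsFormBasis f w t) {m : ℕ} (hm : 0 < m) {τ : ℤ}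
    (hτ : TorsionData f m τ) : ∃ J ∈ torsionIdeals O m,
      ∀ x y z : ℤ, (x : O) + y * w + z * t ∈ J ↔ (m : ℤ) ∣ y ∧ (m : ℤ) ^ 2 ∣ x - m * τ * z := by
  obtain ⟨e, d, hc, hd, hco⟩ := hτ
  exact ⟨_, h.torsionIdeal_mem hm hc hd hco, h.mem_torsionIdeal hc hd⟩

theorem TorsionData.congr {f g : Fin 4 → ℤ} {m τ σ : ℤ}
    (h1 : m ∣ f 1 - g 1) (h2 : m ^ 2 ∣ f 2 - g 2) (h3 : m ^ 3 ∣ f 3 - g 3) (hτ : m ∣ τ - σ)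
    (h : TorsionData f m τ) : TorsionData g m σ := by
  obtain ⟨e, d, hc, hd, hco⟩ := h
  obtain ⟨x, hx⟩ := h1
  obtain ⟨y, hy⟩ := h2
  obtain ⟨z, hz⟩ := h3
  obtain ⟨k, hk⟩ := hτ
  refine ⟨e + 2 * k - y, d - m * z, by linear_combination hc - hy + 2 * m * hk,
    by linear_combination hd - hz, ?_⟩
  obtain rfl : σ = τ - m * k := by linarith
  rw [show g 1 = f 1 - m * x by linarith, show (τ - m * k) ^ 2 - (f 1 - m * x) * (d - m * z) =
    (τ ^ 2 - f 1 * d) + (-2 * τ * k + m * k ^ 2 + f 1 * z + x * d - m * x * z) * m by ring]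
  exact IsCoprime.add_mul_right_left hco _

end

section
variable {O : Type*} [CommRing O] {f : Fin 4 → ℤ} {w t : O}

/-- The torsion ideals whose image in `O/ℤ` contains a vector congruent to `v` modulo `m`. -/
def IsFormBasis.torsionIdealsOver (_ : IsFormBasis f w t) (m : ℕ) (v : ZMod m × ZMod m) :
    Set (Ideal O) :=
  {J | J ∈ torsionIdeals O m ∧ ∃ n x y : ℤ, (n : O) + x * w + y * t ∈ J ∧
    ((x : ZMod m), (y : ZMod m)) = v}

/-- The number of `τ` modulo `m` for which `f` satisfies the congruence conditions. -/
noncomputable def torsionCount (m : ℕ) (f : Fin 4 → ℤ) : ℕ :=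
  Nat.card {τ : ZMod m // TorsionData f m τ.val}

/-- A torsion ideal is described by a line in `O/ℤ` modulo `m`. -/
theorem IsFormBasis.exists_line (h : IsFormBasis f w t) {m : ℕ} {J : Ideal O}
    (hJ : J ∈ torsionIdeals O m) : ∃ q s : ℤ, IsCoprime q s ∧
      ∀ x y : ℤ, (∃ n : ℤ, (n : O) + x * w + y * t ∈ J) ↔ (m : ℤ) ∣ x * s - y * q := by
  obtain ⟨n₀, q, s, hmem, hco⟩ := h.exists_coprime_mem hJ
  obtain ⟨r', p, hrp⟩ := id hco
  obtain ⟨n, k, h'⟩ := h.transform (p := p) (q := q) (r := -r') (s := s) (by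
    rw [show p * s - q * -r' = 1 by linear_combination hrp]; norm_num)
  obtain ⟨τ, hτ, -, hτJ⟩ := h'.torsion_structure hJ (s := n₀ - k) (by
    convert hmem using 1; push_cast; ring)
  refine ⟨q, s, hco, fun x y => ?_⟩
  have hrpO := congrArg (Int.cast : ℤ → O) hrp
  push_cast at hrpO
  have key : ∀ N : ℤ, (N : O) + x * w + y * t =
      ((N - n * (x * s - y * q) - k * (x * r' + y * p) : ℤ) : O) +
        ((x * s - y * q : ℤ) : O) * ((n : O) + p * w + (-r' : ℤ) * t) +
        ((x * r' + y * p : ℤ) : O) * (k + q * w + s * t) := by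
    intro N
    push_cast
    linear_combination (-(x : O) * w - y * t) * hrpO
  constructor
  · rintro ⟨N, hN⟩
    rw [key, hτJ] at hN
    exact hN.1
  · intro hd
    refine ⟨m * τ * (x * r' + y * p) + n * (x * s - y * q) + k * (x * r' + y * p), ?_⟩
    rw [key, hτJ]
    exact ⟨hd, by ring_nf; exact dvd_zero _⟩

theorem IsFormBasis.card_lines (h : IsFormBasis f w t) {m : ℕ} [NeZero m] {J : Ideal O}
    (hJ : J ∈ torsionIdeals O m) :
    Nat.card {v : ZMod m × ZMod m // IsCoprime v.1 v.2 ∧ J ∈ h.torsionIdealsOver m v} =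
      m.totient := by
  obtain ⟨q, s, hco, hline⟩ := h.exists_line hJ
  obtain ⟨a, b, hab⟩ := id hco
  have habm := congrArg (Int.cast : ℤ → ZMod m) hab
  push_cast at habm
  rw [← ZMod.card_units_eq_totient, ← Nat.card_eq_fintype_card]
  symm
  have hF : ∀ z : (ZMod m)ˣ, IsCoprime (z * q : ZMod m) (z * s : ZMod m) ∧
      J ∈ h.torsionIdealsOver m (z * q, z * s) := by
    intro z
    refine ⟨⟨a * ↑z⁻¹, b * ↑z⁻¹, ?_⟩, hJ, ?_⟩
    · linear_combination (a * q + b * s : ZMod m) * z.inv_mul + habm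
    · obtain ⟨n, hn⟩ := (hline (((z : ZMod m).val : ℤ) * q) (((z : ZMod m).val : ℤ) * s)).2
        (by ring_nf; exact dvd_zero _)
      exact ⟨n, _, _, hn, by simp⟩
  refine Nat.card_eq_of_bijective (fun z : (ZMod m)ˣ => ⟨(z * q, z * s), hF z⟩)
    ⟨fun z z' e => ?_, ?_⟩
  · simp only [Subtype.mk.injEq, Prod.mk.injEq] at e
    refine Units.ext ?_
    linear_combination (a : ZMod m) * e.1 + b * e.2 + (z' - z : ZMod m) * habm
  · rintro ⟨v, ⟨u₁, u₂, hu⟩, -, N, x, y, hN, rfl⟩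
    obtain ⟨k, hk⟩ := (hline x y).1 ⟨N, hN⟩
    have hk' := congrArg (Int.cast : ℤ → ZMod m) hk
    push_cast at hk'
    simp only [CharP.cast_eq_zero, zero_mul] at hk'
    simp only at hu
    have hx : (x : ZMod m) = (a * x + b * y) * q := by
      linear_combination -(x : ZMod m) * habm + b * hk'
    have hy : (y : ZMod m) = (a * x + b * y) * s := by
      linear_combination -(y : ZMod m) * habm - a * hk'
    have hz : (a * x + b * y : ZMod m) * (u₁ * q + u₂ * s) = 1 := by
      linear_combination hu - u₁ * hx - u₂ * hy
    exact ⟨⟨_, _, hz, by rw [mul_comm]; exact hz⟩, Subtype.ext (Prod.ext hx.symm hy.symm)⟩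

theorem IsFormBasis.card_torsionIdealsOver (h : IsFormBasis f w t) {m : ℕ} [NeZero m]
    {p q r s : ℤ} (hdet : p * s - q * r = 1) :
    Nat.card (h.torsionIdealsOver m (q, s)) = torsionCount m (cubicSubst p q r s f) ∧
      Finite (h.torsionIdealsOver m (q, s)) := by
  have hm : 0 < m := NeZero.pos m
  have hm0 : (m : ℤ) ≠ 0 := by exact_mod_cast hm.ne'
  obtain ⟨n, k, h'⟩ := h.transform (p := p) (q := q) (r := r) (s := s) (by rw [hdet]; norm_num)
  rw [hdet, one_smul] at h'
  choose F hF hF' using fun τ : {τ : ZMod m // TorsionData (cubicSubst p q r s f) m τ.val} =>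
    h'.exists_torsionIdeal hm τ.2
  have hmem : ∀ τ, F τ ∈ h.torsionIdealsOver m (q, s) := by
    intro τ
    refine ⟨hF τ, m * (τ : ZMod m).val + k, q, s, ?_, rfl⟩
    have := (hF' τ (m * (τ : ZMod m).val) 0 1).2 (by simp)
    convert this using 1
    push_cast
    ring
  have hbij : Function.Bijective fun τ =>
      (⟨F τ, hmem τ⟩ : h.torsionIdealsOver m (q, s)) := by
    refine ⟨fun τ σ e => ?_, ?_⟩
    · simp only [Subtype.mk.injEq] at e
      have h1 := (hF' τ (m * (τ : ZMod m).val) 0 1).2 (by simp)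
      rw [e, hF' σ] at h1
      have h2 := h1.2
      rw [show (m : ℤ) * (τ : ZMod m).val - m * (σ : ZMod m).val * 1 =
        m * ((τ : ZMod m).val - (σ : ZMod m).val) by ring, sq] at h2
      have h3 := Int.dvd_of_mul_dvd_mul_left hm0 h2
      refine Subtype.ext ?_
      have h4 := (ZMod.intCast_eq_intCast_iff_dvd_sub _ _ m).2 h3
      simpa using h4.symm
    · rintro ⟨J, hJ, N, x, y, hN, hxy⟩
      simp only [Prod.mk.injEq] at hxy
      obtain ⟨q', s', hco', hline⟩ := h.exists_line hJ
      have h1 := (hline x y).1 ⟨N, hN⟩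
      obtain ⟨x', hx'⟩ := (ZMod.intCast_eq_intCast_iff_dvd_sub _ _ m).1 hxy.1
      obtain ⟨y', hy'⟩ := (ZMod.intCast_eq_intCast_iff_dvd_sub _ _ m).1 hxy.2
      obtain ⟨N', hN'⟩ := (hline q s).2 (by
        rw [show q * s' - s * q' = (x * s' - y * q') + m * (x' * s' - y' * q') by
          linear_combination s' * hx' - q' * hy']
        exact dvd_add h1 (Dvd.intro _ rfl))
      obtain ⟨τ, hτ, hτd, hτJ⟩ := h'.torsion_structure hJ (s := N' - k) (by
        convert hN' using 1; push_cast; ring)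
      have hττ : (m : ℤ) ∣ τ - ((τ : ZMod m).val : ℤ) := by
        rw [← ZMod.intCast_eq_intCast_iff_dvd_sub]
        simp
      refine ⟨⟨(τ : ZMod m), hτd.congr (by simp) (by simp) (by simp) hττ⟩, Subtype.ext ?_⟩
      refine Ideal.ext fun u => ?_
      obtain ⟨a, b, c, rfl⟩ := h'.span u
      rw [hF', hτJ]
      refine and_congr_right fun _ => ?_
      obtain ⟨l, hl⟩ := hττ
      rw [show a - m * ((τ : ZMod m).val : ℤ) * c = a - m * τ * c + m ^ 2 * (l * c) by
        linear_combination m * c * hl]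
      exact (Int.dvd_add_left (Dvd.intro _ rfl))
  exact ⟨(Nat.card_eq_of_bijective _ hbij).symm, Finite.of_surjective _ hbij.2⟩

/-- The unimodular vectors modulo `m`. -/
abbrev UnimodularVec (m : ℕ) : Type := {v : ZMod m × ZMod m // IsCoprime v.1 v.2}

noncomputable instance (m : ℕ) [NeZero m] : Fintype (UnimodularVec m) := Fintype.ofFinite _

/-- An integral matrix of determinant one whose second column reduces to `v`. -/
theorem exists_matrix_of_isCoprime {m : ℕ} [NeZero m] {v : ZMod m × ZMod m}
    (hv : IsCoprime v.1 v.2) : ∃ M : ℤ × ℤ × ℤ × ℤ, M.1 * M.2.2.2 - M.2.1 * M.2.2.1 = 1 ∧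
      ((M.2.1 : ZMod m), (M.2.2.2 : ZMod m)) = v := by
  have hm0 : (m : ℤ) ≠ 0 := by exact_mod_cast NeZero.ne m
  obtain ⟨a, b, hab⟩ := hv
  obtain ⟨x, y, hx, hy, hco⟩ := exists_coprime_lift (x := v.1.val) (y := v.2.val) hm0 (by
    intro p hp h1 h2 h3
    have h4 : ((a.val * v.1.val + b.val * v.2.val - 1 : ℤ) : ZMod m) = 0 := by
      push_cast
      simp [hab]
    rw [ZMod.intCast_zmod_eq_zero_iff_dvd] at h4
    have h5 := dvd_sub (dvd_add (h1.mul_left (a.val : ℤ)) (h2.mul_left (b.val : ℤ))) (h3.trans h4)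
    refine (Nat.prime_iff_prime_int.1 hp).not_dvd_one ?_
    convert h5 using 1
    ring)
  obtain ⟨r, p, hrp⟩ := hco
  refine ⟨(p, x, -r, y), by linear_combination hrp, Prod.ext ?_ ?_⟩
  · have := (ZMod.intCast_eq_intCast_iff_dvd_sub _ _ m).2 hx
    simpa using this.symm
  · have := (ZMod.intCast_eq_intCast_iff_dvd_sub _ _ m).2 hy
    simpa using this.symm

/-- A determinant one matrix attached to a unimodular vector modulo `m`. -/
noncomputable def unimodularMatrix {m : ℕ} [NeZero m]
    (v : UnimodularVec m) : ℤ × ℤ × ℤ × ℤ :=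
  (exists_matrix_of_isCoprime v.2).choose

/-- The form `f` transformed by `unimodularMatrix v`. -/
noncomputable def unimodularSubst {m : ℕ} [NeZero m]
    (v : UnimodularVec m) (f : Fin 4 → ℤ) : Fin 4 → ℤ :=
  cubicSubst (unimodularMatrix v).1 (unimodularMatrix v).2.1 (unimodularMatrix v).2.2.1
    (unimodularMatrix v).2.2.2 f

theorem IsFormBasis.card_over_unimodular (h : IsFormBasis f w t) {m : ℕ} [NeZero m]
    (v : UnimodularVec m) :
    Nat.card (h.torsionIdealsOver m v.1) = torsionCount m (unimodularSubst v f) ∧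
      Finite (h.torsionIdealsOver m v.1) := by
  have := h.card_torsionIdealsOver (m := m) (exists_matrix_of_isCoprime v.2).choose_spec.1
  rwa [(exists_matrix_of_isCoprime v.2).choose_spec.2] at this

theorem IsFormBasis.finite_torsionIdeals (h : IsFormBasis f w t) (m : ℕ) :
    (torsionIdeals O m).Finite := by
  rcases Nat.eq_zero_or_pos m with rfl | hm
  · convert Set.finite_empty
    exact Set.eq_empty_of_forall_notMem fun J hJ => hJ.1.ne' rfl
  have : NeZero m := ⟨hm.ne'⟩
  refine (Set.finite_iUnion fun v : UnimodularVec m =>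
    Set.finite_coe_iff.1 (h.card_over_unimodular v).2).subset ?_
  intro J hJ
  obtain ⟨n, x, y, hmem, hco⟩ := h.exists_coprime_mem hJ
  refine Set.mem_iUnion.2 ⟨⟨((x : ZMod m), (y : ZMod m)), ?_⟩, hJ, n, x, y, hmem, rfl⟩
  exact hco.map (Int.castRingHom (ZMod m))

theorem IsFormBasis.totient_mul_card (h : IsFormBasis f w t) (m : ℕ) [NeZero m] :
    m.totient * Nat.card (torsionIdeals O m) =
      ∑ v : UnimodularVec m, torsionCount m (unimodularSubst v f) := by
  classical
  have := (h.finite_torsionIdeals m).to_subtype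
  have := Fintype.ofFinite (torsionIdeals O m)
  have := fun v => (h.card_over_unimodular (m := m) v).2
  have e : (Σ J : torsionIdeals O m, {v : ZMod m × ZMod m //
      IsCoprime v.1 v.2 ∧ J.1 ∈ h.torsionIdealsOver m v}) ≃
      Σ v : UnimodularVec m, h.torsionIdealsOver m v.1 :=
    { toFun := fun x => ⟨⟨x.2.1, x.2.2.1⟩, ⟨x.1.1, x.2.2.2⟩⟩
      invFun := fun x => ⟨⟨x.2.1, x.2.2.1⟩, ⟨x.1.1, x.1.2, x.2.2⟩⟩
      left_inv := fun _ => rfl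
      right_inv := fun _ => rfl }
  have h1 := Nat.card_congr e
  rw [Nat.card_sigma, Nat.card_sigma] at h1
  simp only [fun v => (h.card_over_unimodular (m := m) v).1] at h1
  rw [← h1, Finset.sum_congr rfl fun J _ => h.card_lines J.2]
  simp [mul_comm]

end

section
variable {O : Type*} [CommRing O] {f : Fin 4 → ℤ} {w t : O}

theorem IsFormBasis.sq_dvd_disc (h : IsFormBasis f w t) {m : ℕ} {J : Ideal O}
    (hJ : J ∈ torsionIdeals O m) : (m : ℤ) ^ 2 ∣ cubicDisc f := by
  obtain ⟨n₀, q, s, hmem, hco⟩ := h.exists_coprime_mem hJ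
  obtain ⟨r, p, hrp⟩ := id hco
  have hdet : p * s - q * -r = 1 := by linear_combination hrp
  obtain ⟨n, k, h'⟩ := h.transform (p := p) (q := q) (r := -r) (s := s) (by rw [hdet]; norm_num)
  rw [hdet, one_smul] at h'
  obtain ⟨τ, -, ⟨e, d, hc, hd, -⟩, -⟩ := h'.torsion_structure hJ (s := n₀ - k) (by
    convert hmem using 1; push_cast; ring)
  have h1 := cubicDisc_subst (f := f) p q (-r) s
  rw [hdet, one_pow, one_mul] at h1
  rw [← h1]
  generalize cubicSubst p q (-r) s f = g at *
  simp only [cubicDisc, hc, hd]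
  refine ⟨(2 * τ + m * e) ^ 2 * g 1 ^ 2 - 4 * g 0 * m * (2 * τ + m * e) ^ 3 - 4 * g 1 ^ 3 * d -
    27 * g 0 ^ 2 * m ^ 2 * d ^ 2 + 18 * g 0 * g 1 * m * (2 * τ + m * e) * d, ?_⟩
  ring

open FractionalIdeal nonZeroDivisors

/-- The fractional ideal `J/m`. -/
noncomputable def fracOfTorsion [IsDomain O] (m : ℕ) (J : Ideal O) :
    FractionalIdeal O⁰ (FractionRing O) :=
  spanSingleton O⁰ ((m : FractionRing O))⁻¹ * (J : FractionalIdeal O⁰ (FractionRing O))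

theorem IsFormBasis.natCast_ne_zero (h : IsFormBasis f w t) [IsDomain O] {m : ℕ} (hm : 0 < m) :
    (m : FractionRing O) ≠ 0 := by
  have h1 : (m : O) ≠ 0 := by
    intro h0
    have := h.intCast_injective (n := (m : ℤ)) (m := 0) (by push_cast; exact h0)
    exact hm.ne' (by exact_mod_cast this)
  have := (map_ne_zero_iff (algebraMap O (FractionRing O)) (IsFractionRing.injective O _)).2 h1
  simpa using this

theorem IsFormBasis.mem_fracOfTorsion (h : IsFormBasis f w t) [IsDomain O] {m : ℕ} (hm : 0 < m)
    (J : Ideal O) (x : FractionRing O) : x ∈ fracOfTorsion m J ↔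
      ∃ y ∈ J, algebraMap O (FractionRing O) y = m * x := by
  have hm0 := h.natCast_ne_zero hm
  rw [fracOfTorsion, mem_singleton_mul]
  constructor
  · rintro ⟨_, hy, rfl⟩
    obtain ⟨y, hyJ, rfl⟩ := (mem_coeIdeal _).1 hy
    exact ⟨y, hyJ, by rw [mul_inv_cancel_left₀ hm0]⟩
  · rintro ⟨y, hy, e⟩
    exact ⟨_, mem_coeIdeal_of_mem _ hy, by rw [e, inv_mul_cancel_left₀ hm0]⟩

theorem IsFormBasis.fracOfTorsion_mul_self (h : IsFormBasis f w t) [IsDomain O] {m : ℕ}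
    {J : Ideal O} (hJ : J ∈ torsionIdeals O m) : fracOfTorsion m J * fracOfTorsion m J = 1 := by
  have hm0 := h.natCast_ne_zero hJ.1
  rw [fracOfTorsion, mul_mul_mul_comm, spanSingleton_mul_spanSingleton, ← coeIdeal_mul, hJ.2.1,
    coeIdeal_span_singleton, spanSingleton_mul_spanSingleton]
  rw [show ((m : FractionRing O)⁻¹ * (m : FractionRing O)⁻¹ *
    algebraMap O (FractionRing O) ((m : O) ^ 2)) = 1 by
      rw [map_pow, map_natCast]; field_simp, spanSingleton_one]

theorem IsFormBasis.intCast_mem_fracOfTorsion (h : IsFormBasis f w t) [IsDomain O] {m : ℕ}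
    {J : Ideal O} (hJ : J ∈ torsionIdeals O m) (n : ℤ) :
    (n : FractionRing O) ∈ fracOfTorsion m J ↔ (m : ℤ) ∣ n := by
  have hm0 : (m : ℤ) ≠ 0 := by exact_mod_cast hJ.1.ne'
  rw [h.mem_fracOfTorsion hJ.1]
  have : (∃ y ∈ J, algebraMap O (FractionRing O) y = m * n) ↔ ((m * n : ℤ) : O) ∈ J := by
    constructor
    · rintro ⟨y, hy, e⟩
      convert hy
      apply IsFractionRing.injective O (FractionRing O)
      rw [e]; simp
    · intro h
      exact ⟨_, h, by simp⟩
  rw [this, hJ.2.2, sq]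
  exact Int.mul_dvd_mul_iff_left hm0

theorem IsFormBasis.exists_fracOfTorsion (h : IsFormBasis f w t) [IsDomain O] [Module.Finite ℤ O]
    {I : FractionalIdeal O⁰ (FractionRing O)} (hI : I * I = 1) :
    ∃ m, ∃ J ∈ torsionIdeals O m, fracOfTorsion m J = I := by
  have hmul : ∀ x ∈ I, ∀ y ∈ I, ∃ z : O, algebraMap O (FractionRing O) z = x * y := by
    intro x hx y hy
    have := mul_mem_mul hx hy
    rw [hI] at this
    exact (mem_one_iff _).1 this
  let L : Ideal ℤ :=
    { carrier := {n | (n : FractionRing O) ∈ I}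
      zero_mem' := by simpa using I.zero_mem
      add_mem' := fun {a b} ha hb => by
        have := Submodule.add_mem (I : Submodule O (FractionRing O)) ha hb
        simpa using this
      smul_mem' := fun n a ha => by
        have := Submodule.smul_mem (I : Submodule O (FractionRing O)) (n : O) ha
        simpa [Algebra.smul_def] using this }
  have hL : ∀ n : ℤ, n ∈ L ↔ (n : FractionRing O) ∈ I := fun n => Iff.rfl
  obtain ⟨N, hN0, hN⟩ : ∃ N : ℤ, N ≠ 0 ∧ N ∈ L := by
    obtain ⟨a, ha, haI⟩ := I.isFractional
    have ha0 : a ≠ 0 := nonZeroDivisors.ne_zero ha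
    have h1 : Ideal.comap (algebraMap ℤ O) (Ideal.span {a}) ≠ ⊥ :=
      Ideal.comap_ne_bot_of_integral_mem ha0 (Ideal.mem_span_singleton_self a)
        (Algebra.IsIntegral.isIntegral a)
    obtain ⟨N, hN, hN0⟩ := Submodule.exists_mem_ne_zero_of_ne_bot h1
    refine ⟨N, hN0, ?_⟩
    obtain ⟨b, hb⟩ := Ideal.mem_span_singleton.1 (Ideal.mem_comap.1 hN)
    rw [hL]
    have h2 : ∀ z ∈ I * I, (N : FractionRing O) * z ∈ I := by
      intro z hz
      refine FractionalIdeal.mul_induction_on hz ?_ ?_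
      · intro x hx y hy
        obtain ⟨u, hu⟩ := haI x hx
        have := Submodule.smul_mem (I : Submodule O (FractionRing O)) (u * b) hy
        rw [FractionalIdeal.mem_coe] at this
        convert this using 1
        have hbK := congrArg (algebraMap O (FractionRing O)) hb
        simp only [eq_intCast, map_intCast, map_mul] at hbK
        rw [Algebra.smul_def] at hu ⊢
        rw [map_mul, hu, hbK]
        ring
      · intro x y hx hy
        rw [mul_add]
        exact Submodule.add_mem (I : Submodule O (FractionRing O)) hx hy
    have := h2 1 (by rw [hI]; exact one_mem_one _)
    simpa using this
  obtain ⟨l, hl⟩ := (inferInstance : L.IsPrincipal)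
  have hl' : ∀ n : ℤ, (n : FractionRing O) ∈ I ↔ (l.natAbs : ℤ) ∣ n := by
    intro n
    rw [← hL, hl, Int.natAbs_dvd]
    exact Ideal.mem_span_singleton
  have hm : 0 < l.natAbs := by
    rw [Int.natAbs_pos]
    rintro rfl
    have := (hl' N).1 hN
    simp at this
    exact hN0 this
  generalize l.natAbs = m at hl' hm
  clear hl l
  have hm0 := h.natCast_ne_zero hm
  have hmI : (m : FractionRing O) ∈ I := by simpa using (hl' m).2 dvd_rfl
  let J : Ideal O :=
    { carrier := {x | (m : FractionRing O)⁻¹ * algebraMap O (FractionRing O) x ∈ I}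
      zero_mem' := by simpa using I.zero_mem
      add_mem' := fun {a b} ha hb => by
        have := Submodule.add_mem (I : Submodule O (FractionRing O)) ha hb
        simpa [mul_add] using this
      smul_mem' := fun c a ha => by
        have := Submodule.smul_mem (I : Submodule O (FractionRing O)) c ha
        rw [Algebra.smul_def, mul_left_comm] at this
        simpa using this }
  have hJ : ∀ x, x ∈ J ↔ (m : FractionRing O)⁻¹ * algebraMap O (FractionRing O) x ∈ I :=
    fun x => Iff.rfl
  have hJI : fracOfTorsion m J = I := by
    ext x
    rw [h.mem_fracOfTorsion hm]
    constructor
    · rintro ⟨y, hy, e⟩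
      rw [hJ, e, inv_mul_cancel_left₀ hm0] at hy
      exact hy
    · intro hx
      obtain ⟨z, hz⟩ := hmul _ hmI x hx
      exact ⟨z, by rw [hJ, hz, inv_mul_cancel_left₀ hm0]; exact hx, hz⟩
  refine ⟨m, J, ⟨hm, ?_, ?_⟩, hJI⟩
  · apply coeIdeal_injective (R := O) (K := FractionRing O)
    have h1 : (J : FractionalIdeal O⁰ (FractionRing O)) =
        spanSingleton O⁰ (m : FractionRing O) * I := by
      rw [← hJI, fracOfTorsion, ← mul_assoc, spanSingleton_mul_spanSingleton, mul_inv_cancel₀ hm0,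
        spanSingleton_one, one_mul]
    simp only [coeIdeal_mul]
    rw [h1, mul_mul_mul_comm, hI, mul_one, spanSingleton_mul_spanSingleton,
      coeIdeal_span_singleton, map_pow, map_natCast, sq]
  · intro n
    have hm0' : (m : ℤ) ≠ 0 := by exact_mod_cast hm.ne'
    rw [hJ]
    have hcast : algebraMap O (FractionRing O) (n : O) = (n : FractionRing O) := by simp
    rw [hcast]
    constructor
    · intro hn
      obtain ⟨z, hz⟩ := hmul _ hn _ hn
      have h1 : ((n ^ 2 : ℤ) : O) = ((m ^ 2 : ℤ) : O) * z := by
        apply IsFractionRing.injective O (FractionRing O)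
        rw [map_mul, hz]
        simp only [map_intCast]
        push_cast
        field_simp
      have h2 := (h.dvd_coords (x := n ^ 2) (y := 0) (z := 0) (u := z) (by
        rw [← h1]; simp)).1
      obtain ⟨k, rfl⟩ := (Int.pow_dvd_pow_iff two_ne_zero).1 h2
      have h3 : (m : FractionRing O)⁻¹ * ((m * k : ℤ) : FractionRing O) = (k : ℤ) := by
        push_cast
        rw [inv_mul_cancel_left₀ hm0]
      rw [h3, hl'] at hn
      rw [sq]
      exact mul_dvd_mul_left _ hn
    · rintro ⟨k, rfl⟩
      have h3 : (m : FractionRing O)⁻¹ * ((m ^ 2 * k : ℤ) : FractionRing O) = (m * k : ℤ) := by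
        push_cast
        field_simp
      rw [h3, hl']
      exact Dvd.intro _ rfl

theorem IsFormBasis.idealGroupTwoTorsion_eq (h : IsFormBasis f w t) [IsDomain O]
    [Module.Finite ℤ O] :
    idealGroupTwoTorsion O = Nat.card (Σ m : ℕ, torsionIdeals O m) := by
  symm
  have hunit : ∀ x : (Σ m : ℕ, torsionIdeals O m),
      fracOfTorsion x.1 x.2.1 * fracOfTorsion x.1 x.2.1 = 1 :=
    fun x => h.fracOfTorsion_mul_self x.2.2
  refine Nat.card_eq_of_bijective (fun x => ⟨⟨_, _, hunit x, hunit x⟩, ?_⟩) ⟨?_, ?_⟩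
  · rw [sq]
    exact Units.ext (hunit x)
  · rintro ⟨m, J, hJ⟩ ⟨m', J', hJ'⟩ e
    simp only [Subtype.mk.injEq, Units.mk.injEq] at e
    have hmm : m = m' := by
      apply Nat.dvd_antisymm
      · have := (h.intCast_mem_fracOfTorsion hJ' m').2 dvd_rfl
        rw [← e.1, h.intCast_mem_fracOfTorsion hJ] at this
        exact_mod_cast this
      · have := (h.intCast_mem_fracOfTorsion hJ m).2 dvd_rfl
        rw [e.1, h.intCast_mem_fracOfTorsion hJ'] at this
        exact_mod_cast this
    subst hmm
    have hm0 := h.natCast_ne_zero hJ.1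
    have : J = J' := by
      have := congrArg (spanSingleton O⁰ (m : FractionRing O) * ·) e.1
      simp only [fracOfTorsion] at this
      rw [← mul_assoc, ← mul_assoc, spanSingleton_mul_spanSingleton, mul_inv_cancel₀ hm0,
        spanSingleton_one, one_mul, one_mul] at this
      exact coeIdeal_injective this
    subst this
    rfl
  · rintro ⟨I, hI⟩
    have hI' : (I : FractionalIdeal O⁰ (FractionRing O)) * I = 1 := by
      rw [← Units.val_mul, ← sq, hI, Units.val_one]
    obtain ⟨m, J, hJ, e⟩ := h.exists_fracOfTorsion hI'
    exact ⟨⟨m, J, hJ⟩, Subtype.ext (Units.ext e)⟩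

theorem IsFormBasis.torsionIdeals_eq_empty (h : IsFormBasis f w t) (hf : cubicDisc f ≠ 0) {m : ℕ}
    (hm : (cubicDisc f).natAbs < m ^ 2) : torsionIdeals O m = ∅ := by
  refine Set.eq_empty_of_forall_notMem fun J hJ => ?_
  have := Int.natAbs_dvd_natAbs.2 (h.sq_dvd_disc hJ)
  have := Nat.le_of_dvd (Int.natAbs_pos.2 hf) this
  rw [Int.natAbs_pow, Int.natAbs_natCast] at this
  omega

theorem IsFormBasis.idealGroupTwoTorsion_eq_sum (h : IsFormBasis f w t) [IsDomain O]
    [Module.Finite ℤ O] (hf : cubicDisc f ≠ 0) {N : ℕ} (hN : (cubicDisc f).natAbs < N ^ 2) :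
    idealGroupTwoTorsion O = ∑ m ∈ Finset.range N, Nat.card (torsionIdeals O m) := by
  rw [h.idealGroupTwoTorsion_eq, ← Finset.sum_coe_sort]
  have hlt : ∀ x : (Σ m : ℕ, torsionIdeals O m), x.1 < N := by
    rintro ⟨m, J, hJ⟩
    by_contra hle
    rw [h.torsionIdeals_eq_empty hf (hN.trans_le (Nat.pow_le_pow_left (not_lt.1 hle) 2))] at hJ
    exact hJ
  let e : (Σ m : ℕ, torsionIdeals O m) ≃
      Σ m : {m // m ∈ Finset.range N}, torsionIdeals O m.1 :=
    { toFun := fun x => ⟨⟨x.1, Finset.mem_range.2 (hlt x)⟩, x.2⟩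
      invFun := fun x => ⟨x.1.1, x.2⟩
      left_inv := fun _ => rfl
      right_inv := fun _ => rfl }
  have := fun m : ℕ => (h.finite_torsionIdeals m).to_subtype
  rw [Nat.card_congr e, Nat.card_sigma]

end

theorem card_preimage_mul {G H : Type*} [AddCommGroup G] [AddCommGroup H] [Finite G]
    (φ : G →+ H) (hφ : Function.Surjective φ) (T : Set H) :
    Nat.card (φ ⁻¹' T) * Nat.card H = Nat.card T * Nat.card G := by
  obtain ⟨σ, hσ⟩ := hφ.hasRightInverse
  have key : ∀ T : Set H, Nat.card (φ ⁻¹' T) = Nat.card T * Nat.card φ.ker := by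
    intro T
    rw [← Nat.card_prod]
    refine Nat.card_congr
      { toFun := fun g => (⟨φ g, g.2⟩, ⟨g - σ (φ g), by simp [AddMonoidHom.mem_ker, hσ (φ g)]⟩)
        invFun := fun x => ⟨σ x.1 + x.2, by
          have := x.2.2
          rw [AddMonoidHom.mem_ker] at this
          simp [hσ x.1.1, this]⟩
        left_inv := fun g => by simp
        right_inv := fun x => by
          have := x.2.2
          rw [AddMonoidHom.mem_ker] at this
          refine Prod.ext (Subtype.ext ?_) (Subtype.ext ?_) <;> simp [hσ x.1.1, this] }
  have h1 := key Set.univ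
  rw [Set.preimage_univ, Nat.card_congr (Equiv.Set.univ G), Nat.card_congr (Equiv.Set.univ H)] at h1
  rw [key T, h1]
  ring

/-- The number of vectors modulo `m` whose reductions modulo all primes dividing `m` lie in
prescribed sets. -/
theorem card_zmod_local (ι : Type*) [Fintype ι] (m : ℕ) [NeZero m]
    (B : ∀ p : ℕ, Set (ι → ZMod p)) :
    Nat.card {v : ι → ZMod m // ∀ p ∈ m.primeFactors, (fun i => ((v i).cast : ZMod p)) ∈ B p} *
      ∏ p ∈ m.primeFactors, p ^ Fintype.card ι =
    (∏ p ∈ m.primeFactors, Nat.card (B p)) * m ^ Fintype.card ι := by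
  classical
  let P := {p // p ∈ m.primeFactors}
  have hdvd : ∀ p : P, p.1 ∣ m := fun p => Nat.dvd_of_mem_primeFactors p.2
  have hne : ∀ p : P, NeZero p.1 := fun p => ⟨(Nat.prime_of_mem_primeFactors p.2).ne_zero⟩
  let φ : (ι → ZMod m) →+ (∀ p : P, ι → ZMod p.1) :=
    { toFun := fun v p i => ZMod.castHom (hdvd p) (ZMod p.1) (v i)
      map_zero' := by ext; simp
      map_add' := fun u v => by ext p i; exact map_add (ZMod.castHom (hdvd p) (ZMod p.1)) _ _ }
  have hprod : ∏ p : P, p.1 ∣ m := by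
    have := Nat.prod_primeFactors_dvd m
    rwa [← Finset.prod_coe_sort] at this
  have hφ : Function.Surjective φ := by
    intro y
    have hcop : Pairwise (Function.onFun Nat.Coprime fun p : P => p.1) := by
      intro p q hpq
      exact (Nat.coprime_primes (Nat.prime_of_mem_primeFactors p.2)
        (Nat.prime_of_mem_primeFactors q.2)).2 fun h => hpq (Subtype.ext h)
    choose v hv using fun i => ZMod.castHom_surjective hprod
      ((ZMod.prodEquivPi (fun p : P => p.1) hcop).symm fun p => y p i)
    refine ⟨v, ?_⟩
    ext p i
    have h1 : (ZMod.castHom (hdvd p) (ZMod p.1)) =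
        ((Pi.evalRingHom (fun p : P => ZMod p.1) p).comp
          (ZMod.prodEquivPi (fun p : P => p.1) hcop).toRingHom).comp
          (ZMod.castHom hprod (ZMod (∏ p : P, p.1))) := Subsingleton.elim _ _
    change ZMod.castHom (hdvd p) (ZMod p.1) (v i) = _
    rw [h1]
    simp [hv, -ZMod.castHom_apply]
  have h2 := card_preimage_mul φ hφ (Set.univ.pi fun p : P => B p.1)
  have e1 : Nat.card {v : ι → ZMod m // ∀ p ∈ m.primeFactors,
      (fun i => ((v i).cast : ZMod p)) ∈ B p} = Nat.card (φ ⁻¹' Set.univ.pi fun p : P => B p.1) :=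
    Nat.card_congr (Equiv.subtypeEquivRight fun v => by
      simp only [Set.mem_preimage, Set.mem_univ_pi]
      exact ⟨fun H p => H p.1 p.2, fun H p hp => H ⟨p, hp⟩⟩)
  have e2 : Nat.card (Set.univ.pi fun p : P => B p.1) = ∏ p ∈ m.primeFactors, Nat.card (B p) := by
    rw [Nat.card_congr (Equiv.Set.univPi _), Nat.card_pi]
    exact Finset.prod_coe_sort m.primeFactors fun p => Nat.card (B p)
  have e3 : Nat.card (∀ p : P, ι → ZMod p.1) = ∏ p ∈ m.primeFactors, p ^ Fintype.card ι := by
    rw [Nat.card_pi, ← Finset.prod_coe_sort m.primeFactors fun p => p ^ Fintype.card ι]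
    refine Finset.prod_congr rfl fun p _ => ?_
    rw [Nat.card_fun, Nat.card_zmod, Nat.card_eq_fintype_card (α := ι)]
  rw [e1, ← e2, ← e3, h2, Nat.card_fun, Nat.card_zmod, Nat.card_eq_fintype_card (α := ι)]

theorem isUnit_zmod_iff {m : ℕ} [NeZero m] (x : ZMod m) :
    IsUnit x ↔ ∀ p ∈ m.primeFactors, (x.cast : ZMod p) ≠ 0 := by
  have hx : x = ((x.val : ℤ) : ZMod m) := by simp
  have hxp : ∀ p, (x.cast : ZMod p) = 0 ↔ p ∣ x.val := fun p => by
    rw [← ZMod.natCast_val, ZMod.natCast_eq_zero_iff]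
  simp only [ne_eq, hxp]
  conv_lhs => rw [hx]
  rw [ZMod.coe_int_isUnit_iff_isCoprime, Nat.isCoprime_iff_coprime]
  constructor
  · intro h p hp hpx
    have := Nat.dvd_gcd (Nat.dvd_of_mem_primeFactors hp) hpx
    rw [h] at this
    exact (Nat.prime_of_mem_primeFactors hp).one_lt.ne' (Nat.dvd_one.1 this)
  · intro h
    by_contra hne
    obtain ⟨p, hp, hpd⟩ := Nat.exists_prime_and_dvd hne
    exact h p (Nat.mem_primeFactors.2 ⟨hp, hpd.trans (Nat.gcd_dvd_left _ _), NeZero.ne m⟩)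
      (hpd.trans (Nat.gcd_dvd_right _ _))

theorem isCoprime_zmod_iff {m : ℕ} [NeZero m] (x y : ZMod m) :
    IsCoprime x y ↔ ∀ p ∈ m.primeFactors, ((x.cast : ZMod p), (y.cast : ZMod p)) ≠ 0 := by
  constructor
  · rintro ⟨a, b, hab⟩ p hp h0
    have hpm := Nat.dvd_of_mem_primeFactors hp
    have : Fact p.Prime := ⟨Nat.prime_of_mem_primeFactors hp⟩
    have h1 := congrArg (ZMod.castHom hpm (ZMod p)) hab
    simp only [map_add, map_mul, map_one, ZMod.castHom_apply] at h1
    simp only [Prod.mk_eq_zero] at h0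
    rw [h0.1, h0.2] at h1
    simp at h1
  · intro h
    have hm0 : (m : ℤ) ≠ 0 := by exact_mod_cast NeZero.ne m
    obtain ⟨x', y', hx, hy, hco⟩ := exists_coprime_lift (x := x.val) (y := y.val) hm0 (by
      intro p hp h1 h2 h3
      refine h p (Nat.mem_primeFactors.2 ⟨hp, Int.natCast_dvd_natCast.1 h3, NeZero.ne m⟩) ?_
      rw [Prod.mk_eq_zero, ← ZMod.natCast_val, ← ZMod.natCast_val, ZMod.natCast_eq_zero_iff,
        ZMod.natCast_eq_zero_iff]
      exact ⟨Int.natCast_dvd_natCast.1 h1, Int.natCast_dvd_natCast.1 h2⟩)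
    have := hco.map (Int.castRingHom (ZMod m))
    have e1 := (ZMod.intCast_eq_intCast_iff_dvd_sub _ _ m).2 hx
    have e2 := (ZMod.intCast_eq_intCast_iff_dvd_sub _ _ m).2 hy
    simp only [ZMod.natCast_val] at e1 e2
    simpa [← e1, ← e2] using this

theorem card_unimodularVec (m : ℕ) [NeZero m] :
    Nat.card (UnimodularVec m) * ∏ p ∈ m.primeFactors, p ^ 2 =
      (∏ p ∈ m.primeFactors, (p ^ 2 - 1)) * m ^ 2 := by
  have h := card_zmod_local (Fin 2) m fun p => {v | (v 0, v 1) ≠ 0}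
  rw [Fintype.card_fin] at h
  have e : Nat.card (UnimodularVec m) = Nat.card {v : Fin 2 → ZMod m // ∀ p ∈ m.primeFactors,
      (fun i => ((v i).cast : ZMod p)) ∈ {v : Fin 2 → ZMod p | (v 0, v 1) ≠ 0}} := by
    refine Nat.card_congr (Equiv.subtypeEquiv (finTwoArrowEquiv (ZMod m)).symm fun v => ?_)
    rw [isCoprime_zmod_iff]
    rfl
  rw [e, h]
  congr 1
  refine Finset.prod_congr rfl fun p hp => ?_
  have : Fact p.Prime := ⟨Nat.prime_of_mem_primeFactors hp⟩
  have : {v : Fin 2 → ZMod p | (v 0, v 1) ≠ 0} = ({0} : Set (Fin 2 → ZMod p))ᶜ := by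
    ext v
    simp only [ne_eq, Set.mem_ofPred_eq, Set.mem_compl_iff, Set.mem_singleton_iff, Prod.mk_eq_zero,
      funext_iff, Fin.forall_fin_two, Pi.zero_apply]
  rw [this, Nat.card_coe_set_eq, Set.ncard_compl, Set.ncard_singleton, Nat.card_fun, Nat.card_zmod]
  simp

theorem card_zmod_quadric (p : ℕ) [Fact p.Prime] :
    Nat.card {v : Fin 3 → ZMod p | v 1 ^ 2 - v 0 * v 2 = 0} = p ^ 2 := by
  classical
  have h : Nat.card {v : Fin 3 → ZMod p | v 1 ^ 2 - v 0 * v 2 = 0} =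
      Nat.card (ZMod p × ZMod p) := by
    refine Nat.card_eq_of_bijective (fun v => if v.1 2 = 0 then (v.1 0, 0) else (v.1 1, v.1 2))
      ⟨?_, ?_⟩
    · rintro ⟨u, hu⟩ ⟨v, hv⟩ e
      simp only [Set.mem_ofPred_eq] at hu hv e
      refine Subtype.ext (funext fun i => ?_)
      split_ifs at e with h1 h2 h2
      · rw [h1, mul_zero, sub_zero, sq_eq_zero_iff] at hu
        rw [h2, mul_zero, sub_zero, sq_eq_zero_iff] at hv
        simp only [Prod.mk.injEq] at e
        fin_cases i
        · exact e.1
        · exact hu.trans hv.symm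
        · exact h1.trans h2.symm
      · simp only [Prod.mk.injEq] at e
        exact absurd e.2.symm h2
      · simp only [Prod.mk.injEq] at e
        exact absurd e.2 h1
      · simp only [Prod.mk.injEq] at e
        fin_cases i
        · refine mul_right_cancel₀ h1 ?_
          change u 0 * u 2 = v 0 * u 2
          rw [sub_eq_zero] at hu hv
          rw [← hu, e.2, ← hv, e.1]
        · exact e.1
        · exact e.2
    · rintro ⟨x, y⟩
      by_cases hy : y = 0
      · exact ⟨⟨![x, 0, 0], by simp⟩, by simp [hy]⟩
      · exact ⟨⟨![x ^ 2 / y, x, y], by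
          simp only [Set.mem_ofPred_eq, Matrix.cons_val]
          field_simp; ring⟩, by simp [hy]⟩
  rw [h, Nat.card_prod, Nat.card_zmod, sq]

theorem card_isUnit_quadric (m : ℕ) [NeZero m] :
    Nat.card {v : Fin 3 → ZMod m | IsUnit (v 1 ^ 2 - v 0 * v 2)} = m ^ 2 * m.totient := by
  have h := card_zmod_local (Fin 3) m fun p => {v | v 1 ^ 2 - v 0 * v 2 ≠ 0}
  rw [Fintype.card_fin] at h
  have e : Nat.card {v : Fin 3 → ZMod m | IsUnit (v 1 ^ 2 - v 0 * v 2)} =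
      Nat.card {v : Fin 3 → ZMod m // ∀ p ∈ m.primeFactors,
      (fun i => ((v i).cast : ZMod p)) ∈ {v : Fin 3 → ZMod p | v 1 ^ 2 - v 0 * v 2 ≠ 0}} := by
    refine Nat.card_congr (Equiv.subtypeEquivRight fun v => ?_)
    simp only [Set.mem_ofPred_eq]
    rw [isUnit_zmod_iff]
    refine forall₂_congr fun p hp => ?_
    have hpm := Nat.dvd_of_mem_primeFactors hp
    rw [← ZMod.castHom_apply (R := ZMod p) (h := hpm), map_sub, map_mul, map_pow]
    rfl
  rw [← e] at h
  have hB : ∏ p ∈ m.primeFactors, Nat.card {v : Fin 3 → ZMod p | v 1 ^ 2 - v 0 * v 2 ≠ 0} =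
      (∏ p ∈ m.primeFactors, p ^ 2) * ∏ p ∈ m.primeFactors, (p - 1) := by
    rw [← Finset.prod_mul_distrib]
    refine Finset.prod_congr rfl fun p hp => ?_
    have : Fact p.Prime := ⟨Nat.prime_of_mem_primeFactors hp⟩
    have h1 := card_zmod_quadric p
    rw [Nat.card_coe_set_eq] at h1 ⊢
    have h2 := Set.ncard_compl {v : Fin 3 → ZMod p | v 1 ^ 2 - v 0 * v 2 = 0}
    rw [h1, Nat.card_fun, Nat.card_zmod, Nat.card_eq_fintype_card, Fintype.card_fin] at h2
    rw [← Set.compl_ofPred, h2, Nat.mul_sub, mul_one]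
    ring_nf
  rw [hB] at h
  have ht := Nat.totient_mul_prod_primeFactors m
  have hP : 0 < ∏ p ∈ m.primeFactors, p :=
    Finset.prod_pos fun p hp => (Nat.prime_of_mem_primeFactors hp).pos
  rw [Finset.prod_pow, Finset.prod_pow] at h
  refine Nat.eq_of_mul_eq_mul_right (pow_pos hP 3) ?_
  rw [h, mul_assoc (m ^ 2)]
  calc _ = (∏ p ∈ m.primeFactors, p) ^ 2 * m ^ 2 * (m * ∏ p ∈ m.primeFactors, (p - 1)) := by ring
    _ = _ := by rw [← ht]; ring

theorem torsionCount_congr {m : ℕ} {f g : Fin 4 → ℤ} (h : ∀ i, (m : ℤ) ^ 3 ∣ f i - g i) :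
    torsionCount m f = torsionCount m g := by
  have h1 := fun i => (dvd_pow_self (m : ℤ) three_ne_zero).trans (h i)
  have h2 := fun i => (pow_dvd_pow (m : ℤ) (show 2 ≤ 3 by norm_num)).trans (h i)
  have h1' := fun i => (dvd_sub_comm.1 (h1 i))
  have h2' := fun i => (dvd_sub_comm.1 (h2 i))
  have h3' := fun i => (dvd_sub_comm.1 (h i))
  exact Nat.card_congr (Equiv.subtypeEquivRight fun τ =>
    ⟨fun H => H.congr (h1 1) (h2 2) (h 3) (by simp), fun H => H.congr (h1' 1) (h2' 2) (h3' 3)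
      (by simp)⟩)

/-- The integral form with coefficients the standard lifts of a form modulo `M`. -/
def liftForm {M : ℕ} (r : Fin 4 → ZMod M) : Fin 4 → ℤ := fun i => (r i).val

theorem dvd_liftForm_sub {M : ℕ} [NeZero M] (f : Fin 4 → ℤ) (i : Fin 4) :
    (M : ℤ) ∣ f i - liftForm (fun i => (f i : ZMod M)) i := by
  rw [← ZMod.intCast_eq_intCast_iff_dvd_sub]
  simp [liftForm]

theorem sum_liftForm_subst {M : ℕ} [NeZero M] (ψ : (Fin 4 → ℤ) → ℕ)
    (hψ : ∀ f g : Fin 4 → ℤ, (∀ i, (M : ℤ) ∣ f i - g i) → ψ f = ψ g) {p q r s : ℤ}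
    (hdet : p * s - q * r = 1) :
    ∑ x : Fin 4 → ZMod M, ψ (cubicSubst p q r s (liftForm x)) =
      ∑ x : Fin 4 → ZMod M, ψ (liftForm x) := by
  have hdetM := congrArg (Int.cast : ℤ → ZMod M) hdet
  push_cast at hdetM
  have h1 : ∀ x : Fin 4 → ZMod M, ψ (cubicSubst p q r s (liftForm x)) =
      ψ (liftForm (cubicSubst (p : ZMod M) q r s x)) := by
    intro x
    refine hψ _ _ fun i => ?_
    have := dvd_liftForm_sub (M := M) (cubicSubst p q r s (liftForm x)) i
    have h2 := cubicSubst_map (f := liftForm x) (Int.castRingHom (ZMod M)) p q r s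
    have h3 : (fun i => (Int.castRingHom (ZMod M)) (liftForm x i)) = x := by
      ext i; simp [liftForm]
    rw [h3] at h2
    simp only [eq_intCast] at h2
    rw [h2]
    exact this
  simp only [h1]
  let e : (Fin 4 → ZMod M) ≃ (Fin 4 → ZMod M) :=
    { toFun := cubicSubst (p : ZMod M) q r s
      invFun := cubicSubst (s : ZMod M) (-q) (-r) p
      left_inv := fun x => by
        rw [cubicSubst_subst]
        convert cubicSubst_id x using 2 <;> first | ring1 | linear_combination hdetM
      right_inv := fun x => by
        rw [cubicSubst_subst]
        convert cubicSubst_id x using 2 <;> first | ring1 | linear_combination hdetM }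
  exact Equiv.sum_comp e fun y => ψ (liftForm y)

theorem sum_torsionCount (m : ℕ) [NeZero m] :
    ∑ x : Fin 4 → ZMod (m ^ 3), torsionCount m (liftForm x) = m ^ 8 * m.totient := by
  have hm0 : (m : ℤ) ≠ 0 := by exact_mod_cast NeZero.ne m
  have hdvd : m ∣ m ^ 3 := dvd_pow_self m three_ne_zero
  -- unconstrained parameters
  let T : Set (ZMod (m ^ 3) × ZMod m × ZMod m) :=
    {v | IsUnit (v.2.1 ^ 2 - ZMod.castHom hdvd (ZMod m) v.1 * v.2.2)}
  have hT : Nat.card T = m ^ 2 * (m ^ 2 * m.totient) := by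
    let φ : ZMod (m ^ 3) × ZMod m × ZMod m →+ (Fin 3 → ZMod m) :=
      { toFun := fun v => ![ZMod.castHom hdvd (ZMod m) v.1, v.2.1, v.2.2]
        map_zero' := by ext i; fin_cases i <;> simp
        map_add' := fun u v => by
          ext i
          fin_cases i
          · exact map_add (ZMod.castHom hdvd (ZMod m)) _ _
          · rfl
          · rfl }
    have hφ : Function.Surjective φ := by
      intro v
      obtain ⟨b, hb⟩ := ZMod.castHom_surjective hdvd (v 0)
      refine ⟨(b, v 1, v 2), ?_⟩
      ext i
      fin_cases i
      · exact hb
      · rfl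
      · rfl
    have h := card_preimage_mul φ hφ {v | IsUnit (v 1 ^ 2 - v 0 * v 2)}
    rw [card_isUnit_quadric, Nat.card_fun, Nat.card_prod, Nat.card_prod, Nat.card_zmod,
      Nat.card_zmod, Nat.card_eq_fintype_card (α := Fin 3), Fintype.card_fin] at h
    have h3 : 0 < m ^ 3 := pow_pos (NeZero.pos m) 3
    refine Nat.eq_of_mul_eq_mul_right h3 ?_
    refine Eq.trans (b := Nat.card (φ ⁻¹' {v | IsUnit (v 1 ^ 2 - v 0 * v 2)}) * m ^ 3) rfl ?_
    rw [h]
    ring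
  simp only [torsionCount]
  rw [← Nat.card_sigma]
  have hmod : ∀ e e' : ZMod m, ((m ^ 2 * e.val : ℤ) : ZMod (m ^ 3)) = ((m ^ 2 * e'.val : ℤ)) →
      e = e' := by
    intro e e' h
    rw [ZMod.intCast_eq_intCast_iff_dvd_sub] at h
    push_cast at h
    rw [← mul_sub, pow_succ] at h
    have h2 := Int.dvd_of_mul_dvd_mul_left (pow_ne_zero 2 hm0) h
    have := (ZMod.intCast_eq_intCast_iff_dvd_sub _ _ m).2 h2
    simpa using this
  let G : ZMod (m ^ 3) × T × ZMod m → Fin 4 → ℤ := fun x =>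
    ![x.1.val, x.2.1.1.1.val, 2 * m * x.2.1.1.2.1.val + m ^ 2 * x.2.2.val, m ^ 2 * x.2.1.1.2.2.val]
  have hG : ∀ x, TorsionData (liftForm fun i => (G x i : ZMod (m ^ 3))) m x.2.1.1.2.1.val := by
    intro x
    have h := fun i => dvd_liftForm_sub (M := m ^ 3) (G x) i
    push_cast at h
    have h1 := fun i => (dvd_pow_self (m : ℤ) three_ne_zero).trans (h i)
    have h2 := fun i => (pow_dvd_pow (m : ℤ) (show 2 ≤ 3 by norm_num)).trans (h i)
    refine TorsionData.congr (h1 1) (h2 2) (h 3) (σ := x.2.1.1.2.1.val) (by simp)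
      ⟨x.2.2.val, x.2.1.1.2.2.val, rfl, rfl, ?_⟩
    have h4 : IsUnit (x.2.1.1.2.1 ^ 2 - ZMod.castHom hdvd (ZMod m) x.2.1.1.1 * x.2.1.1.2.2) :=
      x.2.1.2
    rw [isCoprime_comm, ← ZMod.coe_int_isUnit_iff_isCoprime]
    simpa [G] using h4
  have hbij : Function.Bijective (fun x => (⟨_, _, hG x⟩ : Σ x : Fin 4 → ZMod (m ^ 3),
      {τ : ZMod m // TorsionData (liftForm x) m τ.val})) := by
    refine ⟨?_, ?_⟩
    · rintro ⟨a, ⟨⟨b, τ, d⟩, h⟩, e⟩ ⟨a', ⟨⟨b', τ', d'⟩, h'⟩, e'⟩ H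
      have H1 := congrArg Sigma.fst H
      have H2 : τ = τ' := congrArg (fun x : Σ x : Fin 4 → ZMod (m ^ 3),
        {τ : ZMod m // TorsionData (liftForm x) m τ.val} => x.2.1) H
      subst H2
      have c0 := congrFun H1 0
      have c1 := congrFun H1 1
      have c2 := congrFun H1 2
      have c3 := congrFun H1 3
      simp only [G, Matrix.cons_val] at c0 c1 c2 c3
      have : e = e' := hmod _ _ (by push_cast at c2 ⊢; linear_combination c2)
      have : d = d' := hmod _ _ c3
      simp at c0 c1
      simp [*]
    · rintro ⟨x, τ, e, d, hc, hd, hco⟩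
      have hmem : ((x 1, τ, (d : ZMod m)) : ZMod (m ^ 3) × ZMod m × ZMod m) ∈ T := by
        rw [isCoprime_comm, ← ZMod.coe_int_isUnit_iff_isCoprime] at hco
        simpa [T, liftForm] using hco
      have key : ∀ e : ℤ, ((m ^ 2 * (e : ZMod m).val : ℤ) : ZMod (m ^ 3)) = ((m ^ 2 * e : ℤ)) := by
        intro e
        rw [ZMod.intCast_eq_intCast_iff_dvd_sub]
        push_cast
        rw [← mul_sub, pow_succ]
        refine mul_dvd_mul_left _ ?_
        rw [← ZMod.intCast_eq_intCast_iff_dvd_sub]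
        simp
      have hx : ∀ i, x i = (liftForm x i : ZMod (m ^ 3)) := by intro i; simp [liftForm]
      have hGx : (fun i => (G (x 0, ⟨_, hmem⟩, (e : ZMod m)) i : ZMod (m ^ 3))) = x := by
        ext i
        fin_cases i
        · simp [G]
        · simp [G]
        · change ((2 * m * τ.val + m ^ 2 * (e : ZMod m).val : ℤ) : ZMod (m ^ 3)) = x 2
          rw [hx 2, hc, Int.cast_add, key, ← Int.cast_add]
        · change ((m ^ 2 * (d : ZMod m).val : ℤ) : ZMod (m ^ 3)) = x 3
          rw [hx 3, hd, key]
      have hsig : ∀ (x' : Fin 4 → ZMod (m ^ 3)) (h' : TorsionData (liftForm x') m τ.val)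
          (h : TorsionData (liftForm x) m τ.val), x' = x →
          (⟨x', τ, h'⟩ : Σ x : Fin 4 → ZMod (m ^ 3),
            {τ : ZMod m // TorsionData (liftForm x) m τ.val}) = ⟨x, τ, h⟩ := by
        rintro x' h' h rfl
        rfl
      exact ⟨(x 0, ⟨_, hmem⟩, (e : ZMod m)), hsig _ _ _ hGx⟩
  rw [← Nat.card_eq_of_bijective _ hbij, Nat.card_prod, Nat.card_prod, hT, Nat.card_zmod,
    Nat.card_zmod]
  ring

/-- The number of ideals of the cubic ring attached to `f` which square to `(m ^ 2)` and meet `ℤ` in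
`m ^ 2 ℤ`. -/
noncomputable def torsionNumber (m : ℕ) (f : Fin 4 → ℤ) : ℕ := Nat.card (torsionIdeals
    (CubicRing f) m)

theorem IsFormBasis.card_torsionIdeals {O : Type*} [CommRing O] {f : Fin 4 → ℤ} {w t : O}
    (h : IsFormBasis f w t) (m : ℕ) [NeZero m] : Nat.card (torsionIdeals O m) =
      torsionNumber m f := by
  have h1 := h.totient_mul_card m
  rw [← (CubicRing.isFormBasis f).totient_mul_card m] at h1
  exact Nat.eq_of_mul_eq_mul_left (Nat.totient_pos.2 (NeZero.pos m)) h1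

theorem CubicEquiv.torsionNumber_eq {f g : Fin 4 → ℤ} (h : CubicEquiv f g) (m : ℕ) [NeZero m] :
    torsionNumber m f = torsionNumber m g := by
  obtain ⟨w, t, h'⟩ := (CubicRing.isFormBasis f).exists_of_cubicEquiv h
  exact h'.card_torsionIdeals m

theorem totient_mul_torsionNumber (m : ℕ) [NeZero m] (f : Fin 4 → ℤ) :
    m.totient * torsionNumber m f = ∑ v : UnimodularVec m, torsionCount m (unimodularSubst v f) :=
  (CubicRing.isFormBasis f).totient_mul_card m

theorem dvd_cubicSubst_sub {M : ℤ} {f g : Fin 4 → ℤ} (h : ∀ i, M ∣ f i - g i) (p q r s : ℤ)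
    (i : Fin 4) : M ∣ cubicSubst p q r s f i - cubicSubst p q r s g i := by
  choose e he using h
  obtain rfl : f = fun i => g i + M * e i := by
    ext i
    linear_combination he i
  refine ⟨cubicSubst p q r s e i, ?_⟩
  fin_cases i <;>
  simp only [Fin.zero_eta, Fin.mk_one, Fin.reduceFinMk, cubicSubst_zero, cubicSubst_one,
    cubicSubst_two, cubicSubst_three] <;> ring

theorem torsionNumber_congr {m : ℕ} [NeZero m] {f g : Fin 4 → ℤ}
    (h : ∀ i, ((m ^ 3 : ℕ) : ℤ) ∣ f i - g i) : torsionNumber m f = torsionNumber m g := by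
  refine Nat.eq_of_mul_eq_mul_left (Nat.totient_pos.2 (NeZero.pos m)) ?_
  rw [totient_mul_torsionNumber, totient_mul_torsionNumber]
  refine Finset.sum_congr rfl fun v _ => torsionCount_congr fun i => ?_
  push_cast at h
  exact dvd_cubicSubst_sub h _ _ _ _ i

theorem sum_torsionNumber (m : ℕ) [NeZero m] :
    ∑ x : Fin 4 → ZMod (m ^ 3), torsionNumber m (liftForm x) = Nat.card (UnimodularVec m)
      * m ^ 8 := by
  refine Nat.eq_of_mul_eq_mul_left (Nat.totient_pos.2 (NeZero.pos m)) ?_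
  rw [Finset.mul_sum]
  simp only [totient_mul_torsionNumber]
  rw [Finset.sum_comm]
  have h : ∀ v : UnimodularVec m, ∑ x : Fin 4 → ZMod (m ^ 3),
      torsionCount m (unimodularSubst v (liftForm x)) = m ^ 8 * m.totient := by
    intro v
    rw [← sum_torsionCount]
    refine sum_liftForm_subst (M := m ^ 3) (torsionCount m) (fun f g h => torsionCount_congr ?_) ?_
    · simpa using h
    · have := (exists_matrix_of_isCoprime v.2).choose_spec.1
      exact this
  rw [Finset.sum_congr rfl fun v _ => h v, Finset.sum_const, Finset.card_univ,
    ← Nat.card_eq_fintype_card, smul_eq_mul]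
  ring

theorem torsionNumber_one (f : Fin 4 → ℤ) : torsionNumber 1 f = 1 := by
  rw [torsionNumber, Nat.card_eq_one_iff_unique]
  have h := CubicRing.isFormBasis f
  have h1 : torsionIdeals (CubicRing f) 1 = {⊤} := by
    ext J
    simp only [torsionIdeals, Set.mem_ofPred_eq, Set.mem_singleton_iff]
    constructor
    · rintro ⟨-, -, h2⟩
      rw [Ideal.eq_top_iff_one]
      exact_mod_cast (h2 1).2 (by simp)
    · rintro rfl
      exact ⟨one_pos, by simp, by simp⟩
  rw [h1]
  exact ⟨inferInstance, inferInstance⟩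

/-- The average of `torsionNumber m` over all forms. -/
noncomputable def torsionMean (m : ℕ) : ℝ :=
  if m = 0 then 0 else Nat.card (UnimodularVec m) / (m : ℝ) ^ 4

theorem torsionMean_eq (m : ℕ) :
    torsionMean m = (∏ p ∈ m.primeFactors, (1 - ((p : ℝ) ^ 2)⁻¹)) * ((m : ℝ) ^ 2)⁻¹ := by
  rcases eq_or_ne m 0 with rfl | hm
  · simp [torsionMean]
  have : NeZero m := ⟨hm⟩
  have hm' : (m : ℝ) ≠ 0 := by exact_mod_cast hm
  have h := congrArg (Nat.cast : ℕ → ℝ) (card_unimodularVec m)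
  push_cast at h
  have h1 : ∏ p ∈ m.primeFactors, (1 - ((p : ℝ) ^ 2)⁻¹) =
      (∏ p ∈ m.primeFactors, ((p ^ 2 - 1 : ℕ) : ℝ)) / ∏ p ∈ m.primeFactors, (p : ℝ) ^ 2 := by
    rw [← Finset.prod_div_distrib]
    refine Finset.prod_congr rfl fun p hp => ?_
    have hp := (Nat.prime_of_mem_primeFactors hp).pos
    have : (p : ℝ) ≠ 0 := by exact_mod_cast hp.ne'
    rw [Nat.cast_sub (Nat.one_le_pow _ _ hp)]
    push_cast
    field_simp
  have h2 : ∏ p ∈ m.primeFactors, (p : ℝ) ^ 2 ≠ 0 := by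
    refine Finset.prod_ne_zero_iff.2 fun p hp => pow_ne_zero _ ?_
    exact_mod_cast (Nat.prime_of_mem_primeFactors hp).ne_zero
  rw [torsionMean, if_neg hm, h1]
  field_simp
  linear_combination h

theorem torsionMean_nonneg (m : ℕ) : 0 ≤ torsionMean m := by
  rw [torsionMean]
  split_ifs <;> positivity

theorem torsionMean_one : torsionMean 1 = 1 := by simp [torsionMean_eq]

theorem hasProd_inv_one_sub_prime_pow {k : ℕ} (hk : 2 ≤ k) :
    HasProd (fun p : Nat.Primes => (1 - ((p : ℝ) ^ k)⁻¹)⁻¹) (∑' n : ℕ, ((n : ℝ) ^ k)⁻¹) := by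
  let φ : ℕ →*₀ ℝ :=
    { toFun := fun n => ((n : ℝ) ^ k)⁻¹
      map_zero' := by simp [show k ≠ 0 by omega]
      map_one' := by simp
      map_mul' := fun a b => by push_cast; rw [mul_pow, mul_inv] }
  refine EulerProduct.eulerProduct_completely_multiplicative_hasProd (f := φ) ?_
  refine (Real.summable_nat_pow_inv.2 (by omega : 1 < k)).congr fun n => ?_
  simp [φ]

theorem summable_torsionMean : Summable torsionMean := by
  refine Summable.of_nonneg_of_le torsionMean_nonneg (fun m => ?_)
    (Real.summable_nat_pow_inv.2 one_lt_two)
  rw [torsionMean_eq]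
  refine mul_le_of_le_one_left (by positivity) (Finset.prod_le_one (fun p hp => ?_) fun p hp => ?_)
  · have : (1 : ℝ) ≤ p := by exact_mod_cast (Nat.prime_of_mem_primeFactors hp).one_le
    rw [sub_nonneg]
    exact inv_le_one_of_one_le₀ (one_le_pow₀ this)
  · rw [sub_le_self_iff]
    positivity

theorem tsum_torsionMean : ∑' m, torsionMean m = 15 / Real.pi ^ 2 := by
  have h1 : HasProd (fun p : Nat.Primes => ∑' e, torsionMean (p ^ e)) (∑' m, torsionMean m) := by
    refine EulerProduct.eulerProduct_hasProd torsionMean_one (fun {m n} hmn => ?_) ?_ ?_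
    · rw [torsionMean_eq, torsionMean_eq, torsionMean_eq, hmn.primeFactors_mul,
        Finset.prod_union hmn.disjoint_primeFactors]
      push_cast
      rw [mul_pow, mul_inv]
      ring
    · exact summable_torsionMean.norm
    · simp [torsionMean]
  have h2 := hasProd_inv_one_sub_prime_pow (le_refl 2)
  have h4 := hasProd_inv_one_sub_prime_pow (show 2 ≤ 4 by norm_num)
  have h5 : (fun p : Nat.Primes => (∑' e, torsionMean (p ^ e)) * (1 - ((p : ℝ) ^ 4)⁻¹)⁻¹) =
      fun p : Nat.Primes => (1 - ((p : ℝ) ^ 2)⁻¹)⁻¹ := by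
    ext ⟨p, hp⟩
    have hp1 : (1 : ℝ) < p := by exact_mod_cast hp.one_lt
    have hlt : ((p : ℝ) ^ 2)⁻¹ < 1 := inv_lt_one_of_one_lt₀ (one_lt_pow₀ hp1 two_ne_zero)
    have hpos : 0 < ((p : ℝ) ^ 2)⁻¹ := by positivity
    have h6 : HasSum (fun e => torsionMean (p ^ e)) (1 + ((p : ℝ) ^ 2)⁻¹) := by
      rw [← hasSum_nat_add_iff' 1]
      have h7 := (hasSum_geometric_of_lt_one hpos.le hlt).mul_left
        ((1 - ((p : ℝ) ^ 2)⁻¹) * ((p : ℝ) ^ 2)⁻¹)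
      convert h7 using 1
      · rfl
      · ext e
        rw [torsionMean_eq, Nat.primeFactors_prime_pow (by omega) hp, Finset.prod_singleton]
        push_cast
        rw [pow_right_comm, ← inv_pow (_ ^ 2), pow_succ (_⁻¹) e]
        ring
      · have : 1 - ((p : ℝ) ^ 2)⁻¹ ≠ 0 := by linarith
        rw [Finset.sum_range_one, pow_zero, torsionMean_one, mul_right_comm, mul_inv_cancel₀ this]
        ring
    simp only [h6.tsum_eq]
    have e1 : ((p : ℝ) ^ 4)⁻¹ = ((p : ℝ) ^ 2)⁻¹ * ((p : ℝ) ^ 2)⁻¹ := by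
      rw [← mul_inv]
      ring
    rw [e1]
    generalize ((p : ℝ) ^ 2)⁻¹ = x at *
    have e2 : 1 - x * x = (1 - x) * (1 + x) := by ring
    have e3 : 1 - x ≠ 0 := by linarith
    have e4 : 1 + x ≠ 0 := by linarith
    rw [e2]
    field_simp
  have h6 := h1.mul h4
  rw [h5] at h6
  have h7 := h6.unique h2
  have z2 := hasSum_zeta_two.tsum_eq
  have z4 := hasSum_zeta_four.tsum_eq
  simp only [one_div] at z2 z4
  rw [z2, z4] at h7
  have := Real.pi_pos
  field_simp at h7 ⊢
  linarith

/-- The weight `K ^ ω(m) / (m * rad m)`. -/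
noncomputable def tailWeight (K : ℝ) (m : ℕ) : ℝ := (∏ p ∈ m.primeFactors, K / p) * (m : ℝ)⁻¹

theorem tailWeight_nonneg {K : ℝ} (hK : 0 ≤ K) (m : ℕ) : 0 ≤ tailWeight K m :=
  mul_nonneg (Finset.prod_nonneg fun p _ => by positivity) (by positivity)

theorem summable_tailWeight {K : ℝ} (hK : 0 ≤ K) : Summable (tailWeight K) := by
  have hprime : ∀ {p : ℕ}, p.Prime → HasSum (fun e => tailWeight K (p ^ e))
      (1 + K / p * ((p : ℝ)⁻¹ * (1 - (p : ℝ)⁻¹)⁻¹)) := by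
    intro p hp
    have hp1 : (1 : ℝ) < p := by exact_mod_cast hp.one_lt
    rw [← hasSum_nat_add_iff' 1]
    have h7 := (hasSum_geometric_of_lt_one (inv_nonneg.2 (by linarith : (0 : ℝ) ≤ p))
      (inv_lt_one_of_one_lt₀ hp1)).mul_left (K / p * (p : ℝ)⁻¹)
    convert h7 using 1
    · rfl
    · ext e
      rw [tailWeight, Nat.primeFactors_prime_pow (by omega) hp, Finset.prod_singleton]
      push_cast
      rw [← inv_pow]
      ring
    · rw [Finset.sum_range_one, pow_zero]
      simp [tailWeight]
      ring
  have hnn := tailWeight_nonneg hK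
  have hsq : Summable fun n : ℕ => 2 * K * ((n : ℝ) ^ 2)⁻¹ :=
    (Real.summable_nat_pow_inv.2 one_lt_two).mul_left _
  refine summable_of_sum_range_le (c := Real.exp (∑' n : ℕ, 2 * K * ((n : ℝ) ^ 2)⁻¹))
    hnn fun N => ?_
  obtain ⟨h1, h2⟩ := EulerProduct.summable_and_hasSum_smoothNumbers_prod_primesBelow_tsum
    (f := tailWeight K) (by simp [tailWeight]) (fun {m n} hmn => by
      rw [tailWeight, tailWeight, tailWeight, hmn.primeFactors_mul,
        Finset.prod_union hmn.disjoint_primeFactors]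
      push_cast
      rw [mul_inv]
      ring) (fun hp => (hprime hp).summable.norm) N
  have h3 : ∑ i ∈ Finset.range N, tailWeight K i ≤ ∑' m : N.smoothNumbers, tailWeight K m := by
    rw [tsum_subtype]
    have hs : Summable ((N.smoothNumbers).indicator (tailWeight K)) :=
      summable_subtype_iff_indicator.1 h2.summable
    refine le_trans (Finset.sum_le_sum fun i hi => ?_)
      (hs.sum_le_tsum (Finset.range N) fun i _ => Set.indicator_nonneg (fun _ _ => hnn _) _)
    rcases Nat.eq_zero_or_pos i with rfl | hi0
    · have : tailWeight K 0 = 0 := by simp [tailWeight]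
      rw [this]
      exact Set.indicator_nonneg (fun _ _ => hnn _) _
    · rw [Set.indicator_of_mem (Nat.mem_smoothNumbers_of_lt hi0 (Finset.mem_range.1 hi))]
  refine h3.trans ?_
  rw [h2.tsum_eq]
  have h4 : ∀ p ∈ N.primesBelow, ∑' n : ℕ, tailWeight K (p ^ n) ≤
      Real.exp (2 * K * ((p : ℝ) ^ 2)⁻¹) := by
    intro p hp
    have hpp := Nat.prime_of_mem_primesBelow hp
    rw [(hprime hpp).tsum_eq, add_comm]
    refine le_trans ?_ (Real.add_one_le_exp _)
    have hp2 : (2 : ℝ) ≤ p := by exact_mod_cast hpp.two_le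
    have hinv : (1 - (p : ℝ)⁻¹)⁻¹ ≤ 2 := by
      rw [inv_le_comm₀ (by rw [sub_pos]; exact inv_lt_one_of_one_lt₀ (by linarith)) (by norm_num)]
      have : (p : ℝ)⁻¹ ≤ 2⁻¹ := inv_anti₀ (by norm_num) hp2
      linarith
    have : K / p * ((p : ℝ)⁻¹ * (1 - (p : ℝ)⁻¹)⁻¹) ≤ K / p * ((p : ℝ)⁻¹ * 2) := by gcongr
    refine add_le_add_left (this.trans (le_of_eq ?_)) _
    have : (p : ℝ) ≠ 0 := by linarith
    field_simp
  refine (Finset.prod_le_prod (fun p _ => tsum_nonneg fun _ => hnn _) h4).trans ?_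
  rw [← Real.exp_sum]
  exact Real.exp_le_exp.2 (hsq.sum_le_tsum _ fun i _ => by positivity)

section
open scoped ComplexConjugate

/-- `f(X, Y) = Re (ζ (X - z Y)² (X - w Y))` with `w = z` for positive and `w = conj z` for negative
discriminant. -/
def IsCov (pos : Bool) (f : Fin 4 → ℝ) (ζ z : ℂ) : Prop :=
  ζ ≠ 0 ∧ z.im ≠ 0 ∧ ∀ X Y : ℝ,
    cubicEval f X Y = (ζ * (X - z * Y) ^ 2 * (X - (if pos then z else conj z) * Y)).re

/-- The sign of the discriminants under consideration. -/
def discSign (pos : Bool) : ℝ := if pos then 1 else -1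

/-- The quantities whose positivity defines the interior of the fundamental domain. -/
def reductionForm (pos : Bool) (f : Fin 4 → ℝ) : Fin 3 → ℝ :=
  if pos then
    ![f 1 * f 2 - 9 * f 0 * f 3, f 1 ^ 2 - 3 * f 0 * f 2 - (f 1 * f 2 - 9 * f 0 * f 3),
      f 2 ^ 2 - 3 * f 1 * f 3 - (f 1 ^ 2 - 3 * f 0 * f 2)]
  else
    ![f 1 * f 2 - f 0 * f 3, (f 0 - f 1) ^ 2 + f 0 * f 2 - f 1 * f 2 + f 0 * f 3,
      f 3 ^ 2 - f 0 ^ 2 + f 0 * f 2 - f 1 * f 3]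

theorem IsCov.coeff_pos {f : Fin 4 → ℝ} {ζ z : ℂ} (h : IsCov true f ζ z) :
    f 0 = ζ.re ∧ f 1 = -3 * (ζ.re * z.re - ζ.im * z.im) ∧
    f 2 = 3 * (ζ.re * (z.re ^ 2 - z.im ^ 2) - 2 * ζ.im * z.re * z.im) ∧
    f 3 = -(ζ.re * (z.re ^ 3 - 3 * z.re * z.im ^ 2) - ζ.im * (3 * z.re ^ 2 * z.im - z.im ^ 3)) := by
  obtain ⟨-, -, h⟩ := h
  have h0 := h 1 0
  have h1 := h 1 1
  have h2 := h 1 (-1)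
  have h3 := h 0 1
  simp [cubicEval, pow_succ, Complex.mul_re, Complex.mul_im] at h0 h1 h2 h3
  refine ⟨h0, ?_, ?_, ?_⟩
  · linear_combination (h1 - h2) / 2 - h3
  · linear_combination (h1 + h2) / 2 - h0
  · linear_combination h3

theorem IsCov.coeff_neg {f : Fin 4 → ℝ} {ζ z : ℂ} (h : IsCov false f ζ z) :
    f 0 = ζ.re ∧ f 1 = -(ζ.re * z.re - ζ.im * z.im) - 2 * z.re * ζ.re ∧
    f 2 = ζ.re * (z.re ^ 2 + z.im ^ 2) + 2 * z.re * (ζ.re * z.re - ζ.im * z.im) ∧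
    f 3 = -(z.re ^ 2 + z.im ^ 2) * (ζ.re * z.re - ζ.im * z.im) := by
  obtain ⟨-, -, h⟩ := h
  have h0 := h 1 0
  have h1 := h 1 1
  have h2 := h 1 (-1)
  have h3 := h 0 1
  simp [cubicEval, pow_succ, Complex.mul_re, Complex.mul_im] at h0 h1 h2 h3
  refine ⟨h0, ?_, ?_, ?_⟩
  · linear_combination (h1 - h2) / 2 - h3
  · linear_combination (h1 + h2) / 2 - h0
  · linear_combination h3

theorem IsCov.coeff_zero {pos : Bool} {f : Fin 4 → ℝ} {ζ z : ℂ} (h : IsCov pos f ζ z) :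
    f 0 = ζ.re := by
  cases pos
  · exact h.coeff_neg.1
  · exact h.coeff_pos.1

theorem IsCov.conj {pos : Bool} {f : Fin 4 → ℝ} {ζ z : ℂ} (h : IsCov pos f ζ z) :
    IsCov pos f (conj ζ) (conj z) := by
  refine ⟨by simpa using h.1, by simpa using h.2.1, fun X Y => ?_⟩
  rw [h.2.2, ← Complex.conj_re]
  cases pos <;> simp

theorem IsCov.smul {pos : Bool} {f : Fin 4 → ℝ} {ζ z : ℂ} (h : IsCov pos f ζ z) {t : ℝ}
    (ht : t ≠ 0) : IsCov pos (t • f) (t * ζ) z := by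
  refine ⟨mul_ne_zero (by exact_mod_cast ht) h.1, h.2.1, fun X Y => ?_⟩
  rw [cubicEval_smul, h.2.2, mul_assoc, mul_assoc, mul_assoc, Complex.re_ofReal_mul]

theorem IsCov.denom_ne_zero {pos : Bool} {f : Fin 4 → ℝ} {ζ z : ℂ} (h : IsCov pos f ζ z)
    {p q r s : ℝ} (hd : p * s - q * r ≠ 0) : (p - z * r : ℂ) ≠ 0 := by
  intro h0
  have h1 := congrArg Complex.im h0
  have h2 := congrArg Complex.re h0
  simp [h.2.1] at h1 h2
  subst h1
  apply hd
  have : p = 0 := by linarith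
  rw [this]
  ring

theorem moebius_im {z : ℂ} {p q r s : ℝ} (h0 : (p - z * r : ℂ) ≠ 0) :
    ((z * s - q) / (p - z * r)).im = (p * s - q * r) * z.im / Complex.normSq (p - z * r) := by
  have hn : Complex.normSq (p - z * r) ≠ 0 := by simpa using h0
  rw [Complex.div_im]
  field_simp
  simp
  ring

theorem IsCov.subst {pos : Bool} {f : Fin 4 → ℝ} {ζ z : ℂ} (h : IsCov pos f ζ z)
    {p q r s : ℝ} (hd : p * s - q * r ≠ 0) :
    ∃ ζ', IsCov pos (cubicSubst p q r s f) ζ' ((z * s - q) / (p - z * r)) := by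
  have h0 := h.denom_ne_zero hd
  have h0' : (p - conj z * r : ℂ) ≠ 0 := by
    have := (map_ne_zero (starRingEnd ℂ)).2 h0
    simpa using this
  have him : ((z * s - q) / (p - z * r)).im ≠ 0 := by
    rw [moebius_im h0]
    exact div_ne_zero (mul_ne_zero hd h.2.1) (by simpa using h0)
  refine ⟨ζ * (p - z * r) ^ 2 * (p - (if pos then z else conj z) * r), ?_, him, fun X Y => ?_⟩
  · refine mul_ne_zero (mul_ne_zero h.1 (pow_ne_zero 2 h0)) ?_
    cases pos
    · simpa using h0'
    · simpa using h0
  · rw [cubicEval_subst, h.2.2]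
    congr 1
    have key (w : ℂ) (hw : (p - w * r : ℂ) ≠ 0) : ((p * X + q * Y : ℝ) : ℂ) -
      w * (r * X + s * Y : ℝ)
        = (p - w * r) * (X - (w * s - q) / (p - w * r) * Y) := by
      push_cast
      field_simp
      ring
    rw [key z h0]
    cases pos
    · have := key _ h0'
      simp only [Bool.false_eq_true, if_false]
      rw [this]
      simp only [map_div₀, map_sub, map_mul, Complex.conj_ofReal]
      ring
    · simp only [if_true]
      rw [key z h0]
      ring

theorem IsCov.disc_pos {f : Fin 4 → ℝ} {ζ z : ℂ} (h : IsCov true f ζ z) :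
    cubicDisc f = 108 * z.im ^ 6 * (ζ.re ^ 2 + ζ.im ^ 2) ^ 2 := by
  obtain ⟨h0, h1, h2, h3⟩ := h.coeff_pos
  rw [cubicDisc, h0, h1, h2, h3]
  ring

theorem IsCov.disc_neg {f : Fin 4 → ℝ} {ζ z : ℂ} (h : IsCov false f ζ z) :
    cubicDisc f = -4 * z.im ^ 6 * (ζ.re ^ 2 + ζ.im ^ 2) ^ 2 := by
  obtain ⟨h0, h1, h2, h3⟩ := h.coeff_neg
  rw [cubicDisc, h0, h1, h2, h3]
  ring

theorem IsCov.norm_pos {pos : Bool} {f : Fin 4 → ℝ} {ζ z : ℂ} (h : IsCov pos f ζ z) :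
    0 < ζ.re ^ 2 + ζ.im ^ 2 := by
  have := Complex.normSq_pos.2 h.1
  rw [Complex.normSq_apply] at this
  nlinarith

theorem IsCov.reductionForm {pos : Bool} {f : Fin 4 → ℝ} {ζ z : ℂ} (h : IsCov pos f ζ z) :
    ∃ K : Fin 3 → ℝ, (∀ i, 0 < K i) ∧ reductionForm pos f =
      ![-2 * z.re * K 0, (1 + 2 * z.re) * K 1, (z.re ^ 2 + z.im ^ 2 - 1) * K 2] := by
  have hn := h.norm_pos
  have hy : 0 < z.im ^ 2 := by have := h.2.1; positivity
  cases pos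
  · obtain ⟨h0, h1, h2, h3⟩ := h.coeff_neg
    obtain ⟨k, hk⟩ : ∃ k, k = -(ζ.re * z.re - ζ.im * z.im) := ⟨_, rfl⟩
    have hkl : ζ.re ≠ 0 ∨ k ≠ 0 := by
      by_contra! hc
      obtain ⟨h1, h2⟩ := hc
      rw [h1] at hk
      have : ζ.im = 0 := by
        have := h.2.1
        rw [h2] at hk
        simpa [this] using hk
      rw [h1, this] at hn
      norm_num at hn
    refine ⟨![(k - z.re * ζ.re) ^ 2 + z.im ^ 2 * ζ.re ^ 2,
      (k - (1 + z.re) * ζ.re) ^ 2 + z.im ^ 2 * ζ.re ^ 2,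
      (ζ.re + z.re * k) ^ 2 + z.im ^ 2 * k ^ 2], ?_, ?_⟩
    · intro i
      rcases eq_or_ne ζ.re 0 with hl | hl
      · have hk0 : k ≠ 0 := by simpa [hl] using hkl
        fin_cases i <;> simp [hl] <;> positivity
      · rcases eq_or_ne k 0 with hk0 | hk0
        · fin_cases i <;> simp [hk0] <;> positivity
        · fin_cases i <;> simp <;> positivity
    · have h1' : f 1 = k - 2 * z.re * ζ.re := by rw [h1, hk]
      have h2' : f 2 = ζ.re * (z.re ^ 2 + z.im ^ 2) - 2 * z.re * k := by rw [h2, hk]; ring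
      have h3' : f 3 = (z.re ^ 2 + z.im ^ 2) * k := by rw [h3, hk]; ring
      ext i
      fin_cases i <;> simp [_root_.reductionForm, h0, h1', h2', h3'] <;> ring
  · obtain ⟨h0, h1, h2, h3⟩ := h.coeff_pos
    refine ⟨fun _ => 9 * z.im ^ 2 * (ζ.re ^ 2 + ζ.im ^ 2), fun _ => by positivity, ?_⟩
    ext i
    fin_cases i <;> simp [_root_.reductionForm, h0, h1, h2, h3] <;> ring

theorem IsCov.discSign_mul_pos {pos : Bool} {f : Fin 4 → ℝ} {ζ z : ℂ} (h : IsCov pos f ζ z) :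
    4 * z.im ^ 6 * (ζ.re ^ 2 + ζ.im ^ 2) ^ 2 ≤ discSign pos * cubicDisc f ∧
      discSign pos * cubicDisc f ≤ 108 * z.im ^ 6 * (ζ.re ^ 2 + ζ.im ^ 2) ^ 2 ∧
      0 < discSign pos * cubicDisc f := by
  have hn := h.norm_pos
  have hy : 0 < z.im ^ 6 := by have := h.2.1; positivity
  have : 0 < z.im ^ 6 * (ζ.re ^ 2 + ζ.im ^ 2) ^ 2 := by positivity
  cases pos
  · rw [h.disc_neg]
    simp only [discSign, Bool.false_eq_true, if_false]
    refine ⟨?_, ?_, ?_⟩ <;> linarith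
  · rw [h.disc_pos]
    simp only [discSign, if_true]
    refine ⟨?_, ?_, ?_⟩ <;> linarith

theorem exists_real_root {f : Fin 4 → ℝ} (ha : f 0 ≠ 0) : ∃ θ : ℝ, cubicEval f θ 1 = 0 := by
  have ha' : 0 < |f 0| := abs_pos.2 ha
  obtain ⟨M, hM⟩ : ∃ M, M = 1 + (|f 1| + |f 2| + |f 3|) / |f 0| := ⟨_, rfl⟩
  have hM1 : 1 ≤ M := by rw [hM]; simp; positivity
  have hMa : |f 1| + |f 2| + |f 3| ≤ |f 0| * M := by
    rw [hM, mul_add, mul_div_cancel₀ _ ha'.ne']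
    linarith
  have bound (x : ℝ) (hx : |x| = M) : |f 1 * x ^ 2 + f 2 * x + f 3| ≤ |f 0| * M ^ 3 := by
    have h1 : |f 1 * x ^ 2 + f 2 * x + f 3| ≤ |f 1| * M ^ 2 + |f 2| * M + |f 3| := by
      refine (abs_add_le _ _).trans (add_le_add ((abs_add_le _ _).trans ?_) le_rfl)
      rw [abs_mul, abs_mul, abs_pow, hx]
    have h2 : |f 2| * M ≤ |f 2| * M ^ 2 := by gcongr; nlinarith
    have h3 : |f 3| ≤ |f 3| * M ^ 2 := le_mul_of_one_le_right (abs_nonneg _) (by nlinarith)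
    have h4 : (|f 1| + |f 2| + |f 3|) * M ^ 2 ≤ |f 0| * M * M ^ 2 := by gcongr
    nlinarith
  have hc : Continuous fun x => cubicEval f x 1 := by unfold cubicEval; fun_prop
  have b1 := abs_le.1 (bound M (abs_of_nonneg (by linarith)))
  have b2 := abs_le.1 (bound (-M) (by rw [abs_neg, abs_of_nonneg (by linarith)]))
  have e1 : cubicEval f M 1 = f 0 * M ^ 3 + (f 1 * M ^ 2 + f 2 * M + f 3) := by
    unfold cubicEval; ring
  have e2 : cubicEval f (-M) 1 = -(f 0 * M ^ 3) + (f 1 * (-M) ^ 2 + f 2 * (-M) + f 3) := by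
    unfold cubicEval; ring
  rcases lt_or_gt_of_ne ha with h | h
  · rw [abs_of_neg h] at b1 b2
    exact mem_range_of_exists_le_of_exists_ge hc ⟨M, by linarith⟩ ⟨-M, by linarith⟩
  · rw [abs_of_pos h] at b1 b2
    exact mem_range_of_exists_le_of_exists_ge hc ⟨-M, by linarith⟩ ⟨M, by linarith⟩

theorem IsCov.of_coeff_pos {f : Fin 4 → ℝ} {ζ z : ℂ} (hζ : ζ ≠ 0) (hz : z.im ≠ 0)
    (h0 : f 0 = ζ.re) (h1 : f 1 = -3 * (ζ.re * z.re - ζ.im * z.im))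
    (h2 : f 2 = 3 * (ζ.re * (z.re ^ 2 - z.im ^ 2) - 2 * ζ.im * z.re * z.im))
    (h3 : f 3 = -(ζ.re * (z.re ^ 3 - 3 * z.re * z.im ^ 2) -
      ζ.im * (3 * z.re ^ 2 * z.im - z.im ^ 3))) : IsCov true f ζ z := by
  refine ⟨hζ, hz, fun X Y => ?_⟩
  simp only [cubicEval, h0, h1, h2, h3, if_true, pow_two, Complex.mul_re, Complex.mul_im,
    Complex.sub_re, Complex.sub_im, Complex.ofReal_re, Complex.ofReal_im]
  ring

theorem IsCov.of_coeff_neg {f : Fin 4 → ℝ} {ζ z : ℂ} (hζ : ζ ≠ 0) (hz : z.im ≠ 0)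
    (h0 : f 0 = ζ.re) (h1 : f 1 = -(ζ.re * z.re - ζ.im * z.im) - 2 * z.re * ζ.re)
    (h2 : f 2 = ζ.re * (z.re ^ 2 + z.im ^ 2) + 2 * z.re * (ζ.re * z.re - ζ.im * z.im))
    (h3 : f 3 = -(z.re ^ 2 + z.im ^ 2) * (ζ.re * z.re - ζ.im * z.im)) : IsCov false f ζ z := by
  refine ⟨hζ, hz, fun X Y => ?_⟩
  simp only [cubicEval, h0, h1, h2, h3, Bool.false_eq_true, if_false, pow_two, Complex.mul_re,
    Complex.mul_im, Complex.sub_re, Complex.sub_im, Complex.ofReal_re, Complex.ofReal_im,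
    Complex.conj_re, Complex.conj_im]
  ring

theorem exists_isCov_pos {f : Fin 4 → ℝ} (ha : f 0 ≠ 0) (hd : 0 < cubicDisc f) :
    ∃ ζ z, IsCov true f ζ z := by
  obtain ⟨A, hA⟩ : ∃ A, A = f 1 ^ 2 - 3 * f 0 * f 2 := ⟨_, rfl⟩
  have hApos : 0 < A := by
    have h1 : 4 * A ^ 3 = (2 * f 1 ^ 3 - 9 * f 0 * f 1 * f 2 + 27 * f 0 ^ 2 * f 3) ^ 2 +
        27 * f 0 ^ 2 * cubicDisc f := by rw [hA, cubicDisc]; ring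
    by_contra! hle
    have h2 : A ^ 3 ≤ 0 := by
      have : A ^ 3 = A * A ^ 2 := by ring
      rw [this]; exact mul_nonpos_of_nonpos_of_nonneg hle (sq_nonneg A)
    have h3 : 0 < 27 * f 0 ^ 2 * cubicDisc f := by positivity
    nlinarith [sq_nonneg (2 * f 1 ^ 3 - 9 * f 0 * f 1 * f 2 + 27 * f 0 ^ 2 * f 3)]
  obtain ⟨x, hx⟩ : ∃ x, x = -(f 1 * f 2 - 9 * f 0 * f 3) / (2 * A) := ⟨_, rfl⟩
  obtain ⟨y, hy⟩ : ∃ y, y = Real.sqrt (3 * cubicDisc f) / (2 * A) := ⟨_, rfl⟩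
  have hy0 : 0 < y := by rw [hy]; positivity
  have hxA : 2 * A * x = -(f 1 * f 2 - 9 * f 0 * f 3) := by rw [hx]; field_simp
  have hyA : 4 * A ^ 2 * y ^ 2 = 3 * cubicDisc f := by
    rw [hy, div_pow, Real.sq_sqrt (by positivity)]; field_simp; norm_num
  have hS : A * (x ^ 2 + y ^ 2) = f 2 ^ 2 - 3 * f 1 * f 3 := by
    apply mul_left_cancel₀ (mul_ne_zero four_ne_zero hApos.ne')
    have : (2 * A * x) ^ 2 = (f 1 * f 2 - 9 * f 0 * f 3) ^ 2 := by rw [hxA]; ring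
    have h3 : 3 * cubicDisc f = 4 * A * (f 2 ^ 2 - 3 * f 1 * f 3) -
      (f 1 * f 2 - 9 * f 0 * f 3) ^ 2 := by rw [hA, cubicDisc]; ring
    linear_combination this + hyA + h3
  refine ⟨⟨f 0, (f 0 * x + f 1 / 3) / y⟩, ⟨x, y⟩, IsCov.of_coeff_pos ?_ hy0.ne' rfl ?_ ?_ ?_⟩
  · intro h
    exact ha (congrArg Complex.re h)
  · simp only
    field_simp
    ring
  · simp only
    have : 3 * (f 0 * (x ^ 2 - y ^ 2) - 2 * ((f 0 * x + f 1 / 3) / y) * x * y) =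
        -3 * f 0 * (x ^ 2 + y ^ 2) - 2 * f 1 * x := by field_simp; ring
    rw [this]
    apply mul_left_cancel₀ hApos.ne'
    linear_combination f 2 * hA + 3 * f 0 * hS + f 1 * hxA
  · simp only
    have : -(f 0 * (x ^ 3 - 3 * x * y ^ 2) - (f 0 * x + f 1 / 3) / y * (3 * x ^ 2 * y - y ^ 3)) =
        2 * f 0 * x * (x ^ 2 + y ^ 2) + 4 / 3 * f 1 * x ^ 2 - f 1 / 3 * (x ^ 2 + y ^ 2) := by
      field_simp; ring
    rw [this]
    apply mul_left_cancel₀ (pow_ne_zero 2 hApos.ne')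
    obtain ⟨S, hS'⟩ : ∃ S, S = x ^ 2 + y ^ 2 := ⟨_, rfl⟩
    have e : A ^ 2 * (2 * f 0 * x * (x ^ 2 + y ^ 2) + 4 / 3 * f 1 * x ^ 2 -
        f 1 / 3 * (x ^ 2 + y ^ 2)) = f 0 * (2 * A * x) * (A * (x ^ 2 + y ^ 2)) +
        f 1 / 3 * (2 * A * x) ^ 2 - f 1 / 3 * A * (A * (x ^ 2 + y ^ 2)) := by ring
    rw [e, hxA, hS, hA]
    ring

theorem exists_isCov_neg {f : Fin 4 → ℝ} (ha : f 0 ≠ 0) (hd : cubicDisc f < 0) :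
    ∃ ζ z, IsCov false f ζ z := by
  obtain ⟨θ, hθ⟩ := exists_real_root ha
  obtain ⟨u, hu⟩ : ∃ u, u = f 1 + f 0 * θ := ⟨_, rfl⟩
  obtain ⟨v, hv⟩ : ∃ v, v = f 2 + u * θ := ⟨_, rfl⟩
  have h1 : f 1 = u - f 0 * θ := by rw [hu]; ring
  have h2 : f 2 = v - u * θ := by rw [hv]; ring
  have h3 : f 3 = -(v * θ) := by
    simp only [cubicEval, h1, h2] at hθ
    linear_combination hθ
  have hneg : 0 < 4 * f 0 * v - u ^ 2 := by
    have : cubicDisc f = -(4 * f 0 * v - u ^ 2) * (f 0 * θ ^ 2 + u * θ + v) ^ 2 := by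
      rw [cubicDisc, h1, h2, h3]; ring
    rw [this] at hd
    by_contra! hle
    nlinarith [mul_nonneg (neg_nonneg.2 hle) (sq_nonneg (f 0 * θ ^ 2 + u * θ + v))]
  obtain ⟨x, hx⟩ : ∃ x, x = -u / (2 * f 0) := ⟨_, rfl⟩
  obtain ⟨y, hy⟩ : ∃ y, y = Real.sqrt (4 * f 0 * v - u ^ 2) / (2 * f 0) := ⟨_, rfl⟩
  have hy0 : y ≠ 0 := by
    rw [hy]; exact div_ne_zero (Real.sqrt_ne_zero'.2 hneg) (mul_ne_zero two_ne_zero ha)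
  have hux : u = -2 * f 0 * x := by rw [hx]; field_simp
  have hS : f 0 * (x ^ 2 + y ^ 2) = v := by
    rw [hx, hy, div_pow, div_pow, Real.sq_sqrt hneg.le]; field_simp; ring
  refine ⟨⟨f 0, (f 0 * x - f 0 * θ) / y⟩, ⟨x, y⟩, IsCov.of_coeff_neg ?_ hy0 rfl ?_ ?_ ?_⟩
  · intro h
    exact ha (congrArg Complex.re h)
  all_goals
    simp only
    rw [div_mul_cancel₀ _ hy0]
  · linear_combination h1 + hux
  · linear_combination h2 - hS - θ * hux
  · linear_combination h3 + θ * hS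

theorem exists_isCov {pos : Bool} {f : Fin 4 → ℝ} (ha : f 0 ≠ 0)
    (hd : 0 < discSign pos * cubicDisc f) : ∃ ζ z, IsCov pos f ζ z ∧ 0 < z.im := by
  have : ∃ ζ z, IsCov pos f ζ z := by
    cases pos
    · exact exists_isCov_neg ha (by
          simp only [discSign, Bool.false_eq_true, if_false] at hd
          linarith)
    · exact exists_isCov_pos ha (by simpa [discSign] using hd)
  obtain ⟨ζ, z, h⟩ := this
  rcases lt_or_gt_of_ne h.2.1 with h1 | h1
  · exact ⟨_, _, h.conj, by simpa using h1⟩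
  · exact ⟨_, _, h, h1⟩

theorem IsCov.unique {pos : Bool} {f : Fin 4 → ℝ} {ζ z ζ' z' : ℂ} (h : IsCov pos f ζ z)
    (h' : IsCov pos f ζ' z') (ha : f 0 ≠ 0) : z'.re = z.re ∧ z'.im ^ 2 = z.im ^ 2 := by
  have hy : 0 < z.im ^ 2 := by have := h.2.1; positivity
  have hy' : 0 < z'.im ^ 2 := by have := h'.2.1; positivity
  cases pos
  · obtain ⟨h0, h1, h2, h3⟩ := h.coeff_neg
    obtain ⟨h0', h1', h2', h3'⟩ := h'.coeff_neg
    rw [← h0] at h1 h2 h3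
    rw [← h0'] at h1' h2' h3'
    obtain ⟨k, hk⟩ : ∃ k, k = f 0 * z.re - ζ.im * z.im := ⟨_, rfl⟩
    obtain ⟨k', hk'⟩ : ∃ k, k = f 0 * z'.re - ζ'.im * z'.im := ⟨_, rfl⟩
    rw [← hk] at h1 h2 h3
    rw [← hk'] at h1' h2' h3'
    have e1 : cubicEval f k (f 0) = 0 := by
      rw [cubicEval, h1, h2, h3]; ring
    have e2 : cubicEval f k (f 0) = f 0 * ((k - z'.re * f 0) ^ 2 + z'.im ^ 2 * f 0 ^ 2) *
        (k - k') := by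
      rw [cubicEval, h1', h2', h3']; ring
    have hkk : k = k' := by
      rw [e2, mul_assoc] at e1
      have : 0 < (k - z'.re * f 0) ^ 2 + z'.im ^ 2 * f 0 ^ 2 := by positivity
      have h5 := (mul_eq_zero.1 ((mul_eq_zero.1 e1).resolve_left ha)).resolve_left this.ne'
      linarith
    have hre : z'.re = z.re := by
      apply mul_left_cancel₀ ha
      linear_combination (h1 - h1' - hkk) / (-2)
    refine ⟨hre, mul_left_cancel₀ ha ?_⟩
    rw [hre] at h2'
    rw [← hkk] at h2'
    linear_combination h2 - h2'
  · obtain ⟨h0, h1, h2, h3⟩ := h.coeff_pos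
    obtain ⟨h0', h1', h2', h3'⟩ := h'.coeff_pos
    have hA : f 1 ^ 2 - 3 * f 0 * f 2 = 9 * z.im ^ 2 * (ζ.re ^ 2 + ζ.im ^ 2) := by
      rw [h0, h1, h2]; ring
    have hA' : f 1 ^ 2 - 3 * f 0 * f 2 = 9 * z'.im ^ 2 * (ζ'.re ^ 2 + ζ'.im ^ 2) := by
      rw [h0', h1', h2']; ring
    have hA0 : 9 * z.im ^ 2 * (ζ.re ^ 2 + ζ.im ^ 2) ≠ 0 := by have := h.norm_pos; positivity
    have hB : f 1 * f 2 - 9 * f 0 * f 3 = -2 * z.re * (9 * z.im ^ 2 * (ζ.re ^ 2 + ζ.im ^ 2)) := by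
      rw [h0, h1, h2, h3]; ring
    have hB' : f 1 * f 2 - 9 * f 0 * f 3 =
        -2 * z'.re * (9 * z'.im ^ 2 * (ζ'.re ^ 2 + ζ'.im ^ 2)) := by
      rw [h0', h1', h2', h3']; ring
    have hC : f 2 ^ 2 - 3 * f 1 * f 3 =
        (z.re ^ 2 + z.im ^ 2) * (9 * z.im ^ 2 * (ζ.re ^ 2 + ζ.im ^ 2)) := by
      rw [h1, h2, h3]; ring
    have hC' : f 2 ^ 2 - 3 * f 1 * f 3 =
        (z'.re ^ 2 + z'.im ^ 2) * (9 * z'.im ^ 2 * (ζ'.re ^ 2 + ζ'.im ^ 2)) := by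
      rw [h1', h2', h3']; ring
    rw [← hA', hA] at hB' hC'
    have hre : z'.re = z.re := by
      apply mul_right_cancel₀ hA0
      linear_combination (hB' - hB) / 2
    refine ⟨hre, mul_right_cancel₀ hA0 ?_⟩
    rw [hre] at hC'
    linear_combination hC - hC'

/-- The real form with the given integral coefficients. -/
def castForm (f : Fin 4 → ℤ) : Fin 4 → ℝ := fun i => f i

theorem castForm_apply (f : Fin 4 → ℤ) (i : Fin 4) : castForm f i = f i := rfl

theorem castForm_smul (t : ℤ) (f : Fin 4 → ℤ) : castForm (t • f) = (t : ℝ) • castForm f := by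
  ext i; simp [castForm]

theorem castForm_subst (p q r s : ℤ) (f : Fin 4 → ℤ) :
    castForm (cubicSubst p q r s f) = cubicSubst (p : ℝ) q r s (castForm f) :=
  (cubicSubst_map f (Int.castRingHom ℝ) p q r s).symm

theorem castForm_disc (f : Fin 4 → ℤ) : cubicDisc (castForm f) = cubicDisc f :=
  cubicDisc_map f (Int.castRingHom ℝ)

/-- The form `f` lies in the closed fundamental domain. -/
def IsReducedForm (pos : Bool) (f : Fin 4 → ℝ) : Prop := 0 < f 0 ∧ ∀ i, 0 ≤ reductionForm pos f i

/-- The form `f` lies in the interior of the fundamental domain. -/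
def IsStrictlyReducedForm (pos : Bool) (f : Fin 4 → ℝ) : Prop :=
  0 < f 0 ∧ ∀ i, 0 < reductionForm pos f i

theorem IsStrictlyReducedForm.isReduced {pos : Bool} {f : Fin 4 → ℝ}
    (h : IsStrictlyReducedForm pos f) :
    IsReducedForm pos f := ⟨h.1, fun i => (h.2 i).le⟩

theorem IsCov.isReduced_iff {pos : Bool} {f : Fin 4 → ℝ} {ζ z : ℂ} (h : IsCov pos f ζ z)
    (ha : 0 < f 0) :
    IsReducedForm pos f ↔ z.re ≤ 0 ∧ -1 / 2 ≤ z.re ∧ 1 ≤ z.re ^ 2 + z.im ^ 2 := by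
  obtain ⟨K, hK, hG⟩ := h.reductionForm
  have e0 : _root_.reductionForm pos f 0 = -2 * z.re * K 0 := by rw [hG]; rfl
  have e1 : _root_.reductionForm pos f 1 = (1 + 2 * z.re) * K 1 := by rw [hG]; rfl
  have e2 : _root_.reductionForm pos f 2 = (z.re ^ 2 + z.im ^ 2 - 1) * K 2 := by rw [hG]; rfl
  simp only [IsReducedForm, ha, true_and, Fin.forall_fin_succ, Fin.succ_zero_eq_one,
    Fin.succ_one_eq_two, IsEmpty.forall_iff, and_true, e0, e1, e2,
    mul_nonneg_iff_of_pos_right (hK _)]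
  constructor
  · rintro ⟨h0, h1, h2⟩; exact ⟨by linarith, by linarith, by linarith⟩
  · rintro ⟨h0, h1, h2⟩; exact ⟨by linarith, by linarith, by linarith⟩

theorem IsCov.isStrictlyReduced_iff {pos : Bool} {f : Fin 4 → ℝ} {ζ z : ℂ} (h : IsCov pos f ζ z)
    (ha : 0 < f 0) :
    IsStrictlyReducedForm pos f ↔ z.re < 0 ∧ -1 / 2 < z.re ∧ 1 < z.re ^ 2 + z.im ^ 2 := by
  obtain ⟨K, hK, hG⟩ := h.reductionForm
  have e0 : _root_.reductionForm pos f 0 = -2 * z.re * K 0 := by rw [hG]; rfl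
  have e1 : _root_.reductionForm pos f 1 = (1 + 2 * z.re) * K 1 := by rw [hG]; rfl
  have e2 : _root_.reductionForm pos f 2 = (z.re ^ 2 + z.im ^ 2 - 1) * K 2 := by rw [hG]; rfl
  simp only [IsStrictlyReducedForm, ha, true_and, Fin.forall_fin_succ, Fin.succ_zero_eq_one,
    Fin.succ_one_eq_two, IsEmpty.forall_iff, and_true, e0, e1, e2,
    mul_pos_iff_of_pos_right (hK _)]
  constructor
  · rintro ⟨h0, h1, h2⟩; exact ⟨by linarith, by linarith, by linarith⟩
  · rintro ⟨h0, h1, h2⟩; exact ⟨by linarith, by linarith, by linarith⟩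

theorem CubicIrred.coeff_zero_ne_zero {f : Fin 4 → ℤ} (hf : CubicIrred f) : f 0 ≠ 0 := by
  intro h
  have := hf 1 0 (by simp [cubicEval, h])
  omega

theorem CubicEquiv.cubicIrred {f g : Fin 4 → ℤ} (h : CubicEquiv f g) (hf : CubicIrred f) :
    CubicIrred g := by
  obtain ⟨p, q, r, s, hd, rfl⟩ := h
  intro x y hxy
  have hne : p * s - q * r ≠ 0 := by intro h0; rw [h0] at hd; norm_num at hd
  rw [cubicEval_smul, cubicEval_subst] at hxy
  obtain ⟨h1, h2⟩ := hf _ _ ((mul_eq_zero.1 hxy).resolve_left hne)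
  constructor
  · apply (mul_eq_zero.1 (?_ : (p * s - q * r) * x = 0)).resolve_left hne
    linear_combination s * h1 - q * h2
  · apply (mul_eq_zero.1 (?_ : (p * s - q * r) * y = 0)).resolve_left hne
    linear_combination p * h2 - r * h1

/-- Reduction theory: every irreducible integral form is equivalent to a reduced one. -/
theorem exists_isReduced {pos : Bool} {f : Fin 4 → ℤ} (hf : CubicIrred f)
    (hd : 0 < discSign pos * cubicDisc f) :
    ∃ g, CubicEquiv f g ∧ IsReducedForm pos (castForm g) := by
  have step1 : ∃ g ζ z, CubicEquiv f g ∧ IsCov pos (castForm g) ζ z ∧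
      1 ≤ z.re ^ 2 + z.im ^ 2 ∧ |z.re| ≤ 1 / 2 := by
    obtain ⟨ζ, z, h, hz⟩ := exists_isCov (pos := pos) (f := castForm f)
      (Int.cast_ne_zero.2 hf.coeff_zero_ne_zero) (by rwa [castForm_disc])
    obtain ⟨γ, hγ⟩ := ModularGroup.exists_smul_mem_fd ⟨z, hz⟩
    have hdet := γ.det_coe
    rw [Matrix.det_fin_two] at hdet
    have hcoe := UpperHalfPlane.coe_specialLinearGroup_apply γ ⟨z, hz⟩
    have hdet' : ((γ 1 1 : ℤ) : ℝ) * (γ 0 0 : ℤ) - ((-γ 0 1 : ℤ) : ℝ) * ((-γ 1 0 : ℤ) : ℝ) = 1 := by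
      exact_mod_cast (by linear_combination hdet :
        γ 1 1 * γ 0 0 - -γ 0 1 * -γ 1 0 = 1)
    obtain ⟨ζ', h'⟩ := h.subst (p := (γ 1 1 : ℤ)) (q := (-γ 0 1 : ℤ)) (r := (-γ 1 0 : ℤ))
      (s := (γ 0 0 : ℤ)) (by rw [hdet']; norm_num)
    rw [← castForm_subst] at h'
    have e : (z * ((γ 0 0 : ℤ) : ℝ) - ((-γ 0 1 : ℤ) : ℝ)) /
        (((γ 1 1 : ℤ) : ℝ) - z * ((-γ 1 0 : ℤ) : ℝ)) =
        ((γ • (⟨z, hz⟩ : UpperHalfPlane) : UpperHalfPlane) : ℂ) := by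
      rw [hcoe]
      congr 1
      · simp [mul_comm]
      · simp; ring
    rw [e] at h'
    have hdet₂ : γ 1 1 * γ 0 0 - -γ 0 1 * -γ 1 0 = 1 := by linear_combination hdet
    refine ⟨cubicSubst (γ 1 1) (-γ 0 1) (-γ 1 0) (γ 0 0) f, ζ', _,
      ⟨γ 1 1, -γ 0 1, -γ 1 0, γ 0 0, ?_, ?_⟩, h', ?_, hγ.2⟩
    · rw [hdet₂, one_pow]
    · rw [hdet₂, one_smul]
    · have := hγ.1
      rw [Complex.normSq_apply] at this
      linarith
  obtain ⟨g, ζ, z, hfg, h, h1, h2⟩ := step1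
  have step2 : ∃ g ζ z, CubicEquiv f g ∧ IsCov pos (castForm g) ζ z ∧
      z.re ≤ 0 ∧ -1 / 2 ≤ z.re ∧ 1 ≤ z.re ^ 2 + z.im ^ 2 := by
    rw [abs_le] at h2
    rcases le_total z.re 0 with h3 | h3
    · exact ⟨g, ζ, z, hfg, h, h3, by linarith, h1⟩
    · obtain ⟨ζ', h'⟩ := h.subst (p := (1 : ℤ)) (q := (0 : ℤ)) (r := (0 : ℤ)) (s := (-1 : ℤ))
        (by norm_num)
      rw [← castForm_subst] at h'
      have h'' := h'.smul (t := ((-1 : ℤ) : ℝ)) (by norm_num)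
      rw [← castForm_smul] at h''
      have e : (z * ((-1 : ℤ) : ℝ) - ((0 : ℤ) : ℝ)) / (((1 : ℤ) : ℝ) - z * ((0 : ℤ) : ℝ)) = -z := by
        simp
      rw [e] at h''
      exact ⟨_, _, _, hfg.trans ⟨1, 0, 0, -1, by norm_num, by norm_num⟩, h'', by simpa using h3,
        by simp only [Complex.neg_re]; linarith, by simpa using h1⟩
  obtain ⟨g, ζ, z, hfg, h, hz⟩ := step2
  have hg0 := (hfg.cubicIrred hf).coeff_zero_ne_zero
  rcases lt_or_gt_of_ne hg0 with h0 | h0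
  · refine ⟨(-1 : ℤ) • g, hfg.trans ⟨-1, 0, 0, -1, by norm_num, ?_⟩, ?_⟩
    · apply cubicForm_ext <;> simp [cubicSubst]
    · rw [castForm_smul]
      have h' := h.smul (t := ((-1 : ℤ) : ℝ)) (by norm_num)
      refine (h'.isReduced_iff ?_).2 hz
      simpa [castForm] using h0
  · exact ⟨g, hfg, (h.isReduced_iff (by simpa [castForm] using h0)).2 hz⟩

theorem one_lt_normSq_of_ne_zero {z : ℂ} (h0 : z.re < 0) (h1 : -1 / 2 < z.re)
    (h2 : 1 < z.re ^ 2 + z.im ^ 2) (p : ℤ) {r : ℤ} (hr : r ≠ 0) :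
    1 < Complex.normSq (((p : ℝ) : ℂ) - z * (r : ℝ)) := by
  have e : Complex.normSq (((p : ℝ) : ℂ) - z * (r : ℝ)) =
      (p : ℝ) ^ 2 - 2 * z.re * (p * r) + (r : ℝ) ^ 2 * (z.re ^ 2 + z.im ^ 2) := by
    rw [Complex.normSq_apply]; simp; ring
  rw [e]
  have hr2 : (0 : ℝ) < (r : ℝ) ^ 2 := by positivity
  have hquad : (1 : ℝ) ≤ (p : ℝ) ^ 2 - |(p : ℝ) * r| + (r : ℝ) ^ 2 := by
    have : (1 : ℤ) ≤ p ^ 2 - |p * r| + r ^ 2 := by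
      have h3 : 0 < r ^ 2 := by positivity
      rcases abs_cases (p * r) with ⟨h, -⟩ | ⟨h, -⟩ <;> rw [h] <;>
        nlinarith [sq_nonneg (2 * p - r), sq_nonneg (2 * p + r)]
    exact_mod_cast this
  have h4 : -|(p : ℝ) * r| ≤ -2 * z.re * (p * r) := by
    rcases abs_cases ((p : ℝ) * r) with ⟨h, h'⟩ | ⟨h, h'⟩ <;> rw [h] <;> nlinarith
  nlinarith

theorem IsStrictlyReducedForm.sq_im_lt {pos : Bool} {f g : Fin 4 → ℤ} {ζ z ζ' z' : ℂ}
    (h : IsCov pos (castForm f) ζ z) (h' : IsCov pos (castForm g) ζ' z')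
    (hf : IsStrictlyReducedForm pos (castForm f)) (hg : g 0 ≠ 0) {p q r s : ℤ}
    (hd : (p * s - q * r) ^ 2 = 1) (hfg : g = (p * s - q * r) • cubicSubst p q r s f)
    (hr : r ≠ 0) : z'.im ^ 2 < z.im ^ 2 := by
  have hne : p * s - q * r ≠ 0 := by intro h0; rw [h0] at hd; norm_num at hd
  have hne' : (p : ℝ) * s - q * r ≠ 0 := by exact_mod_cast hne
  obtain ⟨ζ₁, h₁⟩ := h.subst hne'
  have h₂ := h₁.smul hne'
  have hg' : ((p : ℝ) * s - q * r) • cubicSubst (p : ℝ) q r s (castForm f) = castForm g := by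
    rw [hfg, castForm_smul, castForm_subst]; push_cast; rfl
  rw [hg'] at h₂
  have hu := (h₂.unique h' (Int.cast_ne_zero.2 hg)).2
  rw [hu, moebius_im (h.denom_ne_zero hne')]
  obtain ⟨e1, e2, e3⟩ := (h.isStrictlyReduced_iff hf.1).1 hf
  have hn := one_lt_normSq_of_ne_zero e1 e2 e3 p hr
  have hy : 0 < z.im ^ 2 := by have := h.2.1; positivity
  have hd' : ((p : ℝ) * s - q * r) ^ 2 = 1 := by exact_mod_cast hd
  rw [div_pow, mul_pow, hd', one_mul]
  exact div_lt_self hy (one_lt_pow₀ hn two_ne_zero)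

/-- Equivalent forms in the interior of the fundamental domain are equal. -/
theorem IsStrictlyReducedForm.eq_of_cubicEquiv {pos : Bool} {f g : Fin 4 → ℤ}
    (hf : IsStrictlyReducedForm pos (castForm f)) (hg : IsStrictlyReducedForm pos (castForm g))
    (hd : 0 < discSign pos * cubicDisc f) (hfg : CubicEquiv f g) : f = g := by
  obtain ⟨ζ, z, h, hz⟩ := exists_isCov (pos := pos) (f := castForm f) hf.1.ne'
    (by rwa [castForm_disc])
  obtain ⟨ζ', z', h', hz'⟩ := exists_isCov (pos := pos) (f := castForm g) hg.1.ne'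
    (by rwa [castForm_disc, hfg.disc_eq])
  have hf0 : 0 < f 0 := by exact_mod_cast (show (0 : ℝ) < f 0 from hf.1)
  have hg0 : 0 < g 0 := by exact_mod_cast (show (0 : ℝ) < g 0 from hg.1)
  obtain ⟨p, q, r, s, hdet, hgf⟩ := hfg
  have hr : r = 0 := by
    by_contra hr
    have i1 := hf.sq_im_lt h h' hg0.ne' hdet hgf hr
    obtain ⟨D, hD⟩ : ∃ D, D = p * s - q * r := ⟨_, rfl⟩
    rw [← hD] at hdet hgf
    have hD0 : D ≠ 0 := by intro h0; rw [h0] at hdet; norm_num at hdet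
    have hdet' : D * s * (D * p) - -D * q * (-D * r) = D := by
      linear_combination -D ^ 2 * hD + D * hdet
    have i2 := hg.sq_im_lt h' h hf0.ne' (p := D * s) (q := -D * q) (r := -D * r) (s := D * p)
      (by rw [hdet', hdet]) ?_ (mul_ne_zero (neg_ne_zero.2 hD0) hr)
    · exact lt_asymm i1 i2
    · rw [hdet', hgf, cubicSubst_smul, cubicSubst_subst, smul_smul]
      have h1 : p * (D * s) + q * (-D * r) = 1 := by rw [← hdet, hD]; ring
      have h2 : p * (-D * q) + q * (D * p) = 0 := by ring
      have h3 : r * (D * s) + s * (-D * r) = 0 := by ring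
      have h4 : r * (-D * q) + s * (D * p) = 1 := by rw [← hdet, hD]; ring
      rw [h1, h2, h3, h4, cubicSubst_id, ← sq, hdet, one_smul]
  subst hr
  have hps : (p * s) ^ 2 = 1 := by simpa using hdet
  have hne : (p : ℝ) * s - q * (0 : ℤ) ≠ 0 := by
    have : p * s ≠ 0 := by intro h0; rw [h0] at hps; norm_num at hps
    simpa using (by exact_mod_cast this : (p : ℝ) * s ≠ 0)
  obtain ⟨ζ₁, h₁⟩ := h.subst hne
  have h₂ := h₁.smul hne
  have hg' : ((p : ℝ) * s - q * (0 : ℤ)) • cubicSubst (p : ℝ) q (0 : ℤ) s (castForm f) =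
      castForm g := by
    rw [hgf, castForm_smul, castForm_subst]; push_cast; rfl
  rw [hg'] at h₂
  have hu := (h₂.unique h' hg.1.ne').1
  obtain ⟨a1, a2, -⟩ := (h.isStrictlyReduced_iff hf.1).1 hf
  obtain ⟨b1, b2, -⟩ := (h'.isStrictlyReduced_iff hg.1).1 hg
  have hp : p = 1 ∨ p = -1 := Int.isUnit_iff.1 (IsUnit.of_mul_eq_one (p * s ^ 2) (by
    linear_combination hps))
  have hs : s = 1 ∨ s = -1 := Int.isUnit_iff.1 (IsUnit.of_mul_eq_one (s * p ^ 2) (by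
    linear_combination hps))
  have hpz : q = 0 ∧ p = s := by
    rcases hp with rfl | rfl <;> rcases hs with rfl | rfl <;>
      simp [Complex.div_re] at hu
    · refine ⟨?_, rfl⟩
      have h3 : (q : ℝ) < 1 := by linarith
      have h4 : (-1 : ℝ) < q := by linarith
      have h5 : q < 1 := by exact_mod_cast h3
      have h6 : -1 < q := by exact_mod_cast h4
      omega
    · exfalso
      have h3 : (q : ℝ) < 1 := by linarith
      have h4 : (0 : ℝ) < q := by linarith
      have h5 : q < 1 := by exact_mod_cast h3
      have h6 : 0 < q := by exact_mod_cast h4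
      omega
    · exfalso
      have h3 : (q : ℝ) < 0 := by linarith
      have h4 : (-1 : ℝ) < q := by linarith
      have h5 : q < 0 := by exact_mod_cast h3
      have h6 : -1 < q := by exact_mod_cast h4
      omega
    · refine ⟨?_, rfl⟩
      have h3 : (q : ℝ) < 1 := by linarith
      have h4 : (-1 : ℝ) < q := by linarith
      have h5 : q < 1 := by exact_mod_cast h3
      have h6 : -1 < q := by exact_mod_cast h4
      omega
  obtain ⟨rfl, rfl⟩ := hpz
  rcases hp with rfl | rfl
  · rw [hgf, cubicSubst_id]; norm_num
  · have : g 0 = -f 0 := by rw [hgf]; simp [cubicSubst]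
    omega

/-- Reduced forms which are translates of each other are equal. -/
theorem IsReducedForm.eq_of_translate {pos : Bool} {f g : Fin 4 → ℤ}
    (hf : IsReducedForm pos (castForm f)) (hg : IsReducedForm pos (castForm g))
    (hd : 0 < discSign pos * cubicDisc f) {k l : ℤ}
    (hfg : cubicSubst 1 k 0 1 f = cubicSubst 1 l 0 1 g) : f = g := by
  have hgf : g = cubicSubst 1 (k - l) 0 1 f := by
    have := congrArg (cubicSubst 1 (-l) 0 1) hfg
    rw [cubicSubst_subst, cubicSubst_subst] at this
    simp only [mul_one, mul_zero, add_zero, zero_mul, zero_add, one_mul, neg_add_cancel,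
      cubicSubst_id] at this
    rw [← this]
    congr 1
    ring
  have hdg : cubicDisc g = cubicDisc f := by rw [hgf, cubicDisc_subst]; ring
  obtain ⟨ζ, z, h, hz⟩ := exists_isCov (pos := pos) (f := castForm f) hf.1.ne'
    (by rwa [castForm_disc])
  obtain ⟨ζ', z', h', hz'⟩ := exists_isCov (pos := pos) (f := castForm g) hg.1.ne'
    (by rwa [castForm_disc, hdg])
  obtain ⟨ζ₁, h₁⟩ := h.subst (p := (1 : ℤ)) (q := (k - l : ℤ)) (r := (0 : ℤ)) (s := (1 : ℤ))
    (by norm_num)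
  rw [← castForm_subst, ← hgf] at h₁
  have hu := (h₁.unique h' hg.1.ne').1
  obtain ⟨a1, a2, -⟩ := (h.isReduced_iff hf.1).1 hf
  obtain ⟨b1, b2, -⟩ := (h'.isReduced_iff hg.1).1 hg
  simp at hu
  have h3 : ((k - l : ℤ) : ℝ) < 1 := by push_cast; linarith
  have h4 : (-1 : ℝ) < (k - l : ℤ) := by push_cast; linarith
  have h5 : k - l < 1 := by exact_mod_cast h3
  have h6 : -1 < k - l := by exact_mod_cast h4
  have h7 : k - l = 0 := by omega
  rw [hgf, h7, cubicSubst_id]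

end

section
open MeasureTheory Filter Topology

/-- The point of the lattice `(r + M ℤ^ι) / t` just below `x`. -/
noncomputable def latticeFloor {ι : Type*} (M : ℕ) (r : ι → ℤ) (t : ℝ) (x : ι → ℝ) : ι → ℝ :=
  fun i => (r i + M * ⌊(t * x i - r i) / M⌋) / t

section
variable {ι : Type*} {M : ℕ} [NeZero M] (r : ι → ℤ)

theorem preimage_latticeFloor {t : ℝ} (ht : 0 < t) (B : Set (ι → ℝ)) :
    latticeFloor M r t ⁻¹' B =
      ⋃ g : {g : ι → ℤ // (fun i => (r i + M * g i : ℝ) / t) ∈ B},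
        Set.pi Set.univ fun i => Set.Ico ((r i + M * g.1 i : ℝ) / t)
          ((r i + M * g.1 i + M : ℝ) / t) := by
  have hM : (0 : ℝ) < M := by exact_mod_cast Nat.pos_of_neZero M
  have key (x : ι → ℝ) (g : ι → ℤ) : (∀ i, (r i + M * g i : ℝ) / t ≤ x i ∧
      x i < (r i + M * g i + M : ℝ) / t) ↔ ∀ i, ⌊(t * x i - r i) / M⌋ = g i := by
    refine forall_congr' fun i => ?_
    rw [Int.floor_eq_iff, le_div_iff₀ hM, div_lt_iff₀ hM, div_le_iff₀ ht, lt_div_iff₀ ht]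
    constructor <;> rintro ⟨h1, h2⟩ <;> constructor <;> linarith
  ext x
  simp only [Set.mem_preimage, Set.mem_iUnion, Set.mem_pi, Set.mem_univ, true_imp_iff, Set.mem_Ico,
    Subtype.exists, exists_prop, key]
  constructor
  · intro h
    exact ⟨fun i => ⌊(t * x i - r i) / M⌋, h, fun i => rfl⟩
  · rintro ⟨g, hg, h⟩
    have : latticeFloor M r t x = fun i => (r i + M * g i : ℝ) / t := by
      funext i
      rw [latticeFloor, h i]
    rwa [this]

theorem card_congruent_eq (t : ℝ) (B : Set (ι → ℝ)) :
    Nat.card {f : ι → ℤ // (∀ i, (M : ℤ) ∣ f i - r i) ∧ (fun i => (f i : ℝ) / t) ∈ B} =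
      Nat.card {g : ι → ℤ // (fun i => (r i + M * g i : ℝ) / t) ∈ B} := by
  have hM : (M : ℤ) ≠ 0 := by exact_mod_cast NeZero.ne M
  symm
  refine Nat.card_eq_of_bijective (fun g => ⟨fun i => r i + M * g.1 i, fun i => ⟨g.1 i, by ring⟩,
    by have := g.2; push_cast; exact this⟩) ⟨fun g g' h => ?_, fun f => ?_⟩
  · ext i
    have := congrFun (congrArg Subtype.val h) i
    exact mul_left_cancel₀ hM (add_left_cancel this)
  · obtain ⟨f, h1, h2⟩ := f
    have h1' := h1
    choose g hg using h1'
    refine ⟨⟨g, ?_⟩, ?_⟩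
    · convert h2 using 3 with i
      have : f i = r i + M * g i := by rw [← hg i]; ring
      rw [this]; push_cast; rfl
    · ext i
      have := hg i
      simp only
      omega

variable [Fintype ι]

theorem dist_latticeFloor_le {t : ℝ} (ht : 0 < t) (x : ι → ℝ) :
    dist (latticeFloor M r t x) x ≤ M / t := by
  have hM : (0 : ℝ) < M := by exact_mod_cast Nat.pos_of_neZero M
  refine (dist_pi_le_iff (by positivity)).2 fun i => ?_
  rw [Real.dist_eq, latticeFloor, abs_le]
  have h1 := Int.floor_le ((t * x i - r i) / M)
  have h2 := Int.lt_floor_add_one ((t * x i - r i) / M)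
  rw [le_div_iff₀ hM] at h1
  rw [div_lt_iff₀ hM] at h2
  constructor
  · rw [← neg_div, le_sub_iff_add_le, ← sub_nonneg]
    have : (r i + M * (⌊(t * x i - r i) / M⌋ : ℝ)) / t - (-(M : ℝ) / t + x i) =
      (r i + M * (⌊(t * x i - r i) / M⌋ : ℝ) + M - t * x i) / t := by field_simp; ring
    rw [this]
    exact div_nonneg (by linarith) ht.le
  · rw [sub_le_iff_le_add, ← sub_nonneg]
    have : (M : ℝ) / t + x i - (r i + M * (⌊(t * x i - r i) / M⌋ : ℝ)) / t =
      (M + t * x i - (r i + M * (⌊(t * x i - r i) / M⌋ : ℝ))) / t := by field_simp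
    rw [this]
    exact div_nonneg (by linarith) ht.le

theorem measurableSet_preimage_latticeFloor {t : ℝ} (ht : 0 < t) (B : Set (ι → ℝ)) :
    MeasurableSet (latticeFloor M r t ⁻¹' B) := by
  rw [preimage_latticeFloor r ht]
  exact MeasurableSet.iUnion fun g => MeasurableSet.univ_pi fun i => measurableSet_Ico

theorem finite_lattice_points {t : ℝ} (ht : 0 < t) {B : Set (ι → ℝ)} (hB : Bornology.IsBounded B) :
    Finite {g : ι → ℤ // (fun i => (r i + M * g i : ℝ) / t) ∈ B} := by
  classical
  have hM : (1 : ℝ) ≤ M := by exact_mod_cast Nat.pos_of_neZero M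
  obtain ⟨R, hR⟩ := hB.exists_norm_le
  obtain ⟨N, hN⟩ : ∃ N : ι → ℤ, ∀ i, R * t + |(r i : ℝ)| ≤ N i :=
    ⟨fun i => ⌈R * t + |(r i : ℝ)|⌉, fun i => Int.le_ceil _⟩
  refine Set.Finite.subset (Set.finite_Icc (-N) N) fun g hg => ?_
  have h1 (i : ι) : |(g i : ℝ)| ≤ N i := by
    have h2 := (norm_le_pi_norm _ i).trans (hR _ hg)
    rw [Real.norm_eq_abs, abs_div, abs_of_pos ht, div_le_iff₀ ht] at h2
    have h3 : |(M : ℝ) * g i| ≤ |(r i + M * g i : ℝ)| + |(r i : ℝ)| := by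
      have := abs_sub (r i + M * g i : ℝ) (r i : ℝ)
      simpa using this
    rw [abs_mul, abs_of_pos (by linarith : (0 : ℝ) < M)] at h3
    have := hN i
    nlinarith [abs_nonneg (g i : ℝ)]
  refine ⟨fun i => ?_, fun i => ?_⟩
  · have := (abs_le.1 (h1 i)).1
    exact_mod_cast this
  · have := (abs_le.1 (h1 i)).2
    exact_mod_cast this

theorem volume_preimage_latticeFloor {t : ℝ} (ht : 0 < t) {B : Set (ι → ℝ)}
    (hB : Bornology.IsBounded B) :
    volume.real (latticeFloor M r t ⁻¹' B) =
      Nat.card {g : ι → ℤ // (fun i => (r i + M * g i : ℝ) / t) ∈ B} *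
        (M / t : ℝ) ^ Fintype.card ι := by
  have hM : (0 : ℝ) < M := by exact_mod_cast Nat.pos_of_neZero M
  have := finite_lattice_points (M := M) r ht hB
  have := Fintype.ofFinite {g : ι → ℤ // (fun i => (r i + M * g i : ℝ) / t) ∈ B}
  rw [Measure.real, preimage_latticeFloor r ht, measure_iUnion]
  · have h (g : ι → ℤ) : volume (Set.pi Set.univ fun i => Set.Ico ((r i + M * g i : ℝ) / t)
          ((r i + M * g i + M : ℝ) / t)) = ENNReal.ofReal ((M / t : ℝ) ^ Fintype.card ι) := by
      rw [Real.volume_pi_Ico, ← ENNReal.ofReal_prod_of_nonneg]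
      · congr 1
        rw [Finset.prod_congr rfl (g := fun _ => (M / t : ℝ)), Finset.prod_const, Finset.card_univ]
        intro i _
        ring
      · intro i _
        rw [← sub_div]
        exact div_nonneg (by linarith) ht.le
    simp only [h, tsum_fintype, Finset.sum_const, Finset.card_univ, Nat.card_eq_fintype_card,
      nsmul_eq_mul, ENNReal.toReal_mul, ENNReal.toReal_natCast]
    rw [ENNReal.toReal_ofReal (by positivity)]
  · intro g g' hgg
    rw [Function.onFun, Set.disjoint_left]
    intro x hx hx'
    apply hgg
    ext i
    have h1 := hx i (Set.mem_univ i)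
    have h2 := hx' i (Set.mem_univ i)
    rw [Set.mem_Ico, div_le_iff₀ ht, lt_div_iff₀ ht] at h1 h2
    have h3 : (g.1 i : ℝ) < g'.1 i + 1 := lt_of_mul_lt_mul_left (by linarith) hM.le
    have h4 : (g'.1 i : ℝ) < g.1 i + 1 := lt_of_mul_lt_mul_left (by linarith) hM.le
    have h5 : g.1 i < g'.1 i + 1 := by exact_mod_cast h3
    have h6 : g'.1 i < g.1 i + 1 := by exact_mod_cast h4
    omega
  · intro g
    exact MeasurableSet.univ_pi fun i => measurableSet_Ico

theorem tendsto_latticeFloor (x : ι → ℝ) :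
    Tendsto (fun t => latticeFloor M r t x) atTop (𝓝 x) := by
  rw [tendsto_iff_dist_tendsto_zero]
  refine squeeze_zero' (Eventually.of_forall fun _ => dist_nonneg) ?_
    (tendsto_const_nhds.div_atTop tendsto_id : Tendsto (fun t : ℝ => (M : ℝ) / t) atTop (𝓝 0))
  filter_upwards [eventually_gt_atTop 0] with t ht using dist_latticeFloor_le r ht x

/-- Counting lattice points in a congruence class inside large dilates of a bounded set whose
boundary has measure zero. -/
theorem tendsto_card_congruent {B : Set (ι → ℝ)} (hB : Bornology.IsBounded B)
    (hm : MeasurableSet B) (hfr : volume (frontier B) = 0) :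
    Tendsto (fun t : ℝ => (Nat.card {f : ι → ℤ // (∀ i, (M : ℤ) ∣ f i - r i) ∧
      (fun i => (f i : ℝ) / t) ∈ B} : ℝ) / t ^ Fintype.card ι) atTop
      (𝓝 (volume.real B / (M : ℝ) ^ Fintype.card ι)) := by
  have hM : (0 : ℝ) < M := by exact_mod_cast Nat.pos_of_neZero M
  obtain ⟨R, hR⟩ := hB.subset_closedBall 0
  have key : Tendsto (fun t : ℝ => volume.real (latticeFloor M r t ⁻¹' B)) atTop
      (𝓝 (volume.real B)) := by
    have h1 : Tendsto (fun t : ℝ => ∫ x, (latticeFloor M r t ⁻¹' B).indicator (1 : (ι → ℝ) → ℝ) x)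
        atTop (𝓝 (∫ x, B.indicator (1 : (ι → ℝ) → ℝ) x)) := by
      refine tendsto_integral_filter_of_dominated_convergence
        ((Metric.closedBall (0 : ι → ℝ) (R + M)).indicator 1) ?_ ?_ ?_ ?_
      · filter_upwards [eventually_gt_atTop 0] with t ht
        exact (measurable_one.indicator
          (measurableSet_preimage_latticeFloor r ht B)).aestronglyMeasurable
      · filter_upwards [eventually_ge_atTop 1] with t ht
        refine Eventually.of_forall fun x => ?_
        have hnn : 0 ≤ (latticeFloor M r t ⁻¹' B).indicator (1 : (ι → ℝ) → ℝ) x :=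
          Set.indicator_nonneg (fun _ _ => by simp) _
        rw [Real.norm_of_nonneg hnn]
        refine Set.indicator_le_indicator_of_subset (fun x hx => ?_) (fun _ => by simp) x
        have h2 := hR hx
        rw [Metric.mem_closedBall] at h2 ⊢
        have h3 := dist_latticeFloor_le (M := M) r (by linarith : 0 < t) x
        have h4 : (M : ℝ) / t ≤ M := div_le_self hM.le ht
        rw [dist_comm] at h3
        linarith [dist_triangle x (latticeFloor M r t x) 0]
      · exact (integrable_indicator_iff Metric.isClosed_closedBall.measurableSet).2
          (integrableOn_const (measure_closedBall_lt_top).ne)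
      · have : ∀ᵐ x, x ∉ frontier B := measure_eq_zero_iff_ae_notMem.1 hfr
        filter_upwards [this] with x hx
        have hx' : x ∈ interior B ∨ x ∈ interior Bᶜ := by
          by_contra! hc
          apply hx
          rw [frontier, Set.mem_sdiff, closure_eq_compl_interior_compl]
          exact ⟨hc.2, hc.1⟩
        apply tendsto_const_nhds.congr'
        rcases hx' with h | h
        · have h' := (tendsto_latticeFloor (M := M) r x).eventually
            (isOpen_interior.mem_nhds h)
          filter_upwards [h'] with t ht
          have h5 : latticeFloor M r t x ∈ B := interior_subset (s := B) ht
          rw [Set.indicator_of_mem (interior_subset h),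
            Set.indicator_of_mem (s := latticeFloor M r t ⁻¹' B) h5]
        · have h' := (tendsto_latticeFloor (M := M) r x).eventually
            (isOpen_interior.mem_nhds h)
          filter_upwards [h'] with t ht
          have h5 : latticeFloor M r t x ∉ B := interior_subset (s := Bᶜ) ht
          have h6 : x ∉ B := interior_subset (s := Bᶜ) h
          rw [Set.indicator_of_notMem h6,
            Set.indicator_of_notMem (s := latticeFloor M r t ⁻¹' B) h5]
    rw [integral_indicator_one hm] at h1
    refine h1.congr' ?_
    filter_upwards [eventually_gt_atTop 0] with t ht
    rw [integral_indicator_one (measurableSet_preimage_latticeFloor r ht B)]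
  refine (key.div_const _).congr' ?_
  filter_upwards [eventually_gt_atTop 0] with t ht
  rw [volume_preimage_latticeFloor r ht hB, card_congruent_eq, div_pow]
  field_simp

end

theorem IsReducedForm.exists_cov {pos : Bool} {f : Fin 4 → ℝ} (hf : IsReducedForm pos f)
    (hd : 0 < discSign pos * cubicDisc f) : ∃ ζ z, IsCov pos f ζ z ∧ 0 < z.im ∧
      z.re ≤ 0 ∧ -1 / 2 ≤ z.re ∧ 3 / 4 ≤ z.im ^ 2 := by
  obtain ⟨ζ, z, h, hz⟩ := exists_isCov hf.1.ne' hd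
  obtain ⟨h1, h2, h3⟩ := (h.isReduced_iff hf.1).1 hf
  exact ⟨ζ, z, h, hz, h1, h2, by nlinarith⟩

theorem IsReducedForm.pow_four_le {pos : Bool} {f : Fin 4 → ℝ} (hf : IsReducedForm pos f)
    (hd : 0 < discSign pos * cubicDisc f) : f 0 ^ 4 ≤ discSign pos * cubicDisc f := by
  obtain ⟨ζ, z, h, -, -, -, h3⟩ := hf.exists_cov hd
  refine le_trans ?_ h.discSign_mul_pos.1
  rw [h.coeff_zero]
  have h4 : 1 ≤ 4 * z.im ^ 6 := by
    have := pow_le_pow_left₀ (by norm_num) h3 3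
    nlinarith
  have h5 : ζ.re ^ 4 ≤ (ζ.re ^ 2 + ζ.im ^ 2) ^ 2 := by
    nlinarith [mul_nonneg (sq_nonneg ζ.re) (sq_nonneg ζ.im), sq_nonneg (ζ.im ^ 2)]
  nlinarith [sq_nonneg (ζ.re ^ 2 + ζ.im ^ 2)]

theorem IsReducedForm.hessian_sq_le {pos : Bool} {f : Fin 4 → ℝ} (hf : IsReducedForm pos f)
    (hd : 0 < discSign pos * cubicDisc f) :
    (f 1 ^ 2 - 3 * f 0 * f 2) ^ 2 ≤ 4 * (discSign pos * cubicDisc f) := by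
  obtain ⟨ζ, z, h, -, -, -, h3⟩ := hf.exists_cov hd
  have h4 : z.im ^ 4 * (3 / 4) ≤ z.im ^ 6 := by nlinarith [sq_nonneg (z.im ^ 2)]
  have h5 : z.im ^ 4 * (3 / 4) * (ζ.re ^ 2 + ζ.im ^ 2) ^ 2 ≤
      z.im ^ 6 * (ζ.re ^ 2 + ζ.im ^ 2) ^ 2 := mul_le_mul_of_nonneg_right h4 (sq_nonneg _)
  cases pos
  · obtain ⟨h0, h1, h2, -⟩ := h.coeff_neg
    have e : f 1 ^ 2 - 3 * f 0 * f 2 = z.im ^ 2 * (ζ.im ^ 2 - 3 * ζ.re ^ 2) := by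
      rw [h0, h1, h2]; ring
    rw [e, h.disc_neg, discSign]
    have h6 : (ζ.im ^ 2 - 3 * ζ.re ^ 2) ^ 2 ≤ 9 * (ζ.re ^ 2 + ζ.im ^ 2) ^ 2 := by
      nlinarith [mul_nonneg (sq_nonneg ζ.re) (sq_nonneg ζ.im), sq_nonneg (ζ.im ^ 2)]
    have h7 := mul_le_mul_of_nonneg_left h6 (sq_nonneg (z.im ^ 2))
    norm_num
    nlinarith
  · obtain ⟨h0, h1, h2, -⟩ := h.coeff_pos
    have e : f 1 ^ 2 - 3 * f 0 * f 2 = 9 * z.im ^ 2 * (ζ.re ^ 2 + ζ.im ^ 2) := by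
      rw [h0, h1, h2]; ring
    rw [e, h.disc_pos, discSign]
    norm_num
    nlinarith

/-- The part of the closed fundamental domain with `|disc f| < 1` and `f(1, 0) > ε`. -/
def closedRegion (pos : Bool) (ε : ℝ) : Set (Fin 4 → ℝ) :=
  {f | ε < f 0 ∧ IsReducedForm pos f ∧ 0 < discSign pos * cubicDisc f ∧
    discSign pos * cubicDisc f < 1}

/-- The part of the interior of the fundamental domain with `|disc f| < 1` and `f(1, 0) > ε`. -/
def openRegion (pos : Bool) (ε : ℝ) : Set (Fin 4 → ℝ) :=
  {f | ε < f 0 ∧ IsStrictlyReducedForm pos f ∧ 0 < discSign pos * cubicDisc f ∧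
    discSign pos * cubicDisc f < 1}

theorem openRegion_subset (pos : Bool) (ε : ℝ) : openRegion pos ε ⊆ closedRegion pos ε :=
  fun _ h => ⟨h.1, h.2.1.isReduced, h.2.2⟩

theorem isBounded_closedRegion (pos : Bool) {ε : ℝ} (hε : 0 < ε) :
    Bornology.IsBounded (closedRegion pos ε) := by
  obtain ⟨Y, hY⟩ : ∃ Y : ℝ, Y = 1 + 1 / (4 * ε ^ 4) := ⟨_, rfl⟩
  let F : (Fin 4 → ℝ) → Fin 4 → ℝ := fun v => if pos then
    ![v 0, -3 * (v 0 * v 2 - v 1 * v 3), 3 * (v 0 * (v 2 ^ 2 - v 3 ^ 2) - 2 * v 1 * v 2 * v 3),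
      -(v 0 * (v 2 ^ 3 - 3 * v 2 * v 3 ^ 2) - v 1 * (3 * v 2 ^ 2 * v 3 - v 3 ^ 3))]
    else ![v 0, -(v 0 * v 2 - v 1 * v 3) - 2 * v 2 * v 0,
      v 0 * (v 2 ^ 2 + v 3 ^ 2) + 2 * v 2 * (v 0 * v 2 - v 1 * v 3),
      -(v 2 ^ 2 + v 3 ^ 2) * (v 0 * v 2 - v 1 * v 3)]
  have hF : Continuous F := by
    refine continuous_pi fun i => ?_
    cases pos <;> fin_cases i <;> simp [F] <;> fun_prop
  refine ((isCompact_Icc (a := ![-1, -1, -1, 0]) (b := ![1, 1, 0, Y])).image hF).isBounded.subset ?_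
  rintro f ⟨h1, h2, h3, h4⟩
  obtain ⟨ζ, z, h, hz, hx, hx', hy⟩ := h2.exists_cov h3
  have hlow := h.discSign_mul_pos.1
  have hN : ε ^ 2 ≤ ζ.re ^ 2 + ζ.im ^ 2 := by
    rw [h.coeff_zero] at h1
    nlinarith [sq_nonneg ζ.im]
  have hy4 : 1 ≤ 4 * z.im ^ 6 := by
    have := pow_le_pow_left₀ (by norm_num) hy 3
    nlinarith
  have hN1 : ζ.re ^ 2 + ζ.im ^ 2 ≤ 1 := by
    have h5 : (ζ.re ^ 2 + ζ.im ^ 2) ^ 2 ≤ 1 := by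
      nlinarith [sq_nonneg (ζ.re ^ 2 + ζ.im ^ 2)]
    exact (abs_le_one_iff_mul_self_le_one.2 (by nlinarith) |> fun h => (abs_le.1 h).2)
  have hy6 : z.im ^ 6 ≤ 1 / (4 * ε ^ 4) := by
    rw [le_div_iff₀ (by positivity)]
    have h5 : (ε ^ 2) ^ 2 ≤ (ζ.re ^ 2 + ζ.im ^ 2) ^ 2 := pow_le_pow_left₀ (by positivity) hN 2
    have h6 : 0 ≤ z.im ^ 6 := by positivity
    nlinarith
  have hyY : z.im ≤ Y := by
    rcases le_total z.im 1 with h5 | h5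
    · have : 0 < 1 / (4 * ε ^ 4) := by positivity
      linarith
    · have := le_self_pow₀ h5 (by norm_num : 6 ≠ 0)
      linarith
  refine ⟨![ζ.re, ζ.im, z.re, z.im], ⟨fun i => ?_, fun i => ?_⟩, ?_⟩
  · fin_cases i <;> simp <;> nlinarith [sq_nonneg ζ.re, sq_nonneg ζ.im]
  · fin_cases i <;> simp <;> nlinarith [sq_nonneg ζ.re, sq_nonneg ζ.im]
  · cases pos
    · obtain ⟨e0, e1, e2, e3⟩ := h.coeff_neg
      apply cubicForm_ext <;> simp [F, e0, e1, e2, e3]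
    · obtain ⟨e0, e1, e2, e3⟩ := h.coeff_pos
      apply cubicForm_ext <;> simp [F, e0, e1, e2, e3]

theorem ae_coeff_ne (i : Fin 4) (x : ℝ) : ∀ᵐ f : Fin 4 → ℝ, f i ≠ x :=
  Measure.ae_eval_ne (fun _ : Fin 4 => (volume : Measure ℝ)) i x

/-- A function that is a nonzero quadratic polynomial in the last coefficient of a generic form
vanishes only on a null set. -/
theorem ae_ne_zero_of_quadratic {P : (Fin 4 → ℝ) → ℝ} (hP : Continuous P)
    (α β γ : ℝ → ℝ → ℝ → ℝ)
    (h : ∀ f, P f = α (f 0) (f 1) (f 2) * f 3 ^ 2 + β (f 0) (f 1) (f 2) * f 3 +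
      γ (f 0) (f 1) (f 2))
    (h0 : ∀ a b c, a ≠ 0 → b ≠ 0 → α a b c ≠ 0 ∨ β a b c ≠ 0) :
    ∀ᵐ f : Fin 4 → ℝ, P f ≠ 0 := by
  have key : ∀ᵐ f : Fin 4 → ℝ, f ∈ {f | P f ≠ 0} ∪ {f | f 0 = 0} ∪ {f | f 1 = 0} := by
    refine ae_mem_of_ae_add_linearMap_mem (LinearMap.single ℝ (fun _ : Fin 4 => ℝ) 3)
      (volume : Measure ℝ) volume ?_ fun f => ?_
    · refine MeasurableSet.union (MeasurableSet.union ?_ ?_) ?_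
      · exact (isOpen_ne_fun hP continuous_const).measurableSet
      · exact (isClosed_eq (continuous_apply 0) continuous_const).measurableSet
      · exact (isClosed_eq (continuous_apply 1) continuous_const).measurableSet
    · by_cases ha : f 0 = 0
      · refine Eventually.of_forall fun t => Or.inl (Or.inr ?_)
        simp [ha]
      by_cases hb : f 1 = 0
      · refine Eventually.of_forall fun t => Or.inr ?_
        simp [hb]
      have hp : Polynomial.C (α (f 0) (f 1) (f 2)) * (Polynomial.C (f 3) + Polynomial.X) ^ 2 +
          Polynomial.C (β (f 0) (f 1) (f 2)) * (Polynomial.C (f 3) + Polynomial.X) +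
          Polynomial.C (γ (f 0) (f 1) (f 2)) ≠ 0 := by
        intro hp
        have e (t : ℝ) := congrArg (Polynomial.eval (t - f 3)) hp
        simp only [Polynomial.eval_add, Polynomial.eval_mul, Polynomial.eval_pow,
          Polynomial.eval_C, Polynomial.eval_X, Polynomial.eval_zero] at e
        have e0 := e 0
        have e1 := e 1
        have e2 := e (-1)
        ring_nf at e0 e1 e2
        rcases h0 _ _ (f 2) ha hb with h1 | h1 <;> apply h1 <;> linarith
      have hfin := Polynomial.finite_setOfPred_isRoot hp
      filter_upwards [hfin.countable.ae_notMem volume] with t ht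
      refine Or.inl (Or.inl fun h1 => ht ?_)
      simpa [h] using h1
  filter_upwards [key, ae_coeff_ne 0 0, ae_coeff_ne 1 0] with f hf h1 h2
  rcases hf with (hf | hf) | hf
  · exact hf
  · exact absurd hf h1
  · exact absurd hf h2

@[fun_prop]
theorem continuous_cubicDisc : Continuous (cubicDisc : (Fin 4 → ℝ) → ℝ) := by
  unfold cubicDisc
  fun_prop

theorem continuous_reductionForm (pos : Bool) (i : Fin 3) :
    Continuous fun f => reductionForm pos f i := by
  cases pos <;> fin_cases i <;> simp [reductionForm] <;> fun_prop

theorem ae_cubicDisc_ne (x : ℝ) : ∀ᵐ f : Fin 4 → ℝ, cubicDisc f - x ≠ 0 := by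
  refine ae_ne_zero_of_quadratic (by fun_prop) (fun a _ _ => -27 * a ^ 2)
    (fun a b c => -4 * b ^ 3 + 18 * a * b * c) (fun a b c => b ^ 2 * c ^ 2 - 4 * a * c ^ 3 - x)
    (fun f => by rw [cubicDisc]; ring) fun a b c ha hb => Or.inl (by simpa using ha)

theorem ae_reductionForm_ne (pos : Bool) (i : Fin 3) :
    ∀ᵐ f : Fin 4 → ℝ, reductionForm pos f i ≠ 0 := by
  have hc := continuous_reductionForm pos i
  cases pos <;> fin_cases i
  · exact ae_ne_zero_of_quadratic hc (fun _ _ _ => 0) (fun a _ _ => -a) (fun _ b c => b * c)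
      (fun f => by simp [reductionForm]; ring) fun a b c ha hb => Or.inr (by simpa using ha)
  · exact ae_ne_zero_of_quadratic hc (fun _ _ _ => 0) (fun a _ _ => a)
      (fun a b c => (a - b) ^ 2 + a * c - b * c)
      (fun f => by simp [reductionForm]; ring) fun a b c ha hb => Or.inr (by simpa using ha)
  · exact ae_ne_zero_of_quadratic hc (fun _ _ _ => 1) (fun _ b _ => -b)
      (fun a _ c => -a ^ 2 + a * c)
      (fun f => by simp [reductionForm]; ring) fun a b c ha hb => Or.inl (by simp)
  · exact ae_ne_zero_of_quadratic hc (fun _ _ _ => 0) (fun a _ _ => -9 * a) (fun _ b c => b * c)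
      (fun f => by simp [reductionForm]; ring) fun a b c ha hb => Or.inr (by simpa using ha)
  · exact ae_ne_zero_of_quadratic hc (fun _ _ _ => 0) (fun a _ _ => 9 * a)
      (fun a b c => b ^ 2 - 3 * a * c - b * c)
      (fun f => by simp [reductionForm]; ring) fun a b c ha hb => Or.inr (by simpa using ha)
  · exact ae_ne_zero_of_quadratic hc (fun _ _ _ => 0) (fun _ b _ => -3 * b)
      (fun a b c => c ^ 2 - (b ^ 2 - 3 * a * c))
      (fun f => by simp [reductionForm]; ring) fun a b c ha hb => Or.inr (by simpa using hb)

theorem frontier_inter_subset_union {α : Type*} [TopologicalSpace α] (s t : Set α) :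
    frontier (s ∩ t) ⊆ frontier s ∪ frontier t :=
  (frontier_inter_subset s t).trans
    (Set.union_subset_union Set.inter_subset_left Set.inter_subset_right)

/-- The exceptional set containing the boundaries of `openRegion` and `closedRegion`. -/
def regionBoundary (pos : Bool) (ε : ℝ) : Set (Fin 4 → ℝ) :=
  {f | f 0 = ε} ∪ {f | f 0 = 0} ∪ (⋃ i, {f | reductionForm pos f i = 0}) ∪
    {f | cubicDisc f = 0} ∪ {f | cubicDisc f = discSign pos}

theorem volume_regionBoundary (pos : Bool) (ε : ℝ) : volume (regionBoundary pos ε) = 0 := by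
  rw [measure_eq_zero_iff_ae_notMem]
  have h := ae_all_iff.2 (ae_reductionForm_ne pos)
  filter_upwards [ae_coeff_ne 0 ε, ae_coeff_ne 0 0, h, ae_cubicDisc_ne 0,
    ae_cubicDisc_ne (discSign pos)] with f h1 h2 h3 h4 h5
  rw [sub_zero] at h4
  rw [sub_ne_zero] at h5
  simp only [regionBoundary, Set.mem_union, Set.mem_iUnion, not_or, not_exists]
  exact ⟨⟨⟨⟨h1, h2⟩, h3⟩, h4⟩, h5⟩

theorem discSign_mul_self (pos : Bool) : discSign pos * discSign pos = 1 := by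
  cases pos <;> norm_num [discSign]

theorem frontier_disc_subset (pos : Bool) (ε : ℝ) :
    frontier {f | 0 < discSign pos * cubicDisc f ∧ discSign pos * cubicDisc f < 1} ⊆
      regionBoundary pos ε := by
  refine (frontier_inter_subset_union {f | 0 < discSign pos * cubicDisc f}
    {f | discSign pos * cubicDisc f < 1}).trans (Set.union_subset ?_ ?_)
  · refine (frontier_lt_subset_eq (by fun_prop) (by fun_prop)).trans fun f hf => ?_
    refine Or.inl (Or.inr ?_)
    have hf' : 0 = discSign pos * cubicDisc f := hf
    have := congrArg (discSign pos * ·) hf'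
    simpa [← mul_assoc, discSign_mul_self, eq_comm] using this
  · refine (frontier_lt_subset_eq (by fun_prop) (by fun_prop)).trans fun f hf => ?_
    refine Or.inr ?_
    have hf' : discSign pos * cubicDisc f = 1 := hf
    have := congrArg (discSign pos * ·) hf'
    simpa [← mul_assoc, discSign_mul_self] using this

theorem frontier_coeff_subset (pos : Bool) (ε : ℝ) :
    frontier {f : Fin 4 → ℝ | ε < f 0} ∪ frontier {f : Fin 4 → ℝ | 0 < f 0} ⊆
      regionBoundary pos ε := by
  refine Set.union_subset ?_ ?_
  · refine (frontier_lt_subset_eq (by fun_prop) (by fun_prop)).trans fun f hf => ?_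
    exact Or.inl (Or.inl (Or.inl (Or.inl (Eq.symm hf))))
  · refine (frontier_lt_subset_eq (by fun_prop) (by fun_prop)).trans fun f hf => ?_
    exact Or.inl (Or.inl (Or.inl (Or.inr (Eq.symm hf))))

theorem frontier_openRegion_subset (pos : Bool) (ε : ℝ) :
    frontier (openRegion pos ε) ⊆ regionBoundary pos ε := by
  have h (i) : frontier {f | 0 < reductionForm pos f i} ⊆ regionBoundary pos ε := by
    refine (frontier_lt_subset_eq (by fun_prop) (continuous_reductionForm pos i)).trans
      fun f hf => Or.inl (Or.inl (Or.inr (Set.mem_iUnion.2 ⟨i, Eq.symm hf⟩)))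
  have hc := frontier_coeff_subset pos ε
  have e : openRegion pos ε = ({f | ε < f 0} ∩ {f | 0 < f 0}) ∩ (({f | 0 < reductionForm pos f 0} ∩
      {f | 0 < reductionForm pos f 1} ∩ {f | 0 < reductionForm pos f 2}) ∩
      {f | 0 < discSign pos * cubicDisc f ∧ discSign pos * cubicDisc f < 1}) := by
    ext f
    simp [openRegion, IsStrictlyReducedForm, Fin.forall_fin_succ]
    tauto
  rw [e]
  refine (frontier_inter_subset_union _ _).trans (Set.union_subset
    ((frontier_inter_subset_union _ _).trans hc) ?_)
  refine (frontier_inter_subset_union _ _).trans (Set.union_subset ?_ (frontier_disc_subset pos ε))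
  refine (frontier_inter_subset_union _ _).trans (Set.union_subset ?_ (h 2))
  exact (frontier_inter_subset_union _ _).trans (Set.union_subset (h 0) (h 1))

theorem frontier_closedRegion_subset (pos : Bool) (ε : ℝ) :
    frontier (closedRegion pos ε) ⊆ regionBoundary pos ε := by
  have h (i) : frontier {f | 0 ≤ reductionForm pos f i} ⊆ regionBoundary pos ε := by
    refine (frontier_le_subset_eq (by fun_prop) (continuous_reductionForm pos i)).trans
      fun f hf => Or.inl (Or.inl (Or.inr (Set.mem_iUnion.2 ⟨i, Eq.symm hf⟩)))
  have hc := frontier_coeff_subset pos ε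
  have e : closedRegion pos ε = ({f | ε < f 0} ∩ {f | 0 < f 0}) ∩
      (({f | 0 ≤ reductionForm pos f 0} ∩
      {f | 0 ≤ reductionForm pos f 1} ∩ {f | 0 ≤ reductionForm pos f 2}) ∩
      {f | 0 < discSign pos * cubicDisc f ∧ discSign pos * cubicDisc f < 1}) := by
    ext f
    simp [closedRegion, IsReducedForm, Fin.forall_fin_succ]
    tauto
  rw [e]
  refine (frontier_inter_subset_union _ _).trans (Set.union_subset
    ((frontier_inter_subset_union _ _).trans hc) ?_)
  refine (frontier_inter_subset_union _ _).trans (Set.union_subset ?_ (frontier_disc_subset pos ε))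
  refine (frontier_inter_subset_union _ _).trans (Set.union_subset ?_ (h 2))
  exact (frontier_inter_subset_union _ _).trans (Set.union_subset (h 0) (h 1))

theorem isOpen_openRegion (pos : Bool) (ε : ℝ) : IsOpen (openRegion pos ε) := by
  have e : openRegion pos ε = {f | ε < f 0} ∩ ({f | 0 < f 0} ∩
      (⋂ i, {f | 0 < reductionForm pos f i})) ∩
      ({f | 0 < discSign pos * cubicDisc f} ∩ {f | discSign pos * cubicDisc f < 1}) := by
    ext f
    simp [openRegion, IsStrictlyReducedForm]
    tauto
  rw [e]
  refine ((isOpen_lt (by fun_prop) (by fun_prop)).inter ((isOpen_lt (by fun_prop)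
    (by fun_prop)).inter (isOpen_iInter_of_finite fun i => isOpen_lt (by fun_prop)
    (continuous_reductionForm pos i)))).inter ((isOpen_lt (by fun_prop) (by fun_prop)).inter
    (isOpen_lt (by fun_prop) (by fun_prop)))

theorem closedRegion_subset (pos : Bool) (ε : ℝ) :
    closedRegion pos ε ⊆ openRegion pos ε ∪ regionBoundary pos ε := by
  rintro f ⟨h1, h2, h3⟩
  by_cases h : f ∈ regionBoundary pos ε
  · exact Or.inr h
  refine Or.inl ⟨h1, ⟨h2.1, fun i => lt_of_le_of_ne (h2.2 i) fun h4 => h ?_⟩, h3⟩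
  exact Or.inl (Or.inl (Or.inr (Set.mem_iUnion.2 ⟨i, h4.symm⟩)))

theorem closedRegion_ae_eq (pos : Bool) (ε : ℝ) :
    closedRegion pos ε =ᵐ[volume] openRegion pos ε := by
  refine (ae_le_set.2 (measure_mono_null (fun f hf => ?_)
    (volume_regionBoundary pos ε))).antisymm (openRegion_subset pos ε).eventuallyLE
  exact (closedRegion_subset pos ε hf.1).resolve_left hf.2

theorem measurableSet_closedRegion (pos : Bool) (ε : ℝ) : MeasurableSet (closedRegion pos ε) := by
  have e : closedRegion pos ε = {f | ε < f 0} ∩ ({f | 0 < f 0} ∩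
      (⋂ i, {f | 0 ≤ reductionForm pos f i})) ∩
      ({f | 0 < discSign pos * cubicDisc f} ∩ {f | discSign pos * cubicDisc f < 1}) := by
    ext f
    simp [closedRegion, IsReducedForm]
    tauto
  rw [e]
  exact ((isOpen_lt (by fun_prop) (by fun_prop)).measurableSet.inter ((isOpen_lt (by fun_prop)
    (by fun_prop)).measurableSet.inter (MeasurableSet.iInter fun i => (isClosed_le (by fun_prop)
    (continuous_reductionForm pos i)).measurableSet))).inter
    ((isOpen_lt (by fun_prop) (by fun_prop)).measurableSet.inter
    (isOpen_lt (by fun_prop) (by fun_prop)).measurableSet)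

theorem volume_openRegion_pos (pos : Bool) {ε : ℝ} (hε : 0 < ε) (hε' : ε < 1 / 10) :
    0 < volume.real (openRegion pos ε) := by
  have h1 : volume (openRegion pos ε) ≠ 0 := by
    refine ((isOpen_openRegion pos ε).measure_pos volume ?_).ne'
    cases pos
    · refine ⟨![1 / 10, 1 / 20, 65 / 160, 0], ?_, ⟨?_, fun i => ?_⟩, ?_, ?_⟩
      · simpa using hε'
      · norm_num
      · fin_cases i <;> simp [reductionForm] <;> norm_num
      · simp [cubicDisc, discSign]; norm_num
      · simp [cubicDisc, discSign]; norm_num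
    · refine ⟨![1 / 10, 3 / 40, -189 / 160, -191 / 640], ?_, ⟨?_, fun i => ?_⟩, ?_, ?_⟩
      · simpa using hε'
      · norm_num
      · fin_cases i <;> simp [reductionForm] <;> norm_num
      · simp [cubicDisc, discSign]; norm_num
      · simp [cubicDisc, discSign]; norm_num
  have h2 : volume (openRegion pos ε) ≠ ⊤ :=
    ((isBounded_closedRegion pos hε).subset (openRegion_subset pos ε)).measure_lt_top.ne
  exact ENNReal.toReal_pos h1 h2

theorem exists_coprime_zero {f : Fin 4 → ℤ} (hf : ¬ CubicIrred f) :
    ∃ x y : ℤ, IsCoprime x y ∧ cubicEval f x y = 0 := by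
  rw [CubicIrred] at hf
  push Not at hf
  obtain ⟨x, y, h, hxy⟩ := hf
  have h0 : 0 < Int.gcd x y := Int.gcd_pos_iff.2 (by
    by_contra! hc
    exact hxy hc.1 hc.2)
  obtain ⟨x', y', hc, hx, hy⟩ := Int.exists_gcd_one h0
  refine ⟨x', y', Int.isCoprime_iff_gcd_eq_one.2 hc, ?_⟩
  have hg : ((Int.gcd x y : ℤ)) ≠ 0 := by exact_mod_cast h0.ne'
  have e : cubicEval f x y = (Int.gcd x y : ℤ) ^ 3 * cubicEval f x' y' := by
    rw [cubicEval, cubicEval]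
    generalize (Int.gcd x y : ℤ) = g at hx hy
    rw [hx, hy]; ring
  rw [e] at h
  exact (mul_eq_zero.1 h).resolve_left (pow_ne_zero _ hg)

theorem exists_factor {f : Fin 4 → ℤ} (hf : ¬ CubicIrred f) :
    ∃ x y u v w : ℤ, f 0 = y * u ∧ f 1 = y * v - x * u ∧ f 2 = y * w - x * v ∧ f 3 = -(x * w) := by
  obtain ⟨x, y, hc, h⟩ := exists_coprime_zero hf
  rw [cubicEval] at h
  obtain ⟨u, hu⟩ : y ∣ f 0 := by
    refine (hc.symm.pow_right (n := 3)).dvd_of_dvd_mul_right ⟨-(f 1 * x ^ 2 + f 2 * x * y +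
      f 3 * y ^ 2), ?_⟩
    linear_combination h
  obtain ⟨w, hw⟩ : x ∣ f 3 := by
    refine (hc.pow_right (n := 3)).dvd_of_dvd_mul_right ⟨-(f 0 * x ^ 2 + f 1 * x * y +
      f 2 * y ^ 2), ?_⟩
    linear_combination h
  obtain ⟨a, b, hab⟩ := hc
  by_cases hy : y = 0
  · have hx : x ≠ 0 := by rintro rfl; simp [hy] at hab
    subst hy
    have hx2 : x * x = 1 := by
      have : IsUnit x := IsUnit.of_mul_eq_one a (by linear_combination hab)
      exact Int.isUnit_mul_self this
    refine ⟨x, 0, -x * f 1, -x * f 2, -x * f 3, by simpa using hu, ?_, ?_, ?_⟩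
    · linear_combination -f 1 * hx2
    · linear_combination -f 2 * hx2
    · linear_combination -f 3 * hx2
  by_cases hx : x = 0
  · subst hx
    have hy2 : y * y = 1 := by
      have : IsUnit y := IsUnit.of_mul_eq_one b (by linear_combination hab)
      exact Int.isUnit_mul_self this
    refine ⟨0, y, u, y * f 1, y * f 2, hu, ?_, ?_, by simpa using hw⟩
    · linear_combination -f 1 * hy2
    · linear_combination -f 2 * hy2
  rw [hu, hw] at h
  have h' : u * x ^ 2 + f 1 * x + f 2 * y + w * y ^ 2 = 0 := by
    apply (mul_eq_zero.1 (?_ : (x * y) * _ = 0)).resolve_left (mul_ne_zero hx hy)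
    linear_combination h
  obtain ⟨v, hv⟩ : y ∣ f 1 + x * u := by
    refine (IsCoprime.symm ⟨a, b, hab⟩).dvd_of_dvd_mul_left ⟨-(f 2 + w * y), ?_⟩
    linear_combination h'
  refine ⟨x, y, u, v, -w, hu, by linear_combination hv, ?_, by rw [hw]; ring⟩
  apply mul_left_cancel₀ hy
  linear_combination h' - x * hv

/-- The pairs of integers whose product is nonzero and at most `N` in absolute value. -/
def smallProducts (N : ℕ) : Finset (ℤ × ℤ) :=
  ((Finset.univ : Finset (ℤˣ × ℤˣ)) ×ˢ
    (Finset.Icc 1 N).sigma fun k => Finset.Icc 1 (N / k)).image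
    fun p => (p.1.1 * (p.2.1 : ℤ), p.1.2 * (p.2.2 : ℤ))

theorem mem_smallProducts {N : ℕ} {k l : ℤ} (h0 : k * l ≠ 0) (h : |k * l| ≤ N) :
    (k, l) ∈ smallProducts N := by
  have hk : k ≠ 0 := left_ne_zero_of_mul h0
  have hl : l ≠ 0 := right_ne_zero_of_mul h0
  have hsign (m : ℤ) (hm : m ≠ 0) : ∃ e : ℤˣ, (e : ℤ) * m.natAbs = m := by
    rcases lt_or_gt_of_ne hm with h | h
    · exact ⟨-1, by simp [abs_of_neg h]⟩
    · exact ⟨1, by simp [abs_of_pos h]⟩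
  obtain ⟨e, he⟩ := hsign k hk
  obtain ⟨e', he'⟩ := hsign l hl
  have h1 : k.natAbs * l.natAbs ≤ N := by
    rw [← Int.natAbs_mul]; zify; exact h
  have hk' := Int.natAbs_pos.2 hk
  have hl' := Int.natAbs_pos.2 hl
  refine Finset.mem_image.2 ⟨((e, e'), ⟨k.natAbs, l.natAbs⟩), ?_, by simp only [he, he']⟩
  simp only [Finset.mem_product, Finset.mem_univ, true_and, Finset.mem_sigma, Finset.mem_Icc]
  refine ⟨⟨hk', le_trans (Nat.le_mul_of_pos_right _ hl') h1⟩, hl', ?_⟩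
  rw [Nat.le_div_iff_mul_le hk', mul_comm]
  exact h1

theorem card_smallProducts_le (N : ℕ) :
    ((smallProducts N).card : ℝ) ≤ 4 * N * (1 + Real.log N) := by
  have h1 : (smallProducts N).card ≤ 4 * ∑ k ∈ Finset.Icc 1 N, N / k := by
    refine Finset.card_image_le.trans (le_of_eq ?_)
    rw [Finset.card_product, Finset.card_sigma]
    congr 1
    refine Finset.sum_congr rfl fun k _ => by simp
  have h2 : ((∑ k ∈ Finset.Icc 1 N, N / k : ℕ) : ℝ) ≤ N * (1 + Real.log N) := by
    have h3 := harmonic_le_one_add_log N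
    rw [harmonic_eq_sum_Icc] at h3
    push_cast at h3 ⊢
    calc ∑ k ∈ Finset.Icc 1 N, ((N / k : ℕ) : ℝ) ≤ ∑ k ∈ Finset.Icc 1 N, (N : ℝ) * (k : ℝ)⁻¹ :=
          Finset.sum_le_sum fun k _ => by rw [← div_eq_mul_inv]; exact Nat.cast_div_le
      _ ≤ _ := by rw [← Finset.mul_sum]; gcongr
  have h4 : ((smallProducts N).card : ℝ) ≤ 4 * ((∑ k ∈ Finset.Icc 1 N, N / k : ℕ) : ℝ) := by
    exact_mod_cast h1
  linarith

theorem finite_box (N : ℕ) : {f : Fin 4 → ℤ | ∀ i, |f i| ≤ N}.Finite := by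
  refine (Set.finite_Icc (fun _ : Fin 4 => -(N : ℤ)) (fun _ => N)).subset fun f hf => ?_
  exact ⟨fun i => (abs_le.1 (hf i)).1, fun i => (abs_le.1 (hf i)).2⟩

theorem card_reducible_le (N : ℕ) :
    ({f : Fin 4 → ℤ | (∀ i, |f i| ≤ N) ∧ f 0 ≠ 0 ∧ ¬ CubicIrred f}.ncard : ℝ) ≤
      (2 * N + 1) ^ 3 + (2 * N + 1) * (4 * N * (1 + Real.log N)) ^ 2 := by
  classical
  let I : Finset ℤ := Finset.Icc (-N) N
  have hI : I.card = 2 * N + 1 := by simp [I]; omega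
  let A : Finset (Fin 4 → ℤ) := (I ×ˢ I ×ˢ I).image fun p => ![p.1, p.2.1, p.2.2, 0]
  let B : Finset (Fin 4 → ℤ) := (I ×ˢ smallProducts N ×ˢ smallProducts N).image fun p =>
    ![p.2.1.1 * p.2.1.2, p.1, p.2.1.1 * p.2.2.2 - p.2.2.1 * ((p.1 + p.2.2.1 * p.2.1.2) / p.2.1.1),
      -(p.2.2.1 * p.2.2.2)]
  have hsub : {f : Fin 4 → ℤ | (∀ i, |f i| ≤ N) ∧ f 0 ≠ 0 ∧ ¬ CubicIrred f} ⊆ ↑(A ∪ B) := by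
    rintro f ⟨h1, h2, h3⟩
    have hmem (i) : f i ∈ I := Finset.mem_Icc.2 (abs_le.1 (h1 i))
    rw [Finset.coe_union]
    by_cases hd : f 3 = 0
    · refine Or.inl (Finset.mem_coe.2 (Finset.mem_image.2 ⟨(f 0, f 1, f 2), ?_, ?_⟩))
      · simp only [Finset.mem_product]
        exact ⟨hmem 0, hmem 1, hmem 2⟩
      · apply cubicForm_ext <;> simp [hd]
    · obtain ⟨x, y, u, v, w, e0, e1, e2, e3⟩ := exists_factor h3
      refine Or.inr (Finset.mem_coe.2 (Finset.mem_image.2 ⟨(f 1, (y, u), (x, w)), ?_, ?_⟩))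
      · simp only [Finset.mem_product]
        refine ⟨hmem 1, mem_smallProducts (e0 ▸ h2) (e0 ▸ h1 0), mem_smallProducts ?_ ?_⟩
        · intro h; exact hd (by rw [e3, h, neg_zero])
        · have := h1 3
          rwa [e3, abs_neg] at this
      · have hy : y ≠ 0 := left_ne_zero_of_mul (e0 ▸ h2)
        have hv : (f 1 + x * u) / y = v := by
          rw [e1, sub_add_cancel, Int.mul_ediv_cancel_left _ hy]
        apply cubicForm_ext
        · exact e0.symm
        · rfl
        · show y * w - x * ((f 1 + x * u) / y) = f 2
          rw [hv, e2]
        · exact e3.symm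
  have h1 : {f : Fin 4 → ℤ | (∀ i, |f i| ≤ N) ∧ f 0 ≠ 0 ∧ ¬ CubicIrred f}.ncard ≤
      (2 * N + 1) ^ 3 + (2 * N + 1) * (smallProducts N).card ^ 2 := by
    refine (Set.ncard_le_ncard hsub (Finset.finite_toSet _)).trans ?_
    rw [Set.ncard_coe_finset]
    refine (Finset.card_union_le _ _).trans (Nat.add_le_add ?_ ?_)
    · refine Finset.card_image_le.trans (le_of_eq ?_)
      rw [Finset.card_product, Finset.card_product, hI]; ring
    · refine Finset.card_image_le.trans (le_of_eq ?_)
      rw [Finset.card_product, Finset.card_product, hI]; ring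
  have h2 := card_smallProducts_le N
  calc _ ≤ (((2 * N + 1) ^ 3 + (2 * N + 1) * (smallProducts N).card ^ 2 : ℕ) : ℝ) := by
        exact_mod_cast h1
    _ ≤ _ := by push_cast; gcongr

/-- Reducible forms have density zero in large dilates of a bounded region. -/
theorem tendsto_card_reducible {B : Set (Fin 4 → ℝ)} (hB : Bornology.IsBounded B) :
    Tendsto (fun t : ℝ => ({f : Fin 4 → ℤ | f 0 ≠ 0 ∧ ¬ CubicIrred f ∧
      (fun i => (f i : ℝ) / t) ∈ B}.ncard : ℝ) / t ^ 4) atTop (𝓝 0) := by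
  obtain ⟨R, hR0, hR⟩ := hB.exists_pos_norm_le
  have h1 : Tendsto (fun t : ℝ => ((2 * (R * t) + 1) ^ 3 + (2 * (R * t) + 1) *
      (4 * (R * t) * (1 + Real.log (R * t))) ^ 2) / t ^ 4) atTop (𝓝 0) := by
    have hlog : Tendsto (fun t : ℝ => Real.log (R * t) ^ 2 / (R * t)) atTop (𝓝 0) := by
      have := (Real.isLittleO_pow_log_id_atTop (n := 2)).tendsto_div_nhds_zero
      exact this.comp (tendsto_id.const_mul_atTop hR0)
    have hlog1 : Tendsto (fun t : ℝ => Real.log (R * t) ^ 1 / (R * t)) atTop (𝓝 0) := by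
      have := (Real.isLittleO_pow_log_id_atTop (n := 1)).tendsto_div_nhds_zero
      exact this.comp (tendsto_id.const_mul_atTop hR0)
    have hinv : Tendsto (fun t : ℝ => t⁻¹) atTop (𝓝 0) := tendsto_inv_atTop_zero
    have e : Tendsto (fun t : ℝ => (2 * R + t⁻¹) ^ 3 * t⁻¹ + (2 * R + t⁻¹) * (16 * R ^ 2) *
        (t⁻¹ + 2 * R * (Real.log (R * t) ^ 1 / (R * t)) + R * (Real.log (R * t) ^ 2 / (R * t))))
        atTop (𝓝 ((2 * R + 0) ^ 3 * 0 + (2 * R + 0) * (16 * R ^ 2) * (0 + 2 * R * 0 + R * 0))) :=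
      ((((tendsto_const_nhds.add hinv).pow 3).mul hinv)).add
        (((tendsto_const_nhds.add hinv).mul tendsto_const_nhds).mul
        ((hinv.add (tendsto_const_nhds.mul hlog1)).add (tendsto_const_nhds.mul hlog)))
    simp only [mul_zero, add_zero] at e
    refine e.congr' ?_
    filter_upwards [eventually_gt_atTop 0] with t ht
    field_simp
    ring
  refine squeeze_zero' (Eventually.of_forall fun t => ?_) ?_ h1
  · positivity
  filter_upwards [eventually_ge_atTop (1 / R)] with t ht
  have ht0 : 0 < t := lt_of_lt_of_le (by positivity) ht
  rw [div_le_iff₀ hR0] at ht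
  have hRt : 1 ≤ R * t := by linarith
  have hN1 : 1 ≤ ⌊R * t⌋₊ := Nat.le_floor (by simpa using hRt)
  have hN : (⌊R * t⌋₊ : ℝ) ≤ R * t := Nat.floor_le (by positivity)
  have hsub : {f : Fin 4 → ℤ | f 0 ≠ 0 ∧ ¬ CubicIrred f ∧ (fun i => (f i : ℝ) / t) ∈ B} ⊆
      {f : Fin 4 → ℤ | (∀ i, |f i| ≤ ⌊R * t⌋₊) ∧ f 0 ≠ 0 ∧ ¬ CubicIrred f} := by
    rintro f ⟨h2, h3, h4⟩
    refine ⟨fun i => ?_, h2, h3⟩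
    have h5 := (norm_le_pi_norm _ i).trans (hR _ h4)
    rw [Real.norm_eq_abs, abs_div, abs_of_pos ht0, div_le_iff₀ ht0] at h5
    rw [Int.abs_eq_natAbs, Nat.cast_le]
    refine Nat.le_floor ?_
    rwa [Nat.cast_natAbs, Int.cast_abs]
  have h6 : {f : Fin 4 → ℤ | (∀ i, |f i| ≤ ⌊R * t⌋₊) ∧ f 0 ≠ 0 ∧ ¬ CubicIrred f}.Finite :=
    (finite_box _).subset fun f hf => hf.1
  have h7 := Set.ncard_le_ncard hsub h6
  have h8 := card_reducible_le ⌊R * t⌋₊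
  have hlog0 : 0 ≤ Real.log ⌊R * t⌋₊ := Real.log_nonneg (by exact_mod_cast hN1)
  have hlog1 : Real.log ⌊R * t⌋₊ ≤ Real.log (R * t) :=
    Real.log_le_log (by exact_mod_cast hN1) hN
  gcongr
  refine le_trans (by exact_mod_cast h7) (h8.trans ?_)
  gcongr

theorem card_int_between (x y : ℝ) (h : x ≤ y) :
    {d : ℤ | x ≤ d ∧ d ≤ y}.Finite ∧ ({d : ℤ | x ≤ d ∧ d ≤ y}.ncard : ℝ) ≤ y - x + 1 := by
  have e : {d : ℤ | x ≤ d ∧ d ≤ y} = Finset.Icc ⌈x⌉ ⌊y⌋ := by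
    ext d; simp [Int.ceil_le, Int.le_floor]
  rw [e]
  refine ⟨Finset.finite_toSet _, ?_⟩
  rw [Set.ncard_coe_finset, Int.card_Icc]
  have h1 := Int.floor_le y
  have h2 := Int.le_ceil x
  have : (((⌊y⌋ + 1 - ⌈x⌉).toNat : ℤ) : ℝ) ≤ y - x + 1 := by
    rw [Int.toNat_eq_max]
    push_cast
    exact max_le (by linarith) (by linarith)
  exact_mod_cast this

theorem card_abs_affine_le (p : ℤ) {s : ℝ} (hs : 0 < s) {R : ℝ} (hR : 0 ≤ R) :
    {d : ℤ | |p + s * d| ≤ R}.Finite ∧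
      ({d : ℤ | |p + s * d| ≤ R}.ncard : ℝ) ≤ 2 * R / s + 1 := by
  have e : {d : ℤ | |p + s * d| ≤ R} = {d : ℤ | (-R - p) / s ≤ d ∧ d ≤ (R - p) / s} := by
    ext d
    simp only [Set.mem_ofPred_eq, abs_le, div_le_iff₀ hs, le_div_iff₀ hs]
    constructor <;> rintro ⟨h1, h2⟩ <;> constructor <;> linarith
  rw [e]
  obtain ⟨h1, h2⟩ := card_int_between ((-R - p) / s) ((R - p) / s) (by gcongr; linarith)
  refine ⟨h1, h2.trans (le_of_eq ?_)⟩
  field_simp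
  ring

theorem card_sq_affine_le (p : ℤ) {s : ℝ} (hs : 0 < s) {Q K : ℝ} (hK : 0 ≤ K) (hQ : 0 < Q)
    (hKQ : K ≤ Q) :
    {d : ℤ | |(p + s * d) ^ 2 - Q| ≤ K}.Finite ∧
      ({d : ℤ | |(p + s * d) ^ 2 - Q| ≤ K}.ncard : ℝ) ≤ 2 * (2 * K / (s * √Q) + 1) := by
  obtain ⟨u, hu⟩ : ∃ u, u = √(Q + K) := ⟨_, rfl⟩
  obtain ⟨l, hl⟩ : ∃ l, l = √(Q - K) := ⟨_, rfl⟩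
  have hu2 : u ^ 2 = Q + K := by rw [hu]; exact Real.sq_sqrt (by linarith)
  have hl2 : l ^ 2 = Q - K := by rw [hl]; exact Real.sq_sqrt (by linarith)
  have hl0 : 0 ≤ l := hl ▸ Real.sqrt_nonneg _
  have hlu : l ≤ u := by rw [hl, hu]; exact Real.sqrt_le_sqrt (by linarith)
  have hQu : √Q ≤ u := by rw [hu]; exact Real.sqrt_le_sqrt (by linarith)
  have hQ0 : 0 < √Q := Real.sqrt_pos.2 hQ
  have hdiff : u - l ≤ 2 * K / √Q := by
    rw [le_div_iff₀ hQ0]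
    nlinarith
  have hsub : {d : ℤ | |(p + s * d) ^ 2 - Q| ≤ K} ⊆
      {d : ℤ | (l - p) / s ≤ d ∧ d ≤ (u - p) / s} ∪
      {d : ℤ | (-u - p) / s ≤ d ∧ d ≤ (-l - p) / s} := by
    intro d hd
    have hd' : |(p + s * d) ^ 2 - Q| ≤ K := hd
    rw [abs_le] at hd'
    simp only [Set.mem_union, Set.mem_ofPred_eq, div_le_iff₀ hs, le_div_iff₀ hs]
    have h1 : l ≤ |p + s * d| := abs_le_of_sq_le_sq' (by rw [sq_abs]; linarith) (abs_nonneg _) |>.2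
    have h2 : |p + s * d| ≤ u := abs_le_of_sq_le_sq' (by rw [sq_abs]; linarith) (by linarith) |>.2
    rcases le_total 0 (p + s * d : ℝ) with h | h
    · rw [abs_of_nonneg h] at h1 h2
      left; constructor <;> linarith
    · rw [abs_of_nonpos h] at h1 h2
      right; constructor <;> linarith
  obtain ⟨h1, h2⟩ := card_int_between ((l - p) / s) ((u - p) / s) (by gcongr)
  obtain ⟨h3, h4⟩ := card_int_between ((-u - p) / s) ((-l - p) / s) (by gcongr)
  refine ⟨(h1.union h3).subset hsub, ?_⟩
  have h5 := (Set.ncard_le_ncard hsub (h1.union h3)).trans (Set.ncard_union_le _ _)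
  rw [← Nat.cast_le (α := ℝ), Nat.cast_add] at h5
  have h6 : 2 * K / (s * √Q) = (2 * K / √Q) / s := by field_simp
  have h7 : (u - l) / s ≤ (2 * K / √Q) / s := by gcongr
  have h8 : (u - p) / s - (l - p) / s = (u - l) / s := by ring
  have h9 : (-l - p) / s - (-u - p) / s = (u - l) / s := by ring
  rw [h6]
  linarith

theorem sum_inv_mul_sqrt_le {M : ℕ} (hM : 1 ≤ M) (N : ℕ) :
    ∑ m ∈ Finset.Icc M N, 1 / ((m : ℝ) * √m) ≤ 3 / √M := by
  rcases lt_or_ge N M with h | h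
  · rw [Finset.Icc_eq_empty (by omega), Finset.sum_empty]; positivity
  suffices ∑ m ∈ Finset.Icc M N, 1 / ((m : ℝ) * √m) ≤ 3 / √M - 2 / √N by
    have : 0 ≤ 2 / √N := by positivity
    linarith
  induction N, h using Nat.le_induction with
  | base =>
    have h1 : (1 : ℝ) ≤ M := by exact_mod_cast hM
    have h2 : 0 < √(M : ℝ) := Real.sqrt_pos.2 (by linarith)
    rw [Finset.Icc_self, Finset.sum_singleton, ← sub_div]
    norm_num
    exact mul_le_of_le_one_right (by positivity) (inv_le_one_of_one_le₀ h1)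
  | succ n hn ih =>
    rw [Finset.sum_Icc_succ_top (by omega)]
    have hn1 : (1 : ℝ) ≤ n := by exact_mod_cast hM.trans hn
    obtain ⟨s, hs⟩ : ∃ s, s = √(n : ℝ) := ⟨_, rfl⟩
    obtain ⟨r, hr⟩ : ∃ r, r = √((n + 1 : ℕ) : ℝ) := ⟨_, rfl⟩
    have hs2 : s ^ 2 = n := by rw [hs]; exact Real.sq_sqrt (by linarith)
    have hr2 : r ^ 2 = n + 1 := by rw [hr, Real.sq_sqrt (by positivity)]; push_cast; rfl
    have hs0 : 0 < s := by rw [hs]; exact Real.sqrt_pos.2 (by linarith)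
    have hr0 : 0 < r := by rw [hr]; exact Real.sqrt_pos.2 (by positivity)
    have hsr : s ≤ r := by nlinarith
    have key : 1 / (((n + 1 : ℕ) : ℝ) * r) ≤ 2 / s - 2 / r := by
      push_cast
      rw [← hr2, div_sub_div _ _ hs0.ne' hr0.ne', div_le_div_iff₀ (by positivity) (by positivity)]
      have h3 : (r - s) * (r + s) = 1 := by nlinarith
      have h4 : 1 ≤ 2 * r * (r - s) := by nlinarith
      have h5 : 0 < s * r := by positivity
      have h6 : s * r ≤ r ^ 2 := by nlinarith
      nlinarith [mul_le_mul_of_nonneg_left h4 (by positivity : 0 ≤ r ^ 2)]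
    rw [← hs] at ih
    rw [← hr]
    linarith

theorem sum_inv_sqrt_le (N : ℕ) : ∑ m ∈ Finset.Icc 1 N, 1 / √(m : ℝ) ≤ 2 * √N := by
  induction N with
  | zero => simp
  | succ n ih =>
    rw [Finset.sum_Icc_succ_top (by omega)]
    obtain ⟨s, hs⟩ : ∃ s, s = √(n : ℝ) := ⟨_, rfl⟩
    obtain ⟨r, hr⟩ : ∃ r, r = √((n + 1 : ℕ) : ℝ) := ⟨_, rfl⟩
    have hs2 : s ^ 2 = n := by rw [hs]; exact Real.sq_sqrt (by positivity)
    have hr2 : r ^ 2 = n + 1 := by rw [hr, Real.sq_sqrt (by positivity)]; push_cast; rfl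
    have hs0 : 0 ≤ s := by rw [hs]; positivity
    have hr0 : 0 < r := by rw [hr]; exact Real.sqrt_pos.2 (by positivity)
    rw [← hs] at ih
    rw [← hr]
    have key : 1 / r ≤ 2 * r - 2 * s := by
      rw [div_le_iff₀ hr0]
      nlinarith [sq_nonneg (r - s)]
    linarith

/-- The leading coefficient of the Hessian covariant. -/
def hessianCoeff {R : Type*} [CommRing R] (f : Fin 4 → R) : R := f 1 ^ 2 - 3 * f 0 * f 2

/-- The leading coefficient of the cubic covariant. -/
def cubicCovCoeff {R : Type*} [CommRing R] (f : Fin 4 → R) : R :=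
  2 * f 1 ^ 3 - 9 * f 0 * f 1 * f 2 + 27 * f 0 ^ 2 * f 3

theorem covariant_syzygy {R : Type*} [CommRing R] (f : Fin 4 → R) :
    4 * hessianCoeff f ^ 3 = cubicCovCoeff f ^ 2 + 27 * f 0 ^ 2 * cubicDisc f := by
  rw [hessianCoeff, cubicCovCoeff, cubicDisc]; ring

theorem hessianCoeff_translate {R : Type*} [CommRing R] (f : Fin 4 → R) (k : R) :
    hessianCoeff (cubicSubst 1 k 0 1 f) = hessianCoeff f := by
  simp [hessianCoeff, cubicSubst]; ring

theorem cubicCovCoeff_translate {R : Type*} [CommRing R] (f : Fin 4 → R) (k : R) :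
    cubicCovCoeff (cubicSubst 1 k 0 1 f) = cubicCovCoeff f := by
  simp [cubicCovCoeff, cubicSubst]; ring

/-- The translation-reduced forms with leading coefficient `a` whose covariants satisfy the
inequalities forced by reducedness and `|disc| < X`. -/
def cuspSet (a : ℕ) (X : ℝ) : Set (Fin 4 → ℤ) :=
  {f | f 0 = a ∧ 0 ≤ f 1 ∧ f 1 < 3 * a ∧ ((hessianCoeff f : ℤ) : ℝ) ^ 2 ≤ 4 * X ∧
    |((cubicCovCoeff f : ℤ) : ℝ) ^ 2 - 4 * ((hessianCoeff f : ℤ) : ℝ) ^ 3| ≤ 27 * a ^ 2 * X}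

/-- The part of `cuspSet a X` with prescribed second coefficient and prescribed integral part of
the Hessian coefficient. -/
def cuspFiber (a : ℕ) (X : ℝ) (b m : ℤ) : Set (Fin 4 → ℤ) :=
  {f ∈ cuspSet a X | f 1 = b ∧ f 2 = b ^ 2 / (3 * a) - m}

section
variable {a : ℕ} {X : ℝ} {b m : ℤ}

theorem hessianCoeff_mem_of_mem_cuspFiber (ha : 1 ≤ a) {f : Fin 4 → ℤ}
    (hf : f ∈ cuspFiber a X b m) :
    3 * a * m ≤ hessianCoeff f ∧ hessianCoeff f < 3 * a * (m + 1) := by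
  obtain ⟨⟨h0, -⟩, h1, h2⟩ := hf
  have h3a : (0 : ℤ) < 3 * a := by omega
  have e1 := Int.emod_add_mul_ediv (b ^ 2) (3 * a)
  have e2 := Int.emod_nonneg (b ^ 2) h3a.ne'
  have e3 := Int.emod_lt_of_pos (b ^ 2) h3a
  rw [hessianCoeff, h0, h1, h2]
  constructor <;> linarith

theorem cuspFiber_subset_image (S : Set ℤ)
    (h : ∀ f ∈ cuspFiber a X b m, f 3 ∈ S) :
    cuspFiber a X b m ⊆ (fun d => ![(a : ℤ), b, b ^ 2 / (3 * a) - m, d]) '' S := by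
  intro f hf
  refine ⟨f 3, h f hf, ?_⟩
  apply cubicForm_ext
  · exact hf.1.1.symm
  · exact hf.2.1.symm
  · exact hf.2.2.symm
  · rfl

theorem card_le_of_subset_image {S : Set ℤ} (hS : S.Finite) {T : Set (Fin 4 → ℤ)}
    {g : ℤ → Fin 4 → ℤ} (h : T ⊆ g '' S) : T.Finite ∧ T.ncard ≤ S.ncard :=
  ⟨(hS.image g).subset h, (Set.ncard_le_ncard h (hS.image g)).trans (Set.ncard_image_le hS)⟩

theorem card_cuspFiber_of_lt (ha : 1 ≤ a) (hX : (a : ℝ) ^ 4 ≤ X) {M : ℤ} (hm : m < M)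
    (hM : (a : ℝ) * M ^ 3 ≤ 8 * X) :
    (cuspFiber a X b m).Finite ∧ ((cuspFiber a X b m).ncard : ℝ) ≤ 4 * √X / a := by
  have ha' : (1 : ℝ) ≤ a := by exact_mod_cast ha
  have hX0 : 0 ≤ X := le_trans (by positivity) hX
  have hs : (0 : ℝ) < 27 * a ^ 2 := by positivity
  have haX : (a : ℝ) ≤ √X := by
    rw [Real.le_sqrt (by positivity) hX0]
    have : (a : ℝ) ^ 2 ≤ a ^ 4 := pow_le_pow_right₀ ha' (by norm_num)
    linarith
  obtain ⟨p, hp⟩ : ∃ p : ℤ, p = 2 * b ^ 3 - 9 * a * b * (b ^ 2 / (3 * a) - m) := ⟨_, rfl⟩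
  obtain ⟨h1, h2⟩ := card_abs_affine_le p hs (R := 30 * a * √X) (by positivity)
  have hmem : ∀ f ∈ cuspFiber a X b m, f 3 ∈
    {d : ℤ | |(p : ℝ) + 27 * a ^ 2 * d| ≤ 30 * a * √X} := by
    intro f hf
    obtain ⟨h5, h6⟩ := hessianCoeff_mem_of_mem_cuspFiber ha hf
    have hA : ((hessianCoeff f : ℤ) : ℝ) ≤ 3 * a * M := by
      have h7 : hessianCoeff f ≤ 3 * a * M := by nlinarith
      exact_mod_cast h7
    obtain ⟨⟨e0, -, -, -, h7⟩, e1, e2⟩ := hf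
    have hU : ((cubicCovCoeff f : ℤ) : ℝ) = p + 27 * a ^ 2 * f 3 := by
      rw [hp, cubicCovCoeff, e0, e1, e2]; push_cast; ring
    have h8 : ((hessianCoeff f : ℤ) : ℝ) ^ 3 ≤ (3 * a * M) ^ 3 :=
      (Odd.strictMono_pow (by decide)).monotone hA
    have h9 := (abs_le.1 h7).2
    show |(p : ℝ) + 27 * a ^ 2 * f 3| ≤ _
    rw [← hU]
    apply abs_le_of_sq_le_sq _ (by positivity)
    have h10 : (30 * a * √X) ^ 2 = 900 * a ^ 2 * X := by
      rw [mul_pow, Real.sq_sqrt hX0]; ring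
    rw [h10]
    have h11 : (3 * a * M : ℝ) ^ 3 ≤ 27 * a ^ 2 * (8 * X) := by
      calc (3 * a * M : ℝ) ^ 3 = 27 * a ^ 2 * (a * M ^ 3) := by ring
        _ ≤ _ := by gcongr
    nlinarith [mul_nonneg (sq_nonneg (a : ℝ)) hX0]
  obtain ⟨h3, h4⟩ := card_le_of_subset_image h1 (cuspFiber_subset_image _ hmem)
  refine ⟨h3, ?_⟩
  have h5 : ((cuspFiber a X b m).ncard : ℝ) ≤ 2 * (30 * a * √X) / (27 * a ^ 2) + 1 :=
    le_trans (by exact_mod_cast h4) h2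
  have h6 : 2 * (30 * a * √X) / (27 * a ^ 2) = 60 / 27 * (√X / a) := by field_simp; ring
  have h7 : 1 ≤ √X / a := by rwa [le_div_iff₀ (by linarith), one_mul]
  rw [h6] at h5
  rw [mul_div_assoc]
  linarith

theorem card_cuspFiber_of_ge (ha : 1 ≤ a) (hX : 0 ≤ X) {m : ℕ} (hm : 1 ≤ m)
    (hM : X ≤ (a : ℝ) * m ^ 3) :
    (cuspFiber a X b m).Finite ∧
      ((cuspFiber a X b m).ncard : ℝ) ≤ 2 * (X / (a * √a) * (1 / (m * √m)) + 1) := by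
  have ha' : (1 : ℝ) ≤ a := by exact_mod_cast ha
  have hm' : (1 : ℝ) ≤ m := by exact_mod_cast hm
  have hs : (0 : ℝ) < 27 * a ^ 2 := by positivity
  obtain ⟨p, hp⟩ : ∃ p : ℤ, p = 2 * b ^ 3 - 9 * a * b * (b ^ 2 / (3 * a) - m) := ⟨_, rfl⟩
  obtain ⟨A, hA⟩ : ∃ A : ℤ, A = b ^ 2 - 3 * a * (b ^ 2 / (3 * a) - m) := ⟨_, rfl⟩
  have hAm : (3 * a * m : ℝ) ≤ A := by
    have h3a : (0 : ℤ) < 3 * a := by omega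
    have e1 := Int.emod_add_mul_ediv (b ^ 2) (3 * a)
    have e2 := Int.emod_nonneg (b ^ 2) h3a.ne'
    have : 3 * a * m ≤ A := by rw [hA]; linarith
    exact_mod_cast this
  have hQ : (a * m : ℝ) ^ 3 * 108 ≤ 4 * (A : ℝ) ^ 3 := by
    have := pow_le_pow_left₀ (by positivity) hAm 3
    nlinarith
  have hKQ : 27 * (a : ℝ) ^ 2 * X ≤ 4 * (A : ℝ) ^ 3 := by
    refine le_trans ?_ hQ
    have : (a : ℝ) ^ 2 * X ≤ a ^ 2 * (a * m ^ 3) := by gcongr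
    have h0 : 0 ≤ (a : ℝ) ^ 2 * X := by positivity
    nlinarith
  have hQ0 : (0 : ℝ) < (a * m : ℝ) ^ 3 * 108 := by positivity
  obtain ⟨h1, h2⟩ := card_sq_affine_le p hs (Q := 4 * (A : ℝ) ^ 3) (K := 27 * a ^ 2 * X)
    (by positivity) (by linarith) hKQ
  have hmem : ∀ f ∈ cuspFiber a X b m, f 3 ∈
    {d : ℤ | |((p : ℝ) + 27 * a ^ 2 * d) ^ 2 - 4 * (A : ℝ) ^ 3| ≤ 27 * a ^ 2 * X} := by
    intro f hf
    obtain ⟨⟨e0, -, -, -, h7⟩, e1, e2⟩ := hf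
    have hU : ((cubicCovCoeff f : ℤ) : ℝ) = p + 27 * a ^ 2 * f 3 := by
      rw [hp, cubicCovCoeff, e0, e1, e2]; push_cast; ring
    have hA' : hessianCoeff f = A := by rw [hA, hessianCoeff, e0, e1, e2]
    rw [hU, hA'] at h7
    exact h7
  obtain ⟨h3, h4⟩ := card_le_of_subset_image h1 (cuspFiber_subset_image _ hmem)
  refine ⟨h3, le_trans (by exact_mod_cast h4) (h2.trans ?_)⟩
  have h5 : 2 * (a * √a) * (m * √m) ≤ √(4 * (A : ℝ) ^ 3) := by
    apply Real.le_sqrt_of_sq_le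
    have ea := Real.sq_sqrt (by linarith : (0 : ℝ) ≤ a)
    have em := Real.sq_sqrt (by linarith : (0 : ℝ) ≤ m)
    have : (2 * (a * √a) * (m * √m)) ^ 2 = 4 * (a * m : ℝ) ^ 3 := by
      calc _ = 4 * a ^ 2 * m ^ 2 * √a ^ 2 * √m ^ 2 := by ring
        _ = _ := by rw [ea, em]; ring
    rw [this]
    nlinarith
  have h6 : 2 * (27 * (a : ℝ) ^ 2 * X) / (27 * a ^ 2 * √(4 * (A : ℝ) ^ 3)) =
      2 * X / √(4 * (A : ℝ) ^ 3) := by field_simp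
  have h7 : 2 * X / √(4 * (A : ℝ) ^ 3) ≤ 2 * X / (2 * (a * √a) * (m * √m)) := by gcongr
  have h8 : 2 * X / (2 * (a * √a) * (m * √m)) = X / (a * √a) * (1 / (m * √m)) := by
    field_simp
  rw [h6]
  linarith

end

theorem finite_and_card_biUnion_le {α β : Type*} (s : Finset α) (T : α → Set β) (c : α → ℝ)
    (h : ∀ x ∈ s, (T x).Finite ∧ ((T x).ncard : ℝ) ≤ c x) :
    (⋃ x ∈ s, T x).Finite ∧ ((⋃ x ∈ s, T x).ncard : ℝ) ≤ ∑ x ∈ s, c x := by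
  refine ⟨s.finite_toSet.biUnion fun x hx => (h x hx).1, ?_⟩
  refine le_trans ?_ (Finset.sum_le_sum fun x hx => (h x hx).2)
  exact_mod_cast Finset.set_ncard_biUnion_le s T

theorem card_cuspSet_le {a : ℕ} {X μ : ℝ} (ha : 1 ≤ a) (hX : (a : ℝ) ^ 4 ≤ X) (hμ : 1 ≤ μ)
    (hμX : a * μ ^ 3 = X) :
    (cuspSet a X).Finite ∧ ((cuspSet a X).ncard : ℝ) ≤ 70 * μ * √X := by
  have ha' : (1 : ℝ) ≤ a := by exact_mod_cast ha
  have hX0 : 0 ≤ X := le_trans (by positivity) hX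
  obtain ⟨N, hN⟩ : ∃ N, N = ⌈μ⌉₊ := ⟨_, rfl⟩
  obtain ⟨L, hL⟩ : ∃ L, L = ⌊2 * √X / (3 * a)⌋₊ := ⟨_, rfl⟩
  have hN1 : μ ≤ N := hN ▸ Nat.le_ceil μ
  have hN2 : (N : ℝ) ≤ 2 * μ := by
    have := Nat.ceil_lt_add_one (by linarith : 0 ≤ μ)
    rw [← hN] at this; linarith
  have hN0 : 1 ≤ N := by
    have : (1 : ℝ) ≤ N := hμ.trans hN1
    exact_mod_cast this
  have haN1 : X ≤ a * (N : ℝ) ^ 3 := by rw [← hμX]; gcongr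
  have haN2 : a * ((N : ℤ) : ℝ) ^ 3 ≤ 8 * X := by
    have : (N : ℝ) ^ 3 ≤ (2 * μ) ^ 3 := by gcongr
    rw [← hμX]
    push_cast
    nlinarith
  have hL1 : 3 * a * (L : ℝ) ≤ 2 * √X := by
    have := Nat.floor_le (show 0 ≤ 2 * √X / (3 * a) by positivity)
    rw [← hL, le_div_iff₀ (by positivity)] at this
    linarith
  obtain ⟨I, hI⟩ : ∃ I, I = Finset.Ico (0 : ℤ) (3 * a) := ⟨_, rfl⟩
  have hb : ∀ b ∈ I, (⋃ m ∈ Finset.Ico (-(N : ℤ)) N, cuspFiber a X b m).Finite ∧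
      ((⋃ m ∈ Finset.Ico (-(N : ℤ)) N, cuspFiber a X b m).ncard : ℝ) ≤ 16 * μ * √X / a := by
    intro b _
    obtain ⟨h1, h2⟩ := finite_and_card_biUnion_le (Finset.Ico (-(N : ℤ)) N)
      (fun m => cuspFiber a X b m) (fun _ => 4 * √X / a)
      fun m hm => card_cuspFiber_of_lt ha hX (Finset.mem_Ico.1 hm).2 haN2
    refine ⟨h1, h2.trans ?_⟩
    rw [Finset.sum_const, Int.card_Ico, nsmul_eq_mul]
    have : ((N : ℤ) - -(N : ℤ)).toNat = 2 * N := by omega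
    rw [this]
    push_cast
    calc 2 * (N : ℝ) * (4 * √X / a) ≤ 2 * (2 * μ) * (4 * √X / a) := by gcongr
      _ = _ := by ring
  have hb' : ∀ b ∈ I, (⋃ m ∈ Finset.Icc N L, cuspFiber a X b (m : ℕ)).Finite ∧
      ((⋃ m ∈ Finset.Icc N L, cuspFiber a X b (m : ℕ)).ncard : ℝ) ≤
        6 * μ * √X / a + 2 * L := by
    intro b _
    obtain ⟨h1, h2⟩ := finite_and_card_biUnion_le (Finset.Icc N L)
      (fun m => cuspFiber a X b (m : ℕ))
      (fun m => 2 * (X / (a * √a) * (1 / (m * √m)) + 1))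
      fun m hm => card_cuspFiber_of_ge ha hX0 (hN0.trans (Finset.mem_Icc.1 hm).1) (by
        have : (N : ℝ) ≤ m := by exact_mod_cast (Finset.mem_Icc.1 hm).1
        exact haN1.trans (by gcongr))
    refine ⟨h1, h2.trans ?_⟩
    rw [← Finset.mul_sum, Finset.sum_add_distrib, ← Finset.mul_sum, Finset.sum_const,
      Nat.card_Icc, nsmul_eq_mul, mul_one]
    have h3 : ((L + 1 - N : ℕ) : ℝ) ≤ L := by exact_mod_cast (by omega)
    have h4 := sum_inv_mul_sqrt_le hN0 L
    have h5 : X / (a * √a) * (3 / √N) ≤ 3 * μ * √X / a := by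
      have hsa : 0 < √(a : ℝ) := Real.sqrt_pos.2 (by linarith)
      have hsμ : 0 < √μ := Real.sqrt_pos.2 (by linarith)
      calc X / (a * √a) * (3 / √N) ≤ X / (a * √a) * (3 / √μ) := by gcongr
        _ = 3 * μ * √X / a := by
          have e : √X = √a * (μ * √μ) := by
            rw [← hμX, Real.sqrt_mul (by linarith), pow_succ, Real.sqrt_mul (by positivity),
              Real.sqrt_sq (by linarith)]
          rw [e, ← hμX]
          have e1 := Real.sq_sqrt (by linarith : (0 : ℝ) ≤ a)
          have e2 := Real.sq_sqrt (by linarith : (0 : ℝ) ≤ μ)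
          field_simp
          rw [e1, e2]
    have h6 : X / (a * √a) * ∑ m ∈ Finset.Icc N L, 1 / ((m : ℝ) * √m) ≤
        X / (a * √a) * (3 / √N) := by gcongr
    have h7 : 6 * μ * √X / a = 2 * (3 * μ * √X / a) := by ring
    linarith
  obtain ⟨f1, c1⟩ := finite_and_card_biUnion_le I _ _ hb
  obtain ⟨f2, c2⟩ := finite_and_card_biUnion_le I _ _ hb'
  have hsub : cuspSet a X ⊆ (⋃ b ∈ I, ⋃ m ∈ Finset.Ico (-(N : ℤ)) N, cuspFiber a X b m) ∪
      ⋃ b ∈ I, ⋃ m ∈ Finset.Icc N L, cuspFiber a X b (m : ℕ) := by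
    intro f hf
    obtain ⟨m, hm⟩ : ∃ m, m = f 1 ^ 2 / (3 * a) - f 2 := ⟨_, rfl⟩
    have hmem : f ∈ cuspFiber a X (f 1) m := ⟨hf, rfl, by rw [hm]; ring⟩
    obtain ⟨hA1, hA2⟩ := hessianCoeff_mem_of_mem_cuspFiber ha hmem
    have hfI : f 1 ∈ I := by rw [hI, Finset.mem_Ico]; exact ⟨hf.2.1, hf.2.2.1⟩
    rcases lt_or_ge m N with hmN | hmN
    · left
      simp only [Set.mem_iUnion]
      refine ⟨f 1, hfI, m, Finset.mem_Ico.2 ⟨?_, hmN⟩, hmem⟩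
      by_contra! hlt
      have h1 : hessianCoeff f ≤ -(3 * a * N) := by nlinarith
      have h2 : ((hessianCoeff f : ℤ) : ℝ) ≤ -(3 * a * N) := by exact_mod_cast h1
      have h3 : ((hessianCoeff f : ℤ) : ℝ) ^ 3 ≤ (-(3 * a * N)) ^ 3 :=
        (Odd.strictMono_pow (by decide)).monotone h2
      have h4 := (abs_le.1 hf.2.2.2.2).2
      have h5 : (a : ℝ) ^ 2 * X ≤ a ^ 2 * (a * N ^ 3) := by gcongr
      have h6 : (0 : ℝ) < a ^ 2 * (a * N ^ 3) := by
        have : (0 : ℝ) < N := by exact_mod_cast hN0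
        positivity
      nlinarith [sq_nonneg ((cubicCovCoeff f : ℤ) : ℝ)]
    · right
      obtain ⟨k, rfl⟩ : ∃ k : ℕ, m = k := ⟨m.toNat, by omega⟩
      simp only [Set.mem_iUnion]
      refine ⟨f 1, hfI, k, Finset.mem_Icc.2 ⟨by exact_mod_cast hmN, ?_⟩, hmem⟩
      rw [hL, Nat.le_floor_iff (by positivity), le_div_iff₀ (by positivity)]
      have h1 : (3 * a * k : ℝ) ≤ (hessianCoeff f : ℤ) := by exact_mod_cast hA1
      have h2 : ((hessianCoeff f : ℤ) : ℝ) ≤ 2 * √X := by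
        apply le_of_sq_le_sq _ (by positivity)
        rw [mul_pow, Real.sq_sqrt hX0]
        linarith [hf.2.2.2.1]
      linarith
  refine ⟨(f1.union f2).subset hsub, ?_⟩
  have h1 : ((cuspSet a X).ncard : ℝ) ≤ _ :=
    Nat.cast_le.2 ((Set.ncard_le_ncard hsub (f1.union f2)).trans (Set.ncard_union_le _ _))
  rw [Nat.cast_add] at h1
  refine h1.trans ((add_le_add c1 c2).trans ?_)
  have hc : (I.card : ℝ) = 3 * a := by
    rw [hI, Int.card_Ico, sub_zero, show ((3 : ℤ) * a) = ((3 * a : ℕ) : ℤ) by push_cast; rfl,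
      Int.toNat_natCast]
    push_cast; rfl
  rw [Finset.sum_const, Finset.sum_const, nsmul_eq_mul, nsmul_eq_mul, hc]
  have h2 : 3 * (a : ℝ) * (16 * μ * √X / a) = 48 * (μ * √X) := by field_simp; ring
  have h3 : 3 * (a : ℝ) * (6 * μ * √X / a + 2 * L) = 18 * (μ * √X) + 2 * (3 * a * L) := by
    field_simp; ring
  have h4 : √X ≤ μ * √X := le_mul_of_one_le_left (Real.sqrt_nonneg _) hμ
  rw [h2, h3]
  linarith

/-- The reduced integral forms with `0 < ±disc < X`. -/
def reducedForms (pos : Bool) (X : ℝ) : Set (Fin 4 → ℤ) :=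
  {f | IsReducedForm pos (castForm f) ∧ 0 < discSign pos * cubicDisc f ∧
    discSign pos * cubicDisc f < X}

theorem discSign_eq_or (pos : Bool) : discSign pos = 1 ∨ discSign pos = -1 := by
  cases pos <;> simp [discSign]

theorem abs_le_of_discSign_mul {pos : Bool} {d X : ℝ} (h0 : 0 < discSign pos * d)
    (h : discSign pos * d < X) : |d| ≤ X := by
  rcases discSign_eq_or pos with e | e <;> rw [e] at h0 h
    <;> rw [abs_le] <;> constructor <;> linarith

theorem card_reducedForms_eq_le (pos : Bool) (a : ℕ) (X : ℝ) (ha : 1 ≤ a)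
    (hfin : (cuspSet a X).Finite) :
    {f ∈ reducedForms pos X | f 0 = a}.Finite ∧
      {f ∈ reducedForms pos X | f 0 = a}.ncard ≤ (cuspSet a X).ncard := by
  have hmap : ∀ f ∈ {f ∈ reducedForms pos X | f 0 = a},
      cubicSubst 1 (-(f 1 / (3 * a))) 0 1 f ∈ cuspSet a X := by
    rintro f ⟨⟨hf, hd0, hd⟩, h0⟩
    have h3a : (0 : ℤ) < 3 * a := by omega
    have hA := hf.hessian_sq_le (by rwa [castForm_disc])
    have hs := congrArg (Int.cast : ℤ → ℝ) (covariant_syzygy f)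
    push_cast at hs
    have hA' : ((hessianCoeff f : ℤ) : ℝ) = castForm f 1 ^ 2 - 3 * castForm f 0 * castForm f 2 := by
      simp only [castForm_apply, hessianCoeff]; push_cast; rfl
    rw [castForm_disc, ← hA'] at hA
    refine ⟨?_, ?_, ?_, ?_, ?_⟩
    · simp [cubicSubst, h0]
    · have : cubicSubst 1 (-(f 1 / (3 * a))) 0 1 f 1 = f 1 % (3 * a) := by
        rw [Int.emod_def]
        simp [cubicSubst, h0]; ring
      rw [this]
      exact Int.emod_nonneg _ h3a.ne'
    · have : cubicSubst 1 (-(f 1 / (3 * a))) 0 1 f 1 = f 1 % (3 * a) := by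
        rw [Int.emod_def]
        simp [cubicSubst, h0]; ring
      rw [this]
      exact Int.emod_lt_of_pos _ h3a
    · rw [hessianCoeff_translate]
      linarith
    · rw [hessianCoeff_translate, cubicCovCoeff_translate]
      have e : ((cubicCovCoeff f : ℤ) : ℝ) ^ 2 - 4 * ((hessianCoeff f : ℤ) : ℝ) ^ 3 =
          -(27 * a ^ 2 * (cubicDisc f : ℤ)) := by
        have h0' : ((f 0 : ℤ) : ℝ) = a := by exact_mod_cast h0
        rw [h0'] at hs
        linarith
      rw [e, abs_neg, abs_mul, abs_of_nonneg (by positivity : (0 : ℝ) ≤ 27 * a ^ 2)]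
      have := abs_le_of_discSign_mul hd0 hd
      gcongr
  have hinj : Set.InjOn (fun f : Fin 4 → ℤ => cubicSubst 1 (-(f 1 / (3 * a))) 0 1 f)
      {f ∈ reducedForms pos X | f 0 = a} := by
    intro f hf g hg hfg
    exact hf.1.1.eq_of_translate hg.1.1 hf.1.2.1 hfg
  exact ⟨Set.Finite.of_injOn hmap hinj hfin, Set.ncard_le_ncard_of_injOn _ hmap hinj hfin⟩

theorem card_reducedForms_cusp_le (pos : Bool) {t L : ℝ} (ht : 1 ≤ t) (hL : 0 ≤ L) (hLt : L ≤ t) :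
    {f ∈ reducedForms pos (t ^ 4) | (f 0 : ℝ) ≤ L}.Finite ∧
      ({f ∈ reducedForms pos (t ^ 4) | (f 0 : ℝ) ≤ L}.ncard : ℝ) ≤ 140 * t ^ 3 * √(t * L) := by
  have hb : ∀ a ∈ Finset.Icc 1 ⌊L⌋₊, {f ∈ reducedForms pos (t ^ 4) | f 0 = (a : ℕ)}.Finite ∧
      ({f ∈ reducedForms pos (t ^ 4) | f 0 = (a : ℕ)}.ncard : ℝ) ≤
        70 * t ^ 3 * √t * (1 / √a) := by
    intro a ha
    obtain ⟨ha1, ha2⟩ := Finset.mem_Icc.1 ha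
    have haL : (a : ℝ) ≤ t := ((Nat.le_floor_iff hL).1 ha2).trans hLt
    have ha' : (1 : ℝ) ≤ a := by exact_mod_cast ha1
    obtain ⟨μ, hμ⟩ : ∃ μ : ℝ, μ = (t ^ 4 / a) ^ (1 / 3 : ℝ) := ⟨_, rfl⟩
    have hμ0 : 0 ≤ μ := by rw [hμ]; positivity
    have hμ3 : μ ^ 3 = t ^ 4 / a := by
      rw [hμ, ← Real.rpow_natCast, ← Real.rpow_mul (by positivity)]
      norm_num
    have h1 : 1 ≤ μ := by
      rw [hμ]
      apply Real.one_le_rpow _ (by norm_num)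
      rw [le_div_iff₀ (by linarith), one_mul]
      have := pow_le_pow_right₀ ht (show 1 ≤ 4 by norm_num)
      linarith
    have hX : (a : ℝ) ^ 4 ≤ t ^ 4 := by gcongr
    obtain ⟨c1, c2⟩ := card_cuspSet_le ha1 hX h1 (by rw [hμ3]; field_simp)
    obtain ⟨c3, c4⟩ := card_reducedForms_eq_le pos a (t ^ 4) ha1 c1
    refine ⟨c3, (Nat.cast_le.2 c4).trans (c2.trans ?_)⟩
    have hst : √(t ^ 4) = t ^ 2 := by
      rw [show t ^ 4 = (t ^ 2) ^ 2 by ring]; exact Real.sqrt_sq (by positivity)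
    have hμ' : μ ≤ t * √(t / a) := by
      apply le_of_pow_le_pow_left₀ (n := 3) (by norm_num) (by positivity)
      have e := Real.sq_sqrt (by positivity : 0 ≤ t / a)
      have e' : 1 ≤ √(t / a) := by
        rw [Real.one_le_sqrt, le_div_iff₀ (by linarith)]; linarith
      calc μ ^ 3 = t ^ 3 * (t / a) * 1 := by rw [hμ3]; ring
        _ ≤ t ^ 3 * (t / a) * √(t / a) := by gcongr
        _ = (t * √(t / a)) ^ 3 := by
          rw [mul_pow, show √(t / a) ^ 3 = √(t / a) ^ 2 * √(t / a) by ring, e]; ring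
    rw [hst]
    calc 70 * μ * t ^ 2 ≤ 70 * (t * √(t / a)) * t ^ 2 := by gcongr
      _ = _ := by rw [Real.sqrt_div (by linarith)]; ring
  obtain ⟨h1, h2⟩ := finite_and_card_biUnion_le _ _ _ hb
  have hsub : {f ∈ reducedForms pos (t ^ 4) | (f 0 : ℝ) ≤ L} ⊆
      ⋃ a ∈ Finset.Icc 1 ⌊L⌋₊, {f ∈ reducedForms pos (t ^ 4) | f 0 = (a : ℕ)} := by
    rintro f ⟨hf, hfL⟩
    have hf0 : 0 < f 0 := by exact_mod_cast (show (0 : ℝ) < f 0 from hf.1.1)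
    obtain ⟨k, hk⟩ : ∃ k : ℕ, f 0 = k := ⟨(f 0).toNat, by omega⟩
    simp only [Set.mem_iUnion]
    refine ⟨k, Finset.mem_Icc.2 ⟨by omega, ?_⟩, hf, hk⟩
    rw [Nat.le_floor_iff hL]
    rw [hk] at hfL
    exact_mod_cast hfL
  refine ⟨h1.subset hsub, ?_⟩
  calc ({f ∈ reducedForms pos (t ^ 4) | (f 0 : ℝ) ≤ L}.ncard : ℝ)
      ≤ _ := Nat.cast_le.2 (Set.ncard_le_ncard hsub h1)
    _ ≤ _ := h2
    _ ≤ 70 * t ^ 3 * √t * (2 * √(⌊L⌋₊ : ℝ)) := by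
      rw [← Finset.mul_sum]
      gcongr
      exact sum_inv_sqrt_le _
    _ ≤ 70 * t ^ 3 * √t * (2 * √L) := by
      gcongr
      exact Nat.floor_le hL
    _ = _ := by rw [Real.sqrt_mul (by linarith)]; ring

theorem reducedForms_coeff_le {pos : Bool} {t : ℝ} (ht : 0 ≤ t) {f : Fin 4 → ℤ}
    (hf : f ∈ reducedForms pos (t ^ 4)) : (f 0 : ℝ) ≤ t := by
  have h := hf.1.pow_four_le (by rw [castForm_disc]; exact hf.2.1)
  rw [castForm_disc] at h
  exact le_of_pow_le_pow_left₀ (n := 4) (by norm_num) ht (h.trans hf.2.2.le)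

theorem card_reducedForms_le (pos : Bool) {t : ℝ} (ht : 1 ≤ t) :
    (reducedForms pos (t ^ 4)).Finite ∧ ((reducedForms pos (t ^ 4)).ncard : ℝ) ≤ 140 * t ^ 4 := by
  have h := card_reducedForms_cusp_le pos ht (by linarith) le_rfl
  have e : {f ∈ reducedForms pos (t ^ 4) | (f 0 : ℝ) ≤ t} = reducedForms pos (t ^ 4) :=
    Set.sep_eq_self_iff_mem_true.2 fun f hf => reducedForms_coeff_le (by linarith) hf
  rw [e, Real.sqrt_mul_self (by linarith)] at h
  exact ⟨h.1, h.2.trans (by rw [show (140 : ℝ) * t ^ 3 * t = 140 * t ^ 4 by ring])⟩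

theorem reductionForm_smul (pos : Bool) (c : ℝ) (f : Fin 4 → ℝ) (i : Fin 3) :
    reductionForm pos (c • f) i = c ^ 2 * reductionForm pos f i := by
  cases pos <;> fin_cases i <;> simp [reductionForm] <;> ring

theorem div_eq_smul_castForm (f : Fin 4 → ℤ) (t : ℝ) :
    (fun i => (f i : ℝ) / t) = t⁻¹ • castForm f := by
  ext i; simp [castForm_apply, div_eq_inv_mul]

theorem IsReducedForm.smul_iff {pos : Bool} {c : ℝ} (hc : 0 < c) {f : Fin 4 → ℝ} :
    IsReducedForm pos (c • f) ↔ IsReducedForm pos f := by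
  simp only [IsReducedForm, reductionForm_smul, Pi.smul_apply, smul_eq_mul, hc,
    mul_pos_iff_of_pos_left,
    mul_nonneg_iff_of_pos_left (pow_pos hc 2)]

theorem IsStrictlyReducedForm.smul_iff {pos : Bool} {c : ℝ} (hc : 0 < c) {f : Fin 4 → ℝ} :
    IsStrictlyReducedForm pos (c • f) ↔ IsStrictlyReducedForm pos f := by
  simp only [IsStrictlyReducedForm, reductionForm_smul, Pi.smul_apply, smul_eq_mul, hc,
    mul_pos_iff_of_pos_left, pow_pos hc 2]

theorem disc_smul_bounds {pos : Bool} {t : ℝ} (ht : 0 < t) (f : Fin 4 → ℤ) :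
    (0 < discSign pos * cubicDisc (t⁻¹ • castForm f) ∧
      discSign pos * cubicDisc (t⁻¹ • castForm f) < 1) ↔
      0 < discSign pos * cubicDisc f ∧ discSign pos * cubicDisc f < t ^ 4 := by
  have e : discSign pos * cubicDisc (t⁻¹ • castForm f) = discSign pos * cubicDisc f / t ^ 4 := by
    rw [cubicDisc_smul, castForm_disc, inv_pow]; field_simp
  rw [e, div_pos_iff_of_pos_right (by positivity), div_lt_one (by positivity)]

theorem coeff_smul_iff {ε t : ℝ} (ht : 0 < t) (f : Fin 4 → ℤ) :
    ε < (t⁻¹ • castForm f) 0 ↔ ε * t < f 0 := by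
  simp only [Pi.smul_apply, castForm_apply, smul_eq_mul]
  rw [← div_eq_inv_mul, lt_div_iff₀ ht]

theorem mem_closedRegion_iff {pos : Bool} {ε t : ℝ} (ht : 0 < t) (f : Fin 4 → ℤ) :
    (fun i => (f i : ℝ) / t) ∈ closedRegion pos ε ↔ f ∈ reducedForms pos (t ^ 4) ∧ ε * t < f 0 := by
  rw [div_eq_smul_castForm, closedRegion, reducedForms, Set.mem_ofPred_eq, Set.mem_ofPred_eq,
    disc_smul_bounds ht, IsReducedForm.smul_iff (inv_pos.2 ht), coeff_smul_iff ht]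
  tauto

theorem mem_openRegion_iff {pos : Bool} {ε t : ℝ} (ht : 0 < t) (f : Fin 4 → ℤ) :
    (fun i => (f i : ℝ) / t) ∈ openRegion pos ε ↔
      (f ∈ reducedForms pos (t ^ 4) ∧ ε * t < f 0) ∧ IsStrictlyReducedForm pos (castForm f) := by
  rw [div_eq_smul_castForm, openRegion, reducedForms, Set.mem_ofPred_eq, Set.mem_ofPred_eq,
    disc_smul_bounds ht, IsStrictlyReducedForm.smul_iff (inv_pos.2 ht), coeff_smul_iff ht]
  have := @IsStrictlyReducedForm.isReduced pos (castForm f)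
  tauto

theorem finite_reducedForms (pos : Bool) (X : ℝ) : (reducedForms pos X).Finite := by
  refine (card_reducedForms_le pos (t := max 1 X) (le_max_left _ _)).1.subset fun f hf =>
    ⟨hf.1, hf.2.1, hf.2.2.trans_le ?_⟩
  have h1 : 1 ≤ max 1 X := le_max_left _ _
  calc X ≤ max 1 X := le_max_right _ _
    _ = max 1 X ^ 1 := (pow_one _).symm
    _ ≤ max 1 X ^ 4 := pow_le_pow_right₀ h1 (by norm_num)

theorem exists_torsionNumber_le (m : ℕ) [NeZero m] : ∃ C : ℕ, ∀ f, torsionNumber m f ≤ C := by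
  refine ⟨∑ x : Fin 4 → ZMod (m ^ 3), torsionNumber m (liftForm x), fun f => ?_⟩
  rw [torsionNumber_congr fun i => dvd_liftForm_sub (M := m ^ 3) f i]
  exact Finset.single_le_sum (f := fun x : Fin 4 → ZMod (m ^ 3) => torsionNumber m (liftForm x))
    (fun _ _ => Nat.zero_le _) (Finset.mem_univ _)

/-- The weighted count of lattice points in large dilates of `B`, with weight `torsionNumber`. -/
theorem tendsto_sum_torsionNumber (m : ℕ) [NeZero m] {B : Set (Fin 4 → ℝ)}
    (hB : Bornology.IsBounded B) (hm : MeasurableSet B) (hfr : volume (frontier B) = 0)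
    (T : ℝ → Finset (Fin 4 → ℤ))
    (hT : ∀ᶠ t : ℝ in atTop, ∀ f, f ∈ T t ↔ (fun i => (f i : ℝ) / t) ∈ B) :
    Tendsto (fun t : ℝ => (∑ f ∈ T t, (torsionNumber m f : ℝ)) / t ^ 4) atTop
      (𝓝 (torsionMean m * volume.real B)) := by
  have h1 : ∀ x : Fin 4 → ZMod (m ^ 3), Tendsto (fun t : ℝ => (torsionNumber m (liftForm x) : ℝ) *
      ((Nat.card {f : Fin 4 → ℤ // (∀ i, ((m ^ 3 : ℕ) : ℤ) ∣ f i - liftForm x i) ∧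
      (fun i => (f i : ℝ) / t) ∈ B} : ℝ) / t ^ Fintype.card (Fin 4))) atTop
      (𝓝 ((torsionNumber m (liftForm x) : ℝ) *
        (volume.real B / ((m ^ 3 : ℕ) : ℝ) ^ Fintype.card (Fin 4)))) :=
    fun x => (tendsto_card_congruent (liftForm x) hB hm hfr).const_mul _
  have h2 := tendsto_finsetSum Finset.univ fun x _ => h1 x
  have e1 : ∑ x : Fin 4 → ZMod (m ^ 3), (torsionNumber m (liftForm x) : ℝ) *
      (volume.real B / ((m ^ 3 : ℕ) : ℝ) ^ Fintype.card (Fin 4)) =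
      torsionMean m * volume.real B := by
    rw [← Finset.sum_mul, ← Nat.cast_sum, sum_torsionNumber, torsionMean, if_neg (NeZero.ne m)]
    have : (m : ℝ) ≠ 0 := NeZero.ne _
    simp only [Fintype.card_fin]
    push_cast
    field_simp
  rw [e1] at h2
  refine h2.congr' ?_
  filter_upwards [hT] with t ht
  rw [← Finset.sum_fiberwise (T t) (fun f i => (f i : ZMod (m ^ 3))), Finset.sum_div]
  refine Finset.sum_congr rfl fun x _ => ?_
  have hfib : ∀ f : Fin 4 → ℤ, (fun i => (f i : ZMod (m ^ 3))) = x ↔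
      ∀ i, ((m ^ 3 : ℕ) : ℤ) ∣ f i - liftForm x i := by
    intro f
    rw [funext_iff]
    refine forall_congr' fun i => ?_
    rw [← ZMod.intCast_eq_intCast_iff_dvd_sub, eq_comm]
    simp [liftForm]
  have h3 : ∀ f ∈ (T t).filter fun f => (fun i => (f i : ZMod (m ^ 3))) = x,
      (torsionNumber m f : ℝ) = torsionNumber m (liftForm x) := by
    intro f hf
    rw [torsionNumber_congr ((hfib f).1 (Finset.mem_filter.1 hf).2)]
  rw [Finset.sum_congr rfl h3, Finset.sum_const, nsmul_eq_mul]
  have h4 : Nat.card {f : Fin 4 → ℤ // (∀ i, ((m ^ 3 : ℕ) : ℤ) ∣ f i - liftForm x i) ∧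
      (fun i => (f i : ℝ) / t) ∈ B} =
      ((T t).filter fun f => (fun i => (f i : ZMod (m ^ 3))) = x).card := by
    refine Nat.subtype_card _ fun f => ?_
    rw [Finset.mem_filter, ht, hfib, and_comm]
  rw [h4, Fintype.card_fin]
  ring

/-- A family of reduced forms representing each class of irreducible integral binary cubic forms
with the given sign of the discriminant exactly once. -/
structure IsFormSystem {ι : Type*} (pos : Bool) (F : ι → Fin 4 → ℤ) : Prop where
  irred : ∀ i, CubicIrred (F i)
  reduced : ∀ i, IsReducedForm pos (castForm (F i))
  disc_pos : ∀ i, 0 < discSign pos * cubicDisc (F i)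
  existsUnique : ∀ f, CubicIrred f → 0 < discSign pos * cubicDisc f → ∃! i, CubicEquiv f (F i)

namespace IsFormSystem

variable {ι : Type*} {pos : Bool} {F : ι → Fin 4 → ℤ}

theorem injective (hF : IsFormSystem pos F) : Function.Injective F := fun i _ hij =>
  (hF.existsUnique (F i) (hF.irred i) (hF.disc_pos i)).unique (CubicEquiv.refl _)
    (hij ▸ CubicEquiv.refl _)

theorem finite (hF : IsFormSystem pos F) (X : ℝ) :
    {i | discSign pos * cubicDisc (F i) < X}.Finite :=
  ((finite_reducedForms pos X).preimage hF.injective.injOn).subset fun i hi =>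
    ⟨hF.reduced i, hF.disc_pos i, hi⟩

/-- The indices of the forms with absolute discriminant less than `X`. -/
noncomputable def indices (hF : IsFormSystem pos F) (X : ℝ) : Finset ι := (hF.finite X).toFinset

theorem mem_indices (hF : IsFormSystem pos F) {X : ℝ} {i : ι} :
    i ∈ hF.indices X ↔ discSign pos * cubicDisc (F i) < X := by
  rw [indices, Set.Finite.mem_toFinset]; rfl

/-- The total of `torsionNumber m` over the forms with absolute discriminant less than `X`. -/
noncomputable def torsionSum (hF : IsFormSystem pos F) (m : ℕ) (X : ℝ) : ℝ :=
  ∑ i ∈ hF.indices X, (torsionNumber m (F i) : ℝ)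

theorem sum_indices_le (hF : IsFormSystem pos F) (X : ℝ) {φ : (Fin 4 → ℤ) → ℝ} (hφ : ∀ f, 0 ≤ φ f) :
    ∑ i ∈ hF.indices X, φ (F i) ≤ ∑ f ∈ (finite_reducedForms pos X).toFinset, φ f := by
  classical
  rw [← Finset.sum_image (f := φ) (g := F) hF.injective.injOn]
  refine Finset.sum_le_sum_of_subset_of_nonneg (fun f hf => ?_) fun f _ _ => hφ f
  obtain ⟨i, hi, rfl⟩ := Finset.mem_image.1 hf
  rw [Set.Finite.mem_toFinset]
  exact ⟨hF.reduced i, hF.disc_pos i, hF.mem_indices.1 hi⟩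

theorem card_indices_le (hF : IsFormSystem pos F) {t : ℝ} (ht : 1 ≤ t) :
    ((hF.indices (t ^ 4)).card : ℝ) ≤ 140 * t ^ 4 := by
  have h := hF.sum_indices_le (t ^ 4) (φ := fun _ => 1) fun _ => zero_le_one
  rw [Finset.sum_const, Finset.sum_const, nsmul_eq_mul, nsmul_eq_mul, mul_one, mul_one,
    ← Set.ncard_eq_toFinset_card _ (finite_reducedForms pos (t ^ 4))] at h
  exact h.trans (card_reducedForms_le pos ht).2

theorem le_sum_indices (hF : IsFormSystem pos F) (X : ℝ) {φ : (Fin 4 → ℤ) → ℝ} (hφ : ∀ f, 0 ≤ φ f)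
    (hφ' : ∀ f g, CubicEquiv f g → φ f = φ g) (T : Finset (Fin 4 → ℤ))
    (hT : ∀ f ∈ T, CubicIrred f ∧ IsStrictlyReducedForm pos (castForm f) ∧ f ∈ reducedForms pos X) :
    ∑ f ∈ T, φ f ≤ ∑ i ∈ hF.indices X, φ (F i) := by
  classical
  rcases T.eq_empty_or_nonempty with rfl | ⟨f₀, hf₀⟩
  · simpa using Finset.sum_nonneg fun i _ => hφ (F i)
  have : Nonempty ι := ⟨(hF.existsUnique f₀ (hT f₀ hf₀).1 (hT f₀ hf₀).2.2.2.1).choose⟩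
  choose! r hr using fun f (hf : f ∈ T) =>
    (hF.existsUnique f (hT f hf).1 (hT f hf).2.2.2.1).exists
  have hinj : Set.InjOn r T := by
    intro f hf g hg hfg
    refine (hT f hf).2.1.eq_of_cubicEquiv (hT g hg).2.1 (hT f hf).2.2.2.1 ?_
    exact (hr f hf).trans (hfg ▸ (hr g hg).symm)
  calc ∑ f ∈ T, φ f = ∑ f ∈ T, φ (F (r f)) := Finset.sum_congr rfl fun f hf => hφ' _ _ (hr f hf)
    _ = ∑ i ∈ T.image r, φ (F i) := (Finset.sum_image (f := fun i => φ (F i)) hinj).symm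
    _ ≤ _ := by
      refine Finset.sum_le_sum_of_subset_of_nonneg (fun i hi => ?_) fun i _ _ => hφ _
      obtain ⟨f, hf, rfl⟩ := Finset.mem_image.1 hi
      rw [hF.mem_indices, (hr f hf).disc_eq]
      exact (hT f hf).2.2.2.2

end IsFormSystem

theorem tendsto_of_eventually_le_le {α : Type*} {l : Filter α} {u : α → ℝ} {lo hi : ℕ → α → ℝ}
    {a b : ℕ → ℝ} {c : ℝ} (hlo : ∀ n, ∀ᶠ x in l, lo n x ≤ u x) (hhi : ∀ n, ∀ᶠ x in l, u x ≤ hi n x)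
    (ha : ∀ n, Tendsto (lo n) l (𝓝 (a n))) (hb : ∀ n, Tendsto (hi n) l (𝓝 (b n)))
    (hac : Tendsto a atTop (𝓝 c)) (hbc : Tendsto b atTop (𝓝 c)) : Tendsto u l (𝓝 c) := by
  refine tendsto_order.2 ⟨fun x hx => ?_, fun x hx => ?_⟩
  · obtain ⟨n, hn⟩ := (hac.eventually (lt_mem_nhds hx)).exists
    filter_upwards [hlo n, (ha n).eventually (lt_mem_nhds hn)] with y h1 h2 using h2.trans_le h1
  · obtain ⟨n, hn⟩ := (hbc.eventually (gt_mem_nhds hx)).exists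
    filter_upwards [hhi n, (hb n).eventually (gt_mem_nhds hn)] with y h1 h2 using h1.trans_lt h2

section
variable (pos : Bool) (ε t : ℝ)

open Classical in
/-- The integral points of the dilate by `t` of `closedRegion pos ε`. -/
noncomputable def closedLatticePoints : Finset (Fin 4 → ℤ) :=
  (finite_reducedForms pos (t ^ 4)).toFinset.filter fun f => ε * t < f 0

open Classical in
/-- The integral points of the dilate by `t` of `openRegion pos ε`. -/
noncomputable def openLatticePoints : Finset (Fin 4 → ℤ) :=
  (closedLatticePoints pos ε t).filter fun f => IsStrictlyReducedForm pos (castForm f)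

variable {t}

theorem mem_closedLatticePoints (ht : 0 < t) (f : Fin 4 → ℤ) :
    f ∈ closedLatticePoints pos ε t ↔ (fun i => (f i : ℝ) / t) ∈ closedRegion pos ε := by
  rw [mem_closedRegion_iff ht, closedLatticePoints, Finset.mem_filter, Set.Finite.mem_toFinset]

theorem mem_openLatticePoints (ht : 0 < t) (f : Fin 4 → ℤ) :
    f ∈ openLatticePoints pos ε t ↔ (fun i => (f i : ℝ) / t) ∈ openRegion pos ε := by
  classical
  rw [mem_openRegion_iff ht, openLatticePoints, closedLatticePoints, Finset.mem_filter,
    Finset.mem_filter,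
    Set.Finite.mem_toFinset]

variable {ε} (m : ℕ) [NeZero m]

theorem tendsto_sum_closedLatticePoints (hε : 0 < ε) :
    Tendsto (fun t : ℝ =>
      (∑ f ∈ closedLatticePoints pos ε t, (torsionNumber m f : ℝ)) / t ^ 4) atTop
      (𝓝 (torsionMean m * volume.real (openRegion pos ε))) := by
  rw [← measureReal_congr (closedRegion_ae_eq pos ε)]
  refine tendsto_sum_torsionNumber m (isBounded_closedRegion pos hε)
    (measurableSet_closedRegion pos ε) (measure_mono_null (frontier_closedRegion_subset pos ε)
    (volume_regionBoundary pos ε)) _ ?_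
  filter_upwards [eventually_gt_atTop 0] with t ht using mem_closedLatticePoints pos ε ht

theorem tendsto_sum_openLatticePoints (hε : 0 < ε) :
    Tendsto (fun t : ℝ => (∑ f ∈ openLatticePoints pos ε t, (torsionNumber m f : ℝ)) / t ^ 4) atTop
      (𝓝 (torsionMean m * volume.real (openRegion pos ε))) := by
  refine tendsto_sum_torsionNumber m ((isBounded_closedRegion pos hε).subset
    (openRegion_subset pos ε))
    (isOpen_openRegion pos ε).measurableSet (measure_mono_null (frontier_openRegion_subset pos ε)
    (volume_regionBoundary pos ε)) _ ?_
  filter_upwards [eventually_gt_atTop 0] with t ht using mem_openLatticePoints pos ε ht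

theorem volume_openRegion_le (hε : 0 < ε) : volume.real (openRegion pos ε) ≤ 140 := by
  have h := tendsto_sum_closedLatticePoints pos 1 hε
  rw [torsionMean_one, one_mul] at h
  refine le_of_tendsto h ?_
  filter_upwards [eventually_ge_atTop 1] with t ht
  rw [div_le_iff₀ (by positivity)]
  simp only [torsionNumber_one, Nat.cast_one, Finset.sum_const, nsmul_eq_mul, mul_one]
  refine le_trans ?_ (card_reducedForms_le pos ht).2
  rw [Set.ncard_eq_toFinset_card _ (finite_reducedForms pos (t ^ 4))]
  exact_mod_cast Finset.card_filter_le _ _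

theorem openRegion_anti {δ : ℝ} (h : δ ≤ ε) : openRegion pos ε ⊆ openRegion pos δ :=
  fun _ hf => ⟨h.trans_lt hf.1, hf.2⟩

end

theorem exists_tendsto_volume (pos : Bool) : ∃ V : ℝ, 0 < V ∧
    Tendsto (fun n : ℕ => volume.real (openRegion pos (1 / ((n : ℝ) + 11)))) atTop (𝓝 V) := by
  have hpos : ∀ n : ℕ, (0 : ℝ) < 1 / ((n : ℝ) + 11) := fun n => by positivity
  have hmono : Monotone fun n : ℕ => volume.real (openRegion pos (1 / ((n : ℝ) + 11))) := by
    intro n k hnk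
    refine measureReal_mono (openRegion_anti pos ?_)
      ((isBounded_closedRegion pos (hpos k)).subset (openRegion_subset pos _)).measure_lt_top.ne
    have : (n : ℝ) ≤ k := by exact_mod_cast hnk
    gcongr
  have hbdd : BddAbove (Set.range fun n : ℕ => volume.real (openRegion pos (1 / ((n : ℝ) + 11))))
    := by
    refine ⟨140, ?_⟩
    rintro _ ⟨n, rfl⟩
    exact volume_openRegion_le pos (hpos n)
  refine ⟨_, ?_, tendsto_atTop_ciSup hmono hbdd⟩
  refine lt_of_lt_of_le ?_ (le_ciSup hbdd 0)
  refine volume_openRegion_pos pos (hpos 0) ?_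
  norm_num

namespace IsFormSystem

variable {ι : Type*} {pos : Bool} {F : ι → Fin 4 → ℤ}

theorem torsionSum_le (hF : IsFormSystem pos F) (m : ℕ) {C : ℕ} (hC : ∀ f, torsionNumber m f ≤ C)
    {ε t : ℝ} (hε : 0 < ε) (hε1 : ε ≤ 1) (ht : 1 ≤ t) :
    hF.torsionSum m (t ^ 4) / t ^ 4 ≤
      (∑ f ∈ closedLatticePoints pos ε t, (torsionNumber m f : ℝ)) / t ^ 4 + C * (140 * √ε) := by
  classical
  have ht0 : 0 < t := by linarith
  have h1 := hF.sum_indices_le (t ^ 4) (φ := fun f => (torsionNumber m f : ℝ))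
    fun _ => Nat.cast_nonneg _
  rw [← Finset.sum_filter_add_sum_filter_not _ (fun f : Fin 4 → ℤ => ε * t < f 0)] at h1
  obtain ⟨h2, h3⟩ := card_reducedForms_cusp_le pos ht (L := ε * t) (by positivity) (by nlinarith)
  have h4 : ∑ f ∈ (finite_reducedForms pos (t ^ 4)).toFinset with ¬ ε * t < f 0,
      (torsionNumber m f : ℝ) ≤ C * (140 * √ε) * t ^ 4 := by
    have e : ((finite_reducedForms pos (t ^ 4)).toFinset.filter fun f => ¬ ε * t < f 0) =
        h2.toFinset := by
      ext f
      simp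
    have e2 : √(t * (ε * t)) = t * √ε := by
      rw [show t * (ε * t) = t ^ 2 * ε by ring, Real.sqrt_mul (by positivity),
        Real.sqrt_sq ht0.le]
    rw [e]
    calc _ ≤ ∑ f ∈ h2.toFinset, (C : ℝ) := Finset.sum_le_sum fun f _ => by exact_mod_cast hC f
      _ = C * ({f ∈ reducedForms pos (t ^ 4) | (f 0 : ℝ) ≤ ε * t}.ncard : ℝ) := by
        rw [Finset.sum_const, nsmul_eq_mul, ← Set.ncard_eq_toFinset_card _ h2, mul_comm]
      _ ≤ C * (140 * t ^ 3 * √(t * (ε * t))) := by gcongr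
      _ = _ := by rw [e2]; ring
  have h5 : hF.torsionSum m (t ^ 4) ≤ ∑ f ∈ closedLatticePoints pos ε t, (torsionNumber m f : ℝ) +
      C * (140 * √ε) * t ^ 4 := h1.trans (add_le_add (le_of_eq (by rw [closedLatticePoints])) h4)
  rw [div_le_iff₀ (by positivity), add_mul, div_mul_cancel₀ _ (by positivity)]
  exact h5

theorem le_torsionSum (hF : IsFormSystem pos F) (m : ℕ) [NeZero m] {C : ℕ}
    (hC : ∀ f, torsionNumber m f ≤ C) {ε t : ℝ} (hε : 0 < ε) (ht : 1 ≤ t) :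
    (∑ f ∈ openLatticePoints pos ε t, (torsionNumber m f : ℝ)) / t ^ 4 -
      C * (({f : Fin 4 → ℤ | f 0 ≠ 0 ∧ ¬ CubicIrred f ∧
        (fun i => (f i : ℝ) / t) ∈ openRegion pos ε}.ncard : ℝ) / t ^ 4) ≤
      hF.torsionSum m (t ^ 4) / t ^ 4 := by
  classical
  have ht0 : 0 < t := by linarith
  have h1 := hF.le_sum_indices (t ^ 4) (φ := fun f => (torsionNumber m f : ℝ))
    (fun _ => Nat.cast_nonneg _) (fun f g h => by rw [h.torsionNumber_eq m])
    ((openLatticePoints pos ε t).filter CubicIrred) fun f hf => by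
      rw [Finset.mem_filter, mem_openLatticePoints pos ε ht0, mem_openRegion_iff ht0] at hf
      exact ⟨hf.2, hf.1.2, hf.1.1.1⟩
  have h2 : ∑ f ∈ openLatticePoints pos ε t with ¬ CubicIrred f, (torsionNumber m f : ℝ) ≤
      C * ({f : Fin 4 → ℤ | f 0 ≠ 0 ∧ ¬ CubicIrred f ∧
        (fun i => (f i : ℝ) / t) ∈ openRegion pos ε}.ncard : ℝ) := by
    have e : ((openLatticePoints pos ε t).filter fun f => ¬ CubicIrred f : Set (Fin 4 → ℤ)) =
        {f : Fin 4 → ℤ | f 0 ≠ 0 ∧ ¬ CubicIrred f ∧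
        (fun i => (f i : ℝ) / t) ∈ openRegion pos ε} := by
      ext f
      simp only [Finset.coe_filter, Set.mem_ofPred_eq, mem_openLatticePoints pos ε ht0]
      constructor
      · rintro ⟨h, h'⟩
        refine ⟨fun h0 => ?_, h', h⟩
        have := h.1
        simp only [h0, Int.cast_zero, zero_div] at this
        linarith
      · rintro ⟨-, h', h⟩
        exact ⟨h, h'⟩
    rw [← e, Set.ncard_coe_finset]
    calc _ ≤ ∑ f ∈ (openLatticePoints pos ε t).filter fun f => ¬ CubicIrred f, (C : ℝ) :=
          Finset.sum_le_sum fun f _ => by exact_mod_cast hC f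
      _ = _ := by rw [Finset.sum_const, nsmul_eq_mul, mul_comm]
  rw [← mul_div_assoc, ← sub_div]
  refine div_le_div_of_nonneg_right ?_ (by positivity)
  have h3 := Finset.sum_filter_add_sum_filter_not (openLatticePoints pos ε t) CubicIrred
    fun f => (torsionNumber m f : ℝ)
  have h4 : ∑ f ∈ openLatticePoints pos ε t with CubicIrred f, (torsionNumber m f : ℝ) ≤
    hF.torsionSum m (t ^ 4) := h1
  linarith

/-- The average of `torsionNumber m` over cubic forms. -/
theorem exists_tendsto_torsionSum (hF : IsFormSystem pos F) : ∃ V : ℝ, 0 < V ∧ ∀ m : ℕ, m ≠ 0 →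
    Tendsto (fun t : ℝ => hF.torsionSum m (t ^ 4) / t ^ 4) atTop (𝓝 (torsionMean m * V)) := by
  obtain ⟨V, hV0, hV⟩ := exists_tendsto_volume pos
  refine ⟨V, hV0, fun m hm => ?_⟩
  have : NeZero m := ⟨hm⟩
  obtain ⟨C, hC⟩ := exists_torsionNumber_le m
  have hpos : ∀ n : ℕ, (0 : ℝ) < 1 / ((n : ℝ) + 11) := fun n => by positivity
  have hle : ∀ n : ℕ, 1 / ((n : ℝ) + 11) ≤ 1 := fun n => by
    rw [div_le_one (by positivity)]
    linarith [(Nat.cast_nonneg n : (0 : ℝ) ≤ n)]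
  have h0 : Tendsto (fun n : ℕ => 1 / ((n : ℝ) + 11)) atTop (𝓝 0) :=
    Tendsto.div_atTop tendsto_const_nhds (tendsto_natCast_atTop_atTop.atTop_add tendsto_const_nhds)
  refine tendsto_of_eventually_le_le
    (fun n => (eventually_ge_atTop 1).mono fun t ht => hF.le_torsionSum m hC (hpos n) ht)
    (fun n => (eventually_ge_atTop 1).mono fun t ht => hF.torsionSum_le m hC (hpos n) (hle n) ht)
    (fun n => (tendsto_sum_openLatticePoints pos m (hpos n)).sub ((tendsto_card_reducible
      ((isBounded_closedRegion pos (hpos n)).subset (openRegion_subset pos _))).const_mul _))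
    (fun n => (tendsto_sum_closedLatticePoints pos m (hpos n)).add tendsto_const_nhds) ?_ ?_
  · simpa using hV.const_mul (torsionMean m)
  · have := (hV.const_mul (torsionMean m)).add
      ((((Real.continuous_sqrt.tendsto 0).comp h0).const_mul 140).const_mul (C : ℝ))
    simpa using this

end IsFormSystem

/-- The matrices stabilizing `f` under the twisted action. -/
def formStabilizer (f : Fin 4 → ℤ) : Set (ℤ × ℤ × ℤ × ℤ) :=
  {M | (M.1 * M.2.2.2 - M.2.1 * M.2.2.1) ^ 2 = 1 ∧
    (M.1 * M.2.2.2 - M.2.1 * M.2.2.1) • cubicSubst M.1 M.2.1 M.2.2.1 M.2.2.2 f = f}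

theorem IsFormBasis.isRoot {O : Type*} [CommRing O] {f : Fin 4 → ℤ} {w t : O}
    (h : IsFormBasis f w t) : (Cubic.toPoly ⟨1, -(f 1 : O), ((f 0 * f 2 : ℤ) : O),
      ((-(f 0 ^ 2 * f 3) : ℤ) : O)⟩).IsRoot w := by
  have h1 := h.ww
  have h2 := h.wt
  push_cast at h1 h2
  rw [Polynomial.IsRoot.def, Cubic.toPoly]
  simp
  linear_combination w * h1 - (f 0 : O) * h2

theorem formStabilizer_finite_and_ncard_le {f : Fin 4 → ℤ} (hf : CubicIrred f) :
    (formStabilizer f).Finite ∧ (formStabilizer f).ncard ≤ 3 := by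
  classical
  obtain ⟨w, t, h⟩ : ∃ w t : CubicRing f, IsFormBasis f w t := ⟨_, _, CubicRing.isFormBasis f⟩
  have := h.isDomain hf
  set P : Cubic (CubicRing f) := ⟨1, -(f 1 : CubicRing f), ((f 0 * f 2 : ℤ) : CubicRing f),
      ((-(f 0 ^ 2 * f 3) : ℤ) : CubicRing f)⟩ with hP
  have hP0 : P.toPoly ≠ 0 := Cubic.ne_zero_of_a_ne_zero (by simp [hP])
  have key : ∀ M ∈ formStabilizer f, ∃ n k : ℤ,
      IsFormBasis f ((n : CubicRing f) + M.1 * w + M.2.2.1 * t)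
        ((k : CubicRing f) + M.2.1 * w + M.2.2.2 * t) := by
    rintro M ⟨hd, hM⟩
    obtain ⟨n, k, h'⟩ := h.transform hd
    rw [hM] at h'
    exact ⟨n, k, h'⟩
  choose! n k hnk using key
  have hmaps : ∀ M ∈ formStabilizer f,
      (n M : CubicRing f) + M.1 * w + M.2.2.1 * t ∈ P.toPoly.roots.toFinset := by
    intro M hM
    rw [Multiset.mem_toFinset, Polynomial.mem_roots hP0]
    exact (hnk M hM).isRoot
  have hinj : Set.InjOn (fun M => (n M : CubicRing f) + M.1 * w + M.2.2.1 * t)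
      (formStabilizer f) := by
    intro M hM N hN e
    have e1 := (hnk M hM).wt
    have e2 := (hnk N hN).wt
    simp only at e
    rw [e, ← e2] at e1
    have e0 : (n N : CubicRing f) + N.1 * w + N.2.2.1 * t ≠ 0 := by
      intro h0
      have := (hnk N hN).ind 0 1 0 (by simpa using h0)
      omega
    have e3 := mul_left_cancel₀ e0 e1
    obtain ⟨-, h1, h2⟩ := h.ext_iff e
    obtain ⟨-, h3, h4⟩ := h.ext_iff e3
    exact Prod.ext h1 (Prod.ext h3 (Prod.ext h2 h4))
  constructor
  · exact Set.Finite.of_injOn (t := (P.toPoly.roots.toFinset : Set (CubicRing f)))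
      (fun M hM => hmaps M hM) hinj (Finset.finite_toSet _)
  · refine (Set.ncard_le_ncard_of_injOn (t := (P.toPoly.roots.toFinset : Set (CubicRing f))) _
      (fun M hM => hmaps M hM) hinj (Finset.finite_toSet _)).trans ?_
    rw [Set.ncard_coe_finset]
    refine (Multiset.toFinset_card_le _).trans ((Polynomial.card_roots' _).trans ?_)
    exact (Cubic.natDegree_of_a_ne_zero (by simp [hP])).le

theorem card_two_mul_eq_le (m : ℕ) [NeZero m] (c : ZMod m) :
    Nat.card {τ : ZMod m // 2 * τ = c} ≤ 2 := by
  classical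
  rcases isEmpty_or_nonempty {τ : ZMod m // 2 * τ = c} with h | ⟨σ, hσ⟩
  · simp
  have h1 := IsAddCyclic.card_nsmul_eq_zero_le (α := ZMod m) (n := 2) (by norm_num)
  rw [← Fintype.card_subtype, ← Nat.card_eq_fintype_card] at h1
  refine le_trans (Nat.card_le_card_of_injective
    (fun τ : {τ : ZMod m // 2 * τ = c} => (⟨τ.1 - σ, ?_⟩ : {x : ZMod m // 2 • x = 0})) ?_) h1
  · rw [nsmul_eq_mul, Nat.cast_ofNat, mul_sub, τ.2, hσ, sub_self]
  · intro x y h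
    exact Subtype.ext (sub_left_injective (congrArg Subtype.val h))

theorem torsionCount_le_two (m : ℕ) [NeZero m] (f : Fin 4 → ℤ) : torsionCount m f ≤ 2 := by
  refine le_trans (Nat.card_le_card_of_injective
    (fun τ : {τ : ZMod m // TorsionData f m τ.val} =>
      (⟨τ.1, ?_⟩ : {x : ZMod m // 2 * x = ((f 2 / m : ℤ) : ZMod m)})) ?_) (card_two_mul_eq_le m _)
  · obtain ⟨e, d, h2, -⟩ := τ.2
    have hm : (m : ℤ) ≠ 0 := by exact_mod_cast NeZero.ne m
    have : f 2 / m = 2 * (τ.1.val : ℤ) + m * e := by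
      rw [h2]
      refine Int.ediv_eq_of_eq_mul_right hm (by ring)
    rw [this]
    push_cast
    simp
  · intro x y h
    exact Subtype.ext (Subtype.ext_iff.1 h :)

/-- The number of nonzero zeros of a binary cubic form over a prime field. -/
theorem card_zeros_le {p : ℕ} [Fact p.Prime] {g : Fin 4 → ZMod p} (hg : g ≠ 0 ∨ p = 2) :
    Nat.card {x : Fin 2 → ZMod p | x ≠ 0 ∧ cubicEval g (x 0) (x 1) = 0} ≤ 4 * (p - 1) := by
  classical
  rw [Nat.card_coe_set_eq]
  by_cases hg0 : g = 0
  · obtain rfl := hg.resolve_left (not_not.2 hg0)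
    refine (Set.ncard_le_ncard (t := {0}ᶜ) (fun x hx => hx.1)).trans ?_
    have := Set.ncard_add_ncard_compl ({0} : Set (Fin 2 → ZMod 2))
    rw [Set.ncard_singleton, Nat.card_eq_fintype_card] at this
    simp at this
    omega
  set P : Cubic (ZMod p) := ⟨g 0, g 1, g 2, g 3⟩ with hP
  have hP0 : P.toPoly ≠ 0 := by
    intro h
    have hP' : P = 0 := (Cubic.toPoly_eq_zero_iff P).1 h
    refine hg0 (cubicForm_ext ?_ ?_ ?_ ?_)
    · exact congrArg Cubic.a hP'
    · exact congrArg Cubic.b hP'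
    · exact congrArg Cubic.c hP'
    · exact congrArg Cubic.d hP'
  let φ : Option (ZMod p) × ZMod p → Fin 2 → ZMod p := fun u =>
    u.1.elim ![u.2, 0] fun z => ![z * u.2, u.2]
  let T : Finset (Option (ZMod p) × ZMod p) :=
    Finset.insertNone P.toPoly.roots.toFinset ×ˢ Finset.univ.erase 0
  have hT : T.card ≤ 4 * (p - 1) := by
    rw [Finset.card_product, Finset.card_insertNone, Finset.card_erase_of_mem (Finset.mem_univ _),
      Finset.card_univ, ZMod.card]
    refine Nat.mul_le_mul_right _ (Nat.succ_le_succ ?_)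
    refine (Multiset.toFinset_card_le _).trans ((Polynomial.card_roots' _).trans ?_)
    exact Polynomial.natDegree_cubic_le
  refine le_trans ?_ (Finset.card_image_le.trans hT : (T.image φ).card ≤ _)
  rw [← Set.ncard_coe_finset]
  refine Set.ncard_le_ncard ?_ (Finset.finite_toSet _)
  rintro x ⟨hx0, hx⟩
  rw [Finset.mem_coe, Finset.mem_image]
  by_cases h1 : x 1 = 0
  · refine ⟨(none, x 0), ?_, ?_⟩
    · simp only [T, Finset.mem_product, Finset.none_mem_insertNone, Finset.mem_erase,
      Finset.mem_univ,
        and_true, true_and]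
      intro h0
      exact hx0 (by ext i; fin_cases i <;> assumption)
    · ext i
      fin_cases i <;> simp [φ, h1]
  · refine ⟨(some (x 0 / x 1), x 1), ?_, ?_⟩
    · simp only [T, Finset.mem_product, Finset.some_mem_insertNone, Finset.mem_erase,
        Finset.mem_univ, and_true, Multiset.mem_toFinset]
      refine ⟨?_, h1⟩
      rw [Polynomial.mem_roots hP0, Polynomial.IsRoot.def, Cubic.toPoly]
      simp only [cubicEval] at hx
      simp [hP]
      field_simp
      linear_combination hx
    · ext i
      fin_cases i <;> simp [φ, h1]

/-- The form of the overring attached to a `2`-torsion ideal with parameters `f`, `m`. -/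
def overForm (m : ℤ) (f : Fin 4 → ℤ) : Fin 4 → ℤ := ![m * f 0, f 1, f 2 / m, f 3 / m ^ 2]

theorem TorsionData.subst_overForm {f : Fin 4 → ℤ} {m τ : ℤ} (h : TorsionData f m τ) (hm : m ≠ 0) :
    cubicSubst 1 0 0 m (overForm m f) = m • f := by
  obtain ⟨e, d, h2, h3, -⟩ := h
  have e2 : f 2 / m = 2 * τ + m * e := Int.ediv_eq_of_eq_mul_right hm (by rw [h2]; ring)
  have e3 : f 3 / m ^ 2 = d := Int.ediv_eq_of_eq_mul_right (pow_ne_zero 2 hm) h3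
  apply cubicForm_ext <;>
  simp only [cubicSubst_zero, cubicSubst_one, cubicSubst_two, cubicSubst_three, overForm,
    Matrix.cons_val, Pi.smul_apply, smul_eq_mul, e2, e3]
  · ring
  · ring
  · rw [h2]; ring
  · rw [h3]; ring

theorem TorsionData.sq_mul_disc_overForm {f : Fin 4 → ℤ} {m τ : ℤ} (h : TorsionData f m τ)
    (hm : m ≠ 0) : m ^ 2 * cubicDisc (overForm m f) = cubicDisc f := by
  have e := congrArg cubicDisc (h.subst_overForm hm)
  rw [cubicDisc_subst, cubicDisc_smul] at e
  refine mul_left_cancel₀ (pow_ne_zero 4 hm) ?_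
  linear_combination e

theorem TorsionData.cubicIrred_overForm {f : Fin 4 → ℤ} {m τ : ℤ} (h : TorsionData f m τ)
    (hm : m ≠ 0) (hf : CubicIrred f) : CubicIrred (overForm m f) := by
  intro x y hxy
  have e := congrArg (fun g => cubicEval g (m * x) y) (h.subst_overForm hm)
  rw [cubicEval_subst, cubicEval_smul] at e
  have h0 : cubicEval (overForm m f) (1 * (m * x) + 0 * y) (0 * (m * x) + m * y) =
      m ^ 3 * cubicEval (overForm m f) x y := by
    simp only [cubicEval]; ring
  rw [h0, hxy, mul_zero, eq_comm, mul_eq_zero] at e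
  obtain ⟨h1, h2⟩ := hf _ _ (e.resolve_left hm)
  exact ⟨(mul_eq_zero.1 h1).resolve_left hm, h2⟩

theorem TorsionData.eq_two_of_dvd_overForm {f : Fin 4 → ℤ} {m τ : ℤ} (h : TorsionData f m τ)
    (hm : m ≠ 0) {p : ℕ} (hp : p.Prime) (hpm : (p : ℤ) ∣ m) (hd : ∀ i, (p : ℤ) ∣ overForm m f i) :
    p = 2 := by
  obtain ⟨e, d, h2, h3, hco⟩ := h
  have e2 : f 2 / m = 2 * τ + m * e := Int.ediv_eq_of_eq_mul_right hm (by rw [h2]; ring)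
  have e3 : f 3 / m ^ 2 = d := Int.ediv_eq_of_eq_mul_right (pow_ne_zero 2 hm) h3
  have d1 := hd 1
  have d2 := hd 2
  have d3 := hd 3
  have hp' := Nat.prime_iff_prime_int.1 hp
  simp only [overForm, Matrix.cons_val, e2, e3] at d1 d2 d3
  rcases hp'.dvd_or_dvd ((Int.dvd_add_left (hpm.mul_right e)).1 d2) with h4 | h4
  · exact (Nat.prime_dvd_prime_iff_eq hp Nat.prime_two).1 (by exact_mod_cast h4)
  · exact absurd (hco.isUnit_of_dvd' (dvd_sub (dvd_pow h4 two_ne_zero) (d1.mul_right d)) hpm)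
      hp'.not_isUnit

/-- Overrings with congruent distinguished vectors come from equivalent forms. -/
theorem exists_matrix_of_overForm {m : ℤ} (hm : m ≠ 0) {f₁ f₂ h₁ h₂ g : Fin 4 → ℤ}
    (e₁ : cubicSubst 1 0 0 m h₁ = m • f₁) (e₂ : cubicSubst 1 0 0 m h₂ = m • f₂)
    {p₁ q₁ r₁ s₁ p₂ q₂ r₂ s₂ : ℤ} (d₁ : (p₁ * s₁ - q₁ * r₁) ^ 2 = 1)
    (d₂ : (p₂ * s₂ - q₂ * r₂) ^ 2 = 1)
    (hh₁ : h₁ = (p₁ * s₁ - q₁ * r₁) • cubicSubst p₁ q₁ r₁ s₁ g)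
    (hh₂ : h₂ = (p₂ * s₂ - q₂ * r₂) • cubicSubst p₂ q₂ r₂ s₂ g)
    (hp : m ∣ p₂ - p₁) (hr : m ∣ r₂ - r₁) :
    ∃ a b c d : ℤ, (a * d - b * c) ^ 2 = 1 ∧ f₂ = (a * d - b * c) • cubicSubst a b c d f₁ ∧
      m ∣ b ∧ m ∣ d - (a * d - b * c) := by
  obtain ⟨u, hu⟩ := hp
  obtain ⟨v, hv⟩ := hr
  obtain rfl : p₂ = p₁ + m * u := by linear_combination hu
  obtain rfl : r₂ = r₁ + m * v := by linear_combination hv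
  obtain ⟨D, hD⟩ : ∃ D, D = p₁ * s₁ - q₁ * r₁ := ⟨_, rfl⟩
  obtain ⟨E, hE⟩ : ∃ E, E = (p₁ + m * u) * s₂ - q₂ * (r₁ + m * v) := ⟨_, rfl⟩
  rw [← hD] at d₁ hh₁
  rw [← hE] at d₂ hh₂
  have hdet : (1 + D * m * (s₁ * u - q₁ * v)) * (D * (p₁ * s₂ - r₁ * q₂)) -
      m * (D * (s₁ * q₂ - q₁ * s₂)) * (D * (p₁ * v - r₁ * u)) = D * E := by
    linear_combination D * ((u * s₂ - q₂ * v) * m * d₁ - D * (u * s₂ - q₂ * v) * m * hD - hE)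
  refine ⟨1 + D * m * (s₁ * u - q₁ * v), m * (D * (s₁ * q₂ - q₁ * s₂)),
    D * (p₁ * v - r₁ * u), D * (p₁ * s₂ - r₁ * q₂), ?_, ?_, Dvd.intro _ rfl, ?_⟩
  · rw [hdet]
    linear_combination E ^ 2 * d₁ + d₂
  · rw [hdet]
    have hinj : Function.Injective fun f : Fin 4 → ℤ => m • f := smul_right_injective _ hm
    refine hinj ?_
    simp only
    rw [smul_comm m, ← cubicSubst_smul, ← e₁, ← e₂, hh₁, hh₂, cubicSubst_smul, cubicSubst_subst,
      cubicSubst_smul, cubicSubst_smul, cubicSubst_subst, cubicSubst_subst, smul_smul]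
    have hs : D * E * D = E := by linear_combination E * d₁
    rw [hs]
    congr 1
    congr 1
    · linear_combination -m * u * (d₁ - D * hD)
    · linear_combination -m * q₂ * (d₁ - D * hD)
    · linear_combination -m * v * (d₁ - D * hD)
    · linear_combination -m * s₂ * (d₁ - D * hD)
  · refine ⟨D * (s₁ * q₂ - q₁ * s₂) * (D * (p₁ * v - r₁ * u)) -
      D * (s₁ * u - q₁ * v) * (D * (p₁ * s₂ - r₁ * q₂)), by ring⟩

/-- A matrix relating two transforms of `g` yields a stabilizing matrix of `g`. -/
theorem exists_formStabilizer {m : ℤ} {f₁ f₂ g : Fin 4 → ℤ} {p₁ q₁ r₁ s₁ p₂ q₂ r₂ s₂ : ℤ}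
    (d₁ : p₁ * s₁ - q₁ * r₁ = 1) (d₂ : p₂ * s₂ - q₂ * r₂ = 1)
    (hf₁ : f₁ = cubicSubst p₁ q₁ r₁ s₁ g) (hf₂ : f₂ = cubicSubst p₂ q₂ r₂ s₂ g) {a b c d : ℤ}
    (hd : (a * d - b * c) ^ 2 = 1) (h : f₂ = (a * d - b * c) • cubicSubst a b c d f₁)
    (hb : m ∣ b) (hdd : m ∣ d - (a * d - b * c)) :
    ∃ M ∈ formStabilizer g, m ∣ q₂ - (M.2.2.2 * q₁ - M.2.1 * s₁) ∧
      m ∣ s₂ - (M.1 * s₁ - M.2.2.1 * q₁) := by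
  obtain ⟨D, hD⟩ : ∃ D, D = a * d - b * c := ⟨_, rfl⟩
  rw [← hD] at hd h hdd
  obtain ⟨A, hA⟩ : ∃ A, A = (p₁ * a + q₁ * c) * s₂ - (p₁ * b + q₁ * d) * r₂ := ⟨_, rfl⟩
  obtain ⟨B, hB⟩ : ∃ B, B = -(p₁ * a + q₁ * c) * q₂ + (p₁ * b + q₁ * d) * p₂ := ⟨_, rfl⟩
  obtain ⟨C, hC⟩ : ∃ C, C = (r₁ * a + s₁ * c) * s₂ - (r₁ * b + s₁ * d) * r₂ := ⟨_, rfl⟩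
  obtain ⟨E, hE⟩ : ∃ E, E = -(r₁ * a + s₁ * c) * q₂ + (r₁ * b + s₁ * d) * p₂ := ⟨_, rfl⟩
  have hdet : A * E - B * C = D := by
    rw [hA, hB, hC, hE]
    linear_combination (a * d - b * c) * (p₂ * s₂ - q₂ * r₂) * d₁ + (a * d - b * c) * d₂ - hD
  have hq : A * q₂ + B * s₂ = p₁ * b + q₁ * d := by
    rw [hA, hB]; linear_combination (p₁ * b + q₁ * d) * d₂
  have hs : C * q₂ + E * s₂ = r₁ * b + s₁ * d := by
    rw [hC, hE]; linear_combination (r₁ * b + s₁ * d) * d₂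
  refine ⟨(A, B, C, E), ⟨?_, ?_⟩, ?_, ?_⟩
  · simp only [hdet, hd]
  · simp only [hdet]
    have e := congrArg (cubicSubst s₂ (-q₂) (-r₂) p₂) h
    rw [hf₁, hf₂, cubicSubst_smul, cubicSubst_subst, cubicSubst_subst, cubicSubst_subst] at e
    have i1 : p₂ * s₂ + q₂ * -r₂ = 1 := by linear_combination d₂
    have i2 : p₂ * -q₂ + q₂ * p₂ = 0 := by ring
    have i3 : r₂ * s₂ + s₂ * -r₂ = 0 := by ring
    have i4 : r₂ * -q₂ + s₂ * p₂ = 1 := by linear_combination d₂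
    rw [i1, i2, i3, i4, cubicSubst_id] at e
    refine Eq.trans ?_ e.symm
    rw [hA, hB, hC, hE]
    congr 2 <;> ring
  · obtain ⟨x, hx⟩ := hb
    obtain ⟨y, hy⟩ := hdd
    refine ⟨D * ((E * p₁ - B * r₁) * x + (E * q₁ - B * s₁) * y), ?_⟩
    linear_combination -(q₂ - (E * q₁ - B * s₁)) * hd + D * (E * hq - B * hs - q₂ * hdet) +
      D * (E * p₁ - B * r₁) * hx + D * (E * q₁ - B * s₁) * hy
  · obtain ⟨x, hx⟩ := hb
    obtain ⟨y, hy⟩ := hdd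
    refine ⟨D * ((A * r₁ - C * p₁) * x + (A * s₁ - C * q₁) * y), ?_⟩
    linear_combination -(s₂ - (A * s₁ - C * q₁)) * hd + D * (A * hs - C * hq - s₂ * hdet) +
      D * (A * r₁ - C * p₁) * hx + D * (A * s₁ - C * q₁) * hy

/-- The nonzero zeros modulo `m` of a form that vanishes modulo no odd prime divisor of `m`. -/
theorem card_unimodular_zeros_le (m : ℕ) [NeZero m] {g : Fin 4 → ℤ}
    (hg : ∀ p ∈ m.primeFactors, (∀ i, (p : ℤ) ∣ g i) → p = 2) :
    (Nat.card {v : UnimodularVec m // cubicEval (fun i => (g i : ZMod m)) v.1.1 v.1.2 = 0} : ℝ) ≤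
      (∏ p ∈ m.primeFactors, (4 * ((p : ℝ) - 1) / p ^ 2)) * m ^ 2 := by
  let B : ∀ p : ℕ, Set (Fin 2 → ZMod p) := fun p =>
    {x | x ≠ 0 ∧ cubicEval (fun i => (g i : ZMod p)) (x 0) (x 1) = 0}
  have h1 := card_zmod_local (Fin 2) m B
  rw [Fintype.card_fin] at h1
  have h2 : Nat.card {v : UnimodularVec m // cubicEval (fun i => (g i : ZMod m)) v.1.1 v.1.2 = 0} ≤
      Nat.card {v : Fin 2 → ZMod m // ∀ p ∈ m.primeFactors,
        (fun i => ((v i).cast : ZMod p)) ∈ B p} := by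
    refine Nat.card_le_card_of_injective (fun v => ⟨![v.1.1.1, v.1.1.2], ?_⟩) ?_
    · intro p hp
      have hpm := Nat.dvd_of_mem_primeFactors hp
      constructor
      · intro h0
        refine (isCoprime_zmod_iff _ _).1 v.1.2 p hp ?_
        exact Prod.ext (congrFun h0 0) (congrFun h0 1)
      · have := congrArg (ZMod.castHom hpm (ZMod p)) v.2
        rw [← cubicEval_map, map_zero] at this
        simpa using this
    · intro x y hxy
      have h := Subtype.ext_iff.1 hxy
      exact Subtype.ext (Subtype.ext (Prod.ext (congrFun h 0) (congrFun h 1)))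
  have h3 : ∏ p ∈ m.primeFactors, Nat.card (B p) ≤ ∏ p ∈ m.primeFactors, 4 * (p - 1) := by
    refine Finset.prod_le_prod' fun p hp => ?_
    have : Fact p.Prime := ⟨Nat.prime_of_mem_primeFactors hp⟩
    refine card_zeros_le ?_
    by_contra! hne
    refine hne.2 (hg p hp fun i => ?_)
    rw [← ZMod.intCast_zmod_eq_zero_iff_dvd]
    exact congrFun hne.1 i
  have h4 : (∏ p ∈ m.primeFactors, (4 * ((p : ℝ) - 1) / p ^ 2)) =
      ((∏ p ∈ m.primeFactors, 4 * (p - 1) : ℕ) : ℝ) / ((∏ p ∈ m.primeFactors, p ^ 2 : ℕ) : ℝ) := by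
    push_cast
    rw [← Finset.prod_div_distrib]
    refine Finset.prod_congr rfl fun p hp => ?_
    rw [Nat.cast_sub (Nat.prime_of_mem_primeFactors hp).one_le, Nat.cast_one]
  have h5 : 0 < ∏ p ∈ m.primeFactors, p ^ 2 :=
    Finset.prod_pos fun p hp => pow_pos (Nat.prime_of_mem_primeFactors hp).pos 2
  rw [h4, div_mul_eq_mul_div, le_div_iff₀ (by exact_mod_cast h5)]
  exact_mod_cast (Nat.mul_le_mul_right _ h2).trans (h1.le.trans (Nat.mul_le_mul_right _ h3))

namespace IsFormSystem

variable {ι : Type*} {pos : Bool} {F : ι → Fin 4 → ℤ}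

theorem card_indices_le_mul (hF : IsFormSystem pos F) {X : ℝ} (hX : 0 ≤ X) :
    ((hF.indices X).card : ℝ) ≤ 140 * X := by
  rcases le_total X 1 with h | h
  · have : hF.indices X = ∅ := by
      refine Finset.eq_empty_of_forall_notMem fun i hi => ?_
      have h1 := (hF.mem_indices.1 hi).trans_le h
      have h2 := hF.disc_pos i
      rcases discSign_eq_or pos with e | e <;> rw [e] at h1 h2
      · rw [one_mul] at h1 h2
        norm_cast at h1 h2
        omega
      · have h3 : ((-cubicDisc (F i) : ℤ) : ℝ) < 1 := by push_cast; linarith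
        have h4 : (0 : ℝ) < ((-cubicDisc (F i) : ℤ) : ℝ) := by push_cast; linarith
        norm_cast at h3 h4
        omega
    rw [this]
    simpa using hX
  · have h1 := hF.card_indices_le (t := X ^ ((1 : ℝ) / 4)) (Real.one_le_rpow h (by norm_num))
    have h2 : (X ^ ((1 : ℝ) / 4)) ^ 4 = X := by
      rw [← Real.rpow_natCast, ← Real.rpow_mul hX]; norm_num
    rwa [h2] at h1

open Classical in
theorem card_overForm_le (hF : IsFormSystem pos F) (m : ℕ) [NeZero m] (X : ℝ) :
    ((((hF.indices X) ×ˢ (Finset.univ : Finset (UnimodularVec m))).filter fun x =>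
      ∃ τ : ℤ, TorsionData (unimodularSubst x.2 (F x.1)) m τ).card : ℝ) ≤
    3 * ((hF.indices (X / m ^ 2)).card *
      ((∏ p ∈ m.primeFactors, (4 * ((p : ℝ) - 1) / p ^ 2)) * m ^ 2)) := by
  have hm : (m : ℤ) ≠ 0 := by exact_mod_cast NeZero.ne m
  have hmR : (0 : ℝ) < m := by exact_mod_cast NeZero.pos m
  set P := ((hF.indices X) ×ˢ (Finset.univ : Finset (UnimodularVec m))).filter fun x =>
      ∃ τ : ℤ, TorsionData (unimodularSubst x.2 (F x.1)) m τ with hP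
  let G : ι × UnimodularVec m → Fin 4 → ℤ := fun x => unimodularSubst x.2 (F x.1)
  have hequiv : ∀ x, CubicEquiv (F x.1) (G x) := fun x =>
    ⟨_, _, _, _, by rw [(exists_matrix_of_isCoprime x.2.2).choose_spec.1]; norm_num,
      by rw [(exists_matrix_of_isCoprime x.2.2).choose_spec.1, one_smul]; rfl⟩
  have key : ∀ x ∈ P, ∃ (j : ι) (p q r s : ℤ), (p * s - q * r) ^ 2 = 1 ∧
      overForm m (G x) = (p * s - q * r) • cubicSubst p q r s (F j) := by
    intro x hx
    obtain ⟨-, τ, hτ⟩ := Finset.mem_filter.1 hx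
    have hd := hτ.sq_mul_disc_overForm hm
    have hd' : ((m : ℝ) ^ 2 * cubicDisc (overForm m (G x))) = cubicDisc (G x) := by
      exact_mod_cast hd
    obtain ⟨j, hj, -⟩ := hF.existsUnique (overForm m (G x))
      (hτ.cubicIrred_overForm hm ((hequiv x).cubicIrred (hF.irred x.1))) (by
        have h1 := hF.disc_pos x.1
        rw [← (hequiv x).disc_eq, ← hd'] at h1
        refine pos_of_mul_pos_right (a := (m : ℝ) ^ 2) ?_ (by positivity)
        linarith)
    exact ⟨j, hj.symm⟩
  rcases isEmpty_or_nonempty ι with hι | hι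
  · have : P = ∅ := Finset.eq_empty_of_isEmpty P
    rw [this, Finset.card_empty, Nat.cast_zero]
    have : 0 ≤ ∏ p ∈ m.primeFactors, (4 * ((p : ℝ) - 1) / p ^ 2) :=
      Finset.prod_nonneg fun p hp => by
        have : (1 : ℝ) ≤ p := by exact_mod_cast (Nat.prime_of_mem_primeFactors hp).one_le
        have : 0 ≤ (p : ℝ) - 1 := by linarith
        positivity
    positivity
  choose! j p q r s hdet hover using key
  let Φ : ι × UnimodularVec m → ι × (ZMod m × ZMod m) := fun x => (j x, (p x, r x))
  let T : Finset (ι × (ZMod m × ZMod m)) :=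
    (((hF.indices (X / m ^ 2)).filter fun j => ∀ p ∈ m.primeFactors,
      (∀ i, (p : ℤ) ∣ F j i) → p = 2) ×ˢ Finset.univ).filter fun y =>
        IsCoprime y.2.1 y.2.2 ∧ cubicEval (fun i => (F y.1 i : ZMod m)) y.2.1 y.2.2 = 0
  have hT : (T.card : ℝ) ≤ (hF.indices (X / m ^ 2)).card *
      ((∏ p ∈ m.primeFactors, (4 * ((p : ℝ) - 1) / p ^ 2)) * m ^ 2) := by
    have hW : 0 ≤ (∏ p ∈ m.primeFactors, (4 * ((p : ℝ) - 1) / p ^ 2)) * (m : ℝ) ^ 2 :=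
      mul_nonneg (Finset.prod_nonneg fun p hp => by
        have : (1 : ℝ) ≤ p := by exact_mod_cast (Nat.prime_of_mem_primeFactors hp).one_le
        have : 0 ≤ (p : ℝ) - 1 := by linarith
        positivity) (by positivity)
    rw [Finset.card_filter, Finset.sum_product, Nat.cast_sum]
    refine (Finset.sum_le_card_nsmul _ _
      ((∏ p ∈ m.primeFactors, (4 * ((p : ℝ) - 1) / p ^ 2)) * (m : ℝ) ^ 2) fun j hj => ?_).trans ?_
    · refine le_trans (le_of_eq ?_) (card_unimodular_zeros_le m (Finset.mem_filter.1 hj).2)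
      rw [← Finset.card_filter, ← Fintype.card_subtype, ← Nat.card_eq_fintype_card]
      exact congrArg _ (Nat.card_congr (Equiv.subtypeSubtypeEquivSubtypeInter _
        fun v : ZMod m × ZMod m => cubicEval (fun i => (F j i : ZMod m)) v.1 v.2 = 0).symm)
    · rw [nsmul_eq_mul]
      refine mul_le_mul_of_nonneg_right ?_ hW
      exact_mod_cast Finset.card_filter_le _ _
  have hdisc : ∀ x ∈ P, cubicDisc (F x.1) = m ^ 2 * cubicDisc (F (j x)) := by
    intro x hx
    obtain ⟨-, τ, hτ⟩ := Finset.mem_filter.1 hx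
    rw [← (hequiv x).disc_eq, ← hτ.sq_mul_disc_overForm hm]
    exact congrArg _ (CubicEquiv.disc_eq ⟨_, _, _, _, hdet x hx, hover x hx⟩)
  have hmaps : ∀ x ∈ P, Φ x ∈ T := by
    intro x hx
    obtain ⟨hx1, τ, hτ⟩ := Finset.mem_filter.1 hx
    have hd := hdet x hx
    have ho := hover x hx
    refine Finset.mem_filter.2 ⟨Finset.mem_product.2 ⟨Finset.mem_filter.2 ⟨?_, ?_⟩,
      Finset.mem_univ _⟩, ?_, ?_⟩
    · have h2 := hF.mem_indices.1 (Finset.mem_product.1 hx1).1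
      rw [hdisc x hx] at h2
      rw [hF.mem_indices, lt_div_iff₀ (by positivity)]
      push_cast at h2
      linarith
    · intro ℓ hℓ hdvd
      refine hτ.eq_two_of_dvd_overForm hm (Nat.prime_of_mem_primeFactors hℓ)
        (by exact_mod_cast Nat.dvd_of_mem_primeFactors hℓ) fun i => ?_
      change (ℓ : ℤ) ∣ overForm m (G x) i
      rw [ho]
      have h3 := dvd_cubicSubst_sub (f := F (j x)) (g := 0) (M := ℓ) (by simpa using hdvd)
        (p x) (q x) (r x) (s x) i
      have h4 : cubicSubst (p x) (q x) (r x) (s x) (0 : Fin 4 → ℤ) i = 0 := by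
        fin_cases i <;> simp [cubicSubst]
      rw [h4, sub_zero] at h3
      exact h3.mul_left _
    · have h3 := congrArg (fun z : ℤ => (z : ZMod m)) hd
      push_cast at h3
      refine ⟨(p x * s x - q x * r x) * s x, -(p x * s x - q x * r x) * q x, ?_⟩
      linear_combination h3
    · have h3 := congrArg (fun z : ℤ => (z : ZMod m)) hd
      have h4 := congrArg (fun z : ℤ => (z : ZMod m)) (congrFun ho 0)
      simp only [overForm, Matrix.cons_val, Pi.smul_apply, smul_eq_mul, cubicSubst_zero] at h4
      push_cast at h3 h4
      rw [ZMod.natCast_self, zero_mul] at h4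
      simp only [Φ, cubicEval]
      linear_combination -(p x * s x - q x * r x : ZMod m) * h4 -
        ((F (j x) 0) * (p x) ^ 3 + (F (j x) 1) * (p x) ^ 2 * (r x) +
          (F (j x) 2) * (p x) * (r x) ^ 2 +
          (F (j x) 3) * (r x) ^ 3 : ZMod m) * h3
  have hfib : ∀ y ∈ T, (P.filter fun x => Φ x = y).card ≤ 3 := by
    intro y _
    rcases (P.filter fun x => Φ x = y).eq_empty_or_nonempty with he | ⟨x₁, hx₁⟩
    · rw [he]; simp
    obtain ⟨hx₁, hy₁⟩ := Finset.mem_filter.1 hx₁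
    obtain ⟨-, τ₁, hτ₁⟩ := Finset.mem_filter.1 hx₁
    obtain ⟨hfin, hcard⟩ := formStabilizer_finite_and_ncard_le (hF.irred x₁.1)
    obtain ⟨d₁, v₁⟩ := (exists_matrix_of_isCoprime x₁.2.2).choose_spec
    set M₁ := (exists_matrix_of_isCoprime x₁.2.2).choose with hM₁
    let ψ : ℤ × ℤ × ℤ × ℤ → ι × (ZMod m × ZMod m) := fun M =>
      (x₁.1, ((M.2.2.2 * M₁.2.1 - M.2.1 * M₁.2.2.2 : ℤ) : ZMod m),
        ((M.1 * M₁.2.2.2 - M.2.2.1 * M₁.2.1 : ℤ) : ZMod m))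
    have hinj : Function.Injective fun x : ι × UnimodularVec m => (x.1, x.2.1) := by
      rintro ⟨i, v⟩ ⟨i', v'⟩ h
      obtain ⟨h1, h2⟩ := Prod.ext_iff.1 h
      exact Prod.ext h1 (Subtype.ext h2)
    refine le_trans ?_ ((Set.ncard_image_le hfin (f := ψ)).trans hcard)
    rw [← Set.ncard_coe_finset, ← Set.ncard_image_of_injective _ hinj]
    refine Set.ncard_le_ncard ?_ (hfin.image ψ)
    rintro _ ⟨x₂, hx₂, rfl⟩
    obtain ⟨hx₂, hy₂⟩ := Finset.mem_filter.1 (Finset.mem_coe.1 hx₂)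
    obtain ⟨-, τ₂, hτ₂⟩ := Finset.mem_filter.1 hx₂
    obtain ⟨d₂, v₂⟩ := (exists_matrix_of_isCoprime x₂.2.2).choose_spec
    obtain ⟨hj, hpr⟩ := Prod.ext_iff.1 (hy₂.trans hy₁.symm)
    obtain ⟨hp, hr⟩ := Prod.ext_iff.1 hpr
    simp only [Φ] at hj hp hr
    rw [eq_comm, ZMod.intCast_eq_intCast_iff_dvd_sub] at hp hr
    have ho₂ := hover x₂ hx₂
    rw [hj] at ho₂
    obtain ⟨a, b, c, d, hd, hG, hb, hdd⟩ := exists_matrix_of_overForm hm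
      (hτ₁.subst_overForm hm) (hτ₂.subst_overForm hm) (hdet x₁ hx₁) (hdet x₂ hx₂)
      (hover x₁ hx₁) ho₂ hp hr
    have hi : x₂.1 = x₁.1 := (hF.existsUnique (F x₁.1) (hF.irred _) (hF.disc_pos _)).unique
      (((hequiv x₁).trans ⟨a, b, c, d, hd, hG⟩).trans (hequiv x₂).symm) (CubicEquiv.refl _)
    have hG₂ : G x₂ = cubicSubst _ _ _ _ (F x₂.1) := rfl
    rw [hi] at hG₂
    obtain ⟨M, hM, hq, hs⟩ := exists_formStabilizer d₁ d₂ rfl hG₂ hd hG hb hdd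
    refine ⟨M, hM, Prod.ext hi.symm ?_⟩
    refine Eq.trans ?_ v₂
    exact Prod.ext ((ZMod.intCast_eq_intCast_iff_dvd_sub _ _ _).2 hq)
      ((ZMod.intCast_eq_intCast_iff_dvd_sub _ _ _).2 hs)
  have h1 := Finset.card_le_mul_card_image_of_maps_to hmaps 3 hfib
  calc (P.card : ℝ) ≤ 3 * T.card := by exact_mod_cast h1
    _ ≤ _ := by gcongr

theorem torsionSum_le_tailWeight (hF : IsFormSystem pos F) (m : ℕ) [NeZero m] {X : ℝ} (hX : 0 ≤ X) :
    hF.torsionSum m X ≤ 840 * X * tailWeight 4 m := by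
  classical
  have hmR : (0 : ℝ) < m := by exact_mod_cast NeZero.pos m
  have hpp : ∀ p ∈ m.primeFactors, (1 : ℝ) < p := fun p hp => by
    exact_mod_cast (Nat.prime_of_mem_primeFactors hp).one_lt
  have h1 : (m.totient : ℝ) * hF.torsionSum m X ≤
      2 * ((((hF.indices X) ×ˢ (Finset.univ : Finset (UnimodularVec m))).filter fun x =>
        ∃ τ : ℤ, TorsionData (unimodularSubst x.2 (F x.1)) m τ).card : ℝ) := by
    have h2 : m.totient * ∑ i ∈ hF.indices X, torsionNumber m (F i) ≤
        2 * (((hF.indices X) ×ˢ (Finset.univ : Finset (UnimodularVec m))).filter fun x =>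
        ∃ τ : ℤ, TorsionData (unimodularSubst x.2 (F x.1)) m τ).card := by
      simp only [Finset.mul_sum, totient_mul_torsionNumber]
      rw [← Finset.sum_product', mul_comm 2, ← smul_eq_mul, ← Finset.sum_const, Finset.sum_filter]
      refine Finset.sum_le_sum fun x _ => ?_
      split_ifs with h
      · exact torsionCount_le_two m _
      · rw [torsionCount, Nat.le_zero, Nat.card_eq_zero]
        exact Or.inl ⟨fun τ => h ⟨_, τ.2⟩⟩
    rw [torsionSum]
    exact_mod_cast h2
  have h2 := hF.card_overForm_le m X
  have h3 := hF.card_indices_le_mul (X := X / m ^ 2) (by positivity)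
  have h4 : (m.totient : ℝ) = m * ∏ p ∈ m.primeFactors, (1 - (p : ℝ)⁻¹) := by
    have := congrArg (fun x : ℚ => (x : ℝ)) (Nat.totient_eq_mul_prod_factors m)
    push_cast at this
    exact this
  have h5 : ∏ p ∈ m.primeFactors, (4 * ((p : ℝ) - 1) / p ^ 2) =
      (∏ p ∈ m.primeFactors, ((4 : ℝ) / p)) * ∏ p ∈ m.primeFactors, (1 - (p : ℝ)⁻¹) := by
    rw [← Finset.prod_mul_distrib]
    refine Finset.prod_congr rfl fun p hp => ?_
    have := hpp p hp
    field_simp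
  have hA : 0 < ∏ p ∈ m.primeFactors, (1 - (p : ℝ)⁻¹) :=
    Finset.prod_pos fun p hp => sub_pos.2 (inv_lt_one_of_one_lt₀ (hpp p hp))
  have hB : 0 ≤ ∏ p ∈ m.primeFactors, ((4 : ℝ) / p) :=
    Finset.prod_nonneg fun p _ => by positivity
  rw [h4] at h1
  rw [h5] at h2
  rw [tailWeight]
  set A := ∏ p ∈ m.primeFactors, (1 - (p : ℝ)⁻¹)
  set B := ∏ p ∈ m.primeFactors, ((4 : ℝ) / p)
  refine le_of_mul_le_mul_left ?_ (mul_pos hmR hA)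
  calc m * A * hF.torsionSum m X ≤
      2 * (3 * ((hF.indices (X / m ^ 2)).card * (B * A * m ^ 2))) := h1.trans (by gcongr)
    _ ≤ 2 * (3 * (140 * (X / m ^ 2) * (B * A * m ^ 2))) := by gcongr
    _ = m * A * (840 * X * (B * (m : ℝ)⁻¹)) := by
      field_simp
      ring

end IsFormSystem

theorem torsionNumber_zero (f : Fin 4 → ℤ) : torsionNumber 0 f = 0 := by
  rw [torsionNumber, Nat.card_eq_zero]
  exact Or.inl ⟨fun J => J.2.1.ne' rfl⟩

theorem IsFormBasis.hasSum_torsionNumber {O : Type*} [CommRing O] [IsDomain O] [Module.Finite ℤ O]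
    {f : Fin 4 → ℤ} {w t : O} (h : IsFormBasis f w t) (hf : cubicDisc f ≠ 0) :
    HasSum (fun m => (torsionNumber m f : ℝ)) (idealGroupTwoTorsion O) := by
  have hN : (cubicDisc f).natAbs < ((cubicDisc f).natAbs + 1) ^ 2 := by nlinarith
  have h1 : ∀ m, torsionNumber m f = Nat.card (torsionIdeals O m) := by
    intro m
    rcases Nat.eq_zero_or_pos m with rfl | hm
    · rw [torsionNumber_zero, eq_comm, Nat.card_eq_zero]
      exact Or.inl ⟨fun J => J.2.1.ne' rfl⟩
    · have : NeZero m := ⟨hm.ne'⟩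
      exact (h.card_torsionIdeals m).symm
  rw [h.idealGroupTwoTorsion_eq_sum hf hN, Nat.cast_sum]
  simp only [h1]
  refine hasSum_sum_of_ne_finset_zero fun m hm => ?_
  rw [Finset.mem_range, not_lt] at hm
  rw [h.torsionIdeals_eq_empty hf (hN.trans_le (Nat.pow_le_pow_left hm 2))]
  simp

namespace IsFormSystem

variable {ι : Type*} {pos : Bool} {F : ι → Fin 4 → ℤ}

theorem torsionSum_one (hF : IsFormSystem pos F) (X : ℝ) :
    hF.torsionSum 1 X = (hF.indices X).card := by
  simp [torsionSum, torsionNumber_one]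

/-- The average over a form system of the sum over `m` of `torsionNumber m`. -/
theorem tendsto_average (hF : IsFormSystem pos F) {A : ι → ℝ}
    (hA : ∀ i, HasSum (fun m => (torsionNumber m (F i) : ℝ)) (A i)) :
    Tendsto (fun X : ℝ => (∑ i ∈ hF.indices X, A i) / (hF.indices X).card) atTop
      (𝓝 (15 / Real.pi ^ 2)) := by
  obtain ⟨V, hV, hlim⟩ := hF.exists_tendsto_torsionSum
  have hsum : ∀ X, HasSum (fun m => hF.torsionSum m X) (∑ i ∈ hF.indices X, A i) := fun X =>
    hasSum_sum fun i _ => hA i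
  have hzero : ∀ X, hF.torsionSum 0 X = 0 := fun X => by simp [torsionSum, torsionNumber_zero]
  have h1 : Tendsto (fun t : ℝ => ∑' m, hF.torsionSum m (t ^ 4) / t ^ 4) atTop
      (𝓝 (∑' m, torsionMean m * V)) := by
    refine tendsto_tsum_of_dominated_convergence (bound := fun m => 840 * tailWeight 4 m)
      ((summable_tailWeight (by norm_num)).mul_left 840) ?_ ?_
    · intro m
      rcases Nat.eq_zero_or_pos m with rfl | hm
      · simp [hzero, torsionMean]
      · exact hlim m hm.ne'
    · filter_upwards [eventually_gt_atTop 0] with t ht m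
      have ht4 : 0 < t ^ 4 := pow_pos ht 4
      have h0 : 0 ≤ hF.torsionSum m (t ^ 4) := Finset.sum_nonneg fun i _ => Nat.cast_nonneg _
      rw [Real.norm_of_nonneg (div_nonneg h0 ht4.le), div_le_iff₀ ht4]
      rcases Nat.eq_zero_or_pos m with rfl | hm
      · rw [hzero]
        have := tailWeight_nonneg (K := 4) (by norm_num) 0
        positivity
      · have : NeZero m := ⟨hm.ne'⟩
        have := hF.torsionSum_le_tailWeight m ht4.le
        linarith
  have h2 := hlim 1 one_ne_zero
  rw [torsionMean_one, one_mul] at h2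
  have h3 := h1.div h2 hV.ne'
  rw [tsum_mul_right, tsum_torsionMean, mul_div_cancel_right₀ _ hV.ne'] at h3
  have h4 := h3.comp (tendsto_rpow_atTop (y := (1 : ℝ) / 4) (by norm_num))
  refine h4.congr' ?_
  filter_upwards [eventually_gt_atTop 0] with X hX
  have hX4 : (X ^ ((1 : ℝ) / 4)) ^ 4 = X := by
    rw [← Real.rpow_natCast, ← Real.rpow_mul hX.le]; norm_num
  simp only [Pi.div_apply, Function.comp_apply, hX4]
  rw [tsum_div_const, (hsum X).tsum_eq, torsionSum_one, div_div_div_cancel_right₀ hX.ne']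

end IsFormSystem

end

/-- **Average `2`-torsion in ideal groups of cubic orders (Theorem 1.7a).**
Let `O i` (`i ∈ ι`) be a set of representatives for the isomorphism classes of irreducible
cubic orders of positive discriminant (`pos = true`), resp. negative discriminant
(`pos = false`).  Then, as `X → ∞`, the average of `#I(O)[2]` over the `O i` with
`|disc (O i)| < X` tends to `ζ(2)/ζ(4) = 15/π²`. -/
theorem average_two_torsion_ideal_group_cubic_orders (pos : Bool)
    (ι : Type) (O : ι → Type) [∀ i, CommRing (O i)]
    [∀ i, Module.Free ℤ (O i)] [∀ i, Module.Finite ℤ (O i)]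
    (hcubic : ∀ i, IsIrredCubicOrder (O i))
    (hsign : ∀ i, if pos then 0 < ringDisc (O i) else ringDisc (O i) < 0)
    (hrep : ∀ (O' : Type) [CommRing O'] [Module.Free ℤ O'] [Module.Finite ℤ O'],
      IsIrredCubicOrder O' → (if pos then 0 < ringDisc O' else ringDisc O' < 0) →
      ∃! i : ι, Nonempty (O' ≃+* O i)) :
    Filter.Tendsto (fun X : ℝ =>
        (∑' i : {i : ι // |(ringDisc (O i) : ℝ)| < X},
            (idealGroupTwoTorsion (O (i : ι)) : ℝ)) /
          (Nat.card {i : ι // |(ringDisc (O i) : ℝ)| < X} : ℝ))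
      Filter.atTop (nhds (15 / Real.pi ^ 2)) := by
  have hsign_iff : ∀ d : ℤ, (if pos then 0 < d else d < 0) ↔ 0 < discSign pos * (d : ℝ) := by
    intro d
    cases pos <;> simp [discSign]
  have key : ∀ i, ∃ (f : Fin 4 → ℤ) (w t : O i), IsFormBasis f w t ∧
      IsReducedForm pos (castForm f) := by
    intro i
    have := (hcubic i).isDomain
    obtain ⟨f, w, t, h⟩ := exists_isFormBasis (O i) (hcubic i).1
    obtain ⟨g, hfg, hg⟩ := exists_isReduced h.cubicIrred (by
      rw [← hsign_iff, ← h.ringDisc_eq]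
      exact hsign i)
    obtain ⟨w', t', h'⟩ := h.exists_of_cubicEquiv hfg
    exact ⟨g, w', t', h', hg⟩
  choose F w t hbasis hred using key
  have hF : IsFormSystem pos F := by
    refine ⟨fun i => ?_, hred, fun i => ?_, fun f hf hd => ?_⟩
    · have := (hcubic i).isDomain
      exact (hbasis i).cubicIrred
    · rw [← hsign_iff, ← (hbasis i).ringDisc_eq]
      exact hsign i
    · have hb := CubicRing.isFormBasis f
      rw [← hsign_iff, ← hb.ringDisc_eq] at hd
      obtain ⟨i, hi, huniq⟩ := hrep (CubicRing f) (CubicRing.isIrredCubicOrder hf) hd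
      exact ⟨i, (hb.exists_of_isFormBasis (hbasis i)).1 hi, fun j hj =>
        huniq j ((hb.exists_of_isFormBasis (hbasis j)).2 hj)⟩
  have hdisc : ∀ i, cubicDisc (F i) ≠ 0 := by
    intro i h0
    have := hF.disc_pos i
    rw [h0] at this
    simp at this
  have hlim := hF.tendsto_average (A := fun i => (idealGroupTwoTorsion (O i) : ℝ)) fun i => by
    have := (hcubic i).isDomain
    exact (hbasis i).hasSum_torsionNumber (hdisc i)
  refine hlim.congr fun X => ?_
  have hmem : ∀ i, i ∈ hF.indices X ↔ |(ringDisc (O i) : ℝ)| < X := by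
    intro i
    have h := hF.disc_pos i
    rw [hF.mem_indices, (hbasis i).ringDisc_eq, ← abs_of_pos h, abs_mul]
    rcases discSign_eq_or pos with e | e <;> rw [e] <;> simp
  let e := Equiv.subtypeEquivRight hmem
  rw [← Nat.card_congr e, ← e.tsum_eq, Nat.card_eq_fintype_card, Fintype.card_coe, tsum_fintype]
  congr 1
  exact (Finset.sum_coe_sort (hF.indices X) fun i => (idealGroupTwoTorsion (O i) : ℝ)).symm
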